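/- Let T be a normal combinatorially two-orbit LFC tiling of ℝ². Then the face poset of T is order-isomorphic to the face poset of the trihexagonal tiling or to the face poset of the rhombille tiling. -/

import Mathlib

/-! Generic definitions about flags, flag orbits, and abstract polytopes. -/

variable {α : Type*} [PartialOrder α]

/-- Two flags (maximal chains) are in the same orbit of the automorphism group
(the group of order automorphisms) if some order automorphism maps one onto the other. -/
def SameFlagOrbit (Φ Ψ : Flag α) : Prop :=
  ∃ γ : α ≃o α, γ '' (Φ : Set α) = (Ψ : Set α)

/-- The automorphism group has exactly two orbits on the flags. -/
def TwoFlagOrbits (α : Type*) [PartialOrder α] : Prop :=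
  ∃ Φ Ψ : Flag α, ¬ SameFlagOrbit Φ Ψ ∧
    ∀ Ω : Flag α, SameFlagOrbit Ω Φ ∨ SameFlagOrbit Ω Ψ

/-- `Ψ` is the flag `Φ^i`: it differs from `Φ` in exactly the rank-`i` element
(with respect to the rank function `rk`). -/
def IsIAdjacent (rk : α → ℤ) (i : ℤ) (Φ Ψ : Flag α) : Prop :=
  Φ ≠ Ψ ∧ ∀ x : α, rk x ≠ i → (x ∈ Φ ↔ x ∈ Ψ)

/-- A two-orbit polytope (with rank function `rk`, adjacency indices `0, …, n-1`)
is in class `2_I` if, for every flag `Φ` and every `i < n`, the `i`-adjacent flag `Φ^i`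
lies in the same orbit as `Φ` exactly when `i ∈ I`. -/
def InClass (rk : α → ℤ) (n : ℕ) (I : Set ℕ) : Prop :=
  TwoFlagOrbits α ∧
    ∀ (Φ Ψ : Flag α) (i : ℕ), i < n → IsIAdjacent rk i Φ Ψ →
      (SameFlagOrbit Φ Ψ ↔ i ∈ I)

/-- An abstract polytope of rank `d`: a bounded poset, graded by a rank function `rk`
taking values `-1, 0, …, d`, in which every flag (maximal chain) has exactly one element
of each rank, satisfying the diamond condition and strong flag-connectivity. -/
structure IsAbstractPolytope (α : Type*) [PartialOrder α] [BoundedOrder α]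
    (rk : α → ℤ) (d : ℕ) : Prop where
  rk_bot : rk ⊥ = -1
  rk_top : rk ⊤ = d
  rk_strictMono : StrictMono rk
  rk_cover : ∀ x y : α, x ⋖ y → rk y = rk x + 1
  flag_ranks : ∀ (Φ : Flag α) (i : ℤ), -1 ≤ i → i ≤ d → ∃! x, x ∈ Φ ∧ rk x = i
  diamond : ∀ x y : α, x < y → rk y = rk x + 2 →
    ∃ a b : α, a ≠ b ∧ ∀ z : α, (x < z ∧ z < y) ↔ (z = a ∨ z = b)
  connected : ∀ Φ Ψ : Flag α, ∃ (n : ℕ) (c : Fin (n + 1) → Flag α),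
    c 0 = Φ ∧ c (Fin.last n) = Ψ ∧
    (∀ k : Fin n, ∃ i : ℤ, IsIAdjacent rk i (c k.castSucc) (c k.succ)) ∧
    (∀ k, (Φ : Set α) ∩ (Ψ : Set α) ⊆ (c k : Set α))
/-! Definitions about convex polytopes and their face lattices. -/

/-- Euclidean `d`-space. -/
abbrev EucSp (d : ℕ) : Type := EuclideanSpace ℝ (Fin d)

/-- A convex `d`-polytope: the convex hull of a finite set of points of `ℝ^d`,
with nonempty interior. -/
def IsConvexPolytope {d : ℕ} (P : Set (EucSp d)) : Prop :=
  (∃ S : Finset (EucSp d), P = convexHull ℝ (S : Set (EucSp d))) ∧ (interior P).Nonempty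

/-- The face lattice of `P`: the exposed faces of `P` (intersections of `P` with supporting
hyperplanes, together with `∅` and `P` itself), ordered by inclusion. -/
def Faces {d : ℕ} (P : Set (EucSp d)) : Type := {F : Set (EucSp d) // IsExposed ℝ P F}

noncomputable instance {d : ℕ} (P : Set (EucSp d)) : PartialOrder (Faces P) :=
  Subtype.partialOrder _

open scoped Classical

/-- The rank of a face: `-1` for the empty face, and otherwise its affine dimension. -/
noncomputable def faceRank {d : ℕ} {P : Set (EucSp d)} (F : Faces P) : ℤ :=
  if F.1 = ∅ then -1
  else (Module.finrank ℝ (affineSpan ℝ F.1).direction : ℤ)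
/-! Definitions about locally finite face-to-face tilings of Euclidean space by convex
polytopes (LFC tilings) and their face posets. -/

/-- An LFC tiling of `ℝ^d`: a face-to-face, locally finite tiling of `ℝ^d` by convex
`d`-polytopes. -/
structure IsLFCTiling {d : ℕ} (T : Set (Set (EucSp d))) : Prop where
  /-- Every tile is a convex `d`-polytope. -/
  polytope : ∀ t ∈ T, IsConvexPolytope t
  /-- The tiles cover all of `ℝ^d`. -/
  covers : ⋃₀ T = Set.univ
  /-- The tiling is face-to-face: the intersection of any two tiles is a
  (possibly empty) face of each. -/
  face_to_face : ∀ t ∈ T, ∀ s ∈ T, IsExposed ℝ t (t ∩ s) ∧ IsExposed ℝ s (t ∩ s)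
  /-- The tiling is locally finite: every bounded set meets only finitely many tiles. -/
  locally_finite : ∀ B : Set (EucSp d), Bornology.IsBounded B →
    {t ∈ T | (t ∩ B).Nonempty}.Finite

/-- The faces of the tiling `T`: all faces of all tiles (the empty face included). -/
def TFace {d : ℕ} (T : Set (Set (EucSp d))) : Type :=
  {F : Set (EucSp d) // ∃ t ∈ T, IsExposed ℝ t F}

noncomputable instance {d : ℕ} (T : Set (Set (EucSp d))) : PartialOrder (TFace T) :=
  Subtype.partialOrder _

/-- The face poset of the tiling `T`: all faces of all tiles, together with a greatest
element, ordered by inclusion.  It is an abstract polytope of rank `d + 1`. -/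
abbrev TPoset {d : ℕ} (T : Set (Set (EucSp d))) : Type := WithTop (TFace T)

/-- The rank of a subset of `ℝ^d` regarded as a face: `-1` for the empty face, and
otherwise its affine dimension. -/
noncomputable def setRank {d : ℕ} (F : Set (EucSp d)) : ℤ :=
  if F = ∅ then -1 else (Module.finrank ℝ (affineSpan ℝ F).direction : ℤ)

/-- The rank function of the face poset of a tiling of `ℝ^d`: faces get their affine
dimension (`-1` for the empty face), and the greatest element gets rank `d + 1`. -/
noncomputable def tileRank {d : ℕ} (T : Set (Set (EucSp d))) : TPoset T → ℤ :=
  WithTop.recTopCoe ((d : ℤ) + 1) (fun F => setRank F.1)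

/-- A tiling is normal if its tiles are uniformly bounded: for some `u, U > 0`, every tile
contains a ball of radius `u` and is contained in a ball of radius `U`. -/
def IsNormalTiling {d : ℕ} (T : Set (Set (EucSp d))) : Prop :=
  ∃ u U : ℝ, 0 < u ∧ 0 < U ∧ ∀ t ∈ T,
    (∃ x, Metric.closedBall x u ⊆ t) ∧ (∃ x, t ⊆ Metric.closedBall x U)
/-! The trihexagonal tiling and the rhombille tiling of the plane. -/

/-- The point `(a, b)` of the Euclidean plane. -/
noncomputable def pt2 (a b : ℝ) : EucSp 2 := (WithLp.equiv 2 (Fin 2 → ℝ)).symm ![a, b]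

/-- A unit-edge regular hexagon centered at the origin. -/
noncomputable def hexTile : Set (EucSp 2) :=
  convexHull ℝ {pt2 1 0, pt2 (1/2) (Real.sqrt 3 / 2), pt2 (-(1/2)) (Real.sqrt 3 / 2),
    pt2 (-1) 0, pt2 (-(1/2)) (-(Real.sqrt 3 / 2)), pt2 (1/2) (-(Real.sqrt 3 / 2))}

/-- A unit-edge equilateral triangle filling the gap above the vertex `(1,0)` of
`hexTile`. -/
noncomputable def triTileUp : Set (EucSp 2) :=
  convexHull ℝ {pt2 1 0, pt2 (1/2) (Real.sqrt 3 / 2), pt2 (3/2) (Real.sqrt 3 / 2)}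

/-- A unit-edge equilateral triangle filling the gap below the vertex `(1,0)` of
`hexTile`. -/
noncomputable def triTileDown : Set (EucSp 2) :=
  convexHull ℝ {pt2 1 0, pt2 (1/2) (-(Real.sqrt 3 / 2)), pt2 (3/2) (-(Real.sqrt 3 / 2))}

/-- The triangular lattice of hexagon centers of the trihexagonal tiling. -/
noncomputable def trihexLattice : Set (EucSp 2) :=
  {v | ∃ a b : ℤ, v = a • pt2 2 0 + b • pt2 1 (Real.sqrt 3)}

/-- The trihexagonal tiling: the edge-to-edge tiling of the plane by unit-edge equilateral
triangles and unit-edge regular hexagons in which two triangles and two hexagons alternate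
around every vertex. -/
noncomputable def TrihexagonalTiling : Set (Set (EucSp 2)) :=
  {t | ∃ v ∈ trihexLattice,
    (t = (fun x => x + v) '' hexTile ∨ t = (fun x => x + v) '' triTileUp ∨
     t = (fun x => x + v) '' triTileDown)}

/-- A rhombus with angles `60°` and `120°`, with an obtuse corner at the origin. -/
noncomputable def rhombTile1 : Set (EucSp 2) :=
  convexHull ℝ {pt2 0 0, pt2 (Real.sqrt 3 / 2) (1/2), pt2 0 1, pt2 (-(Real.sqrt 3 / 2)) (1/2)}

/-- `rhombTile1` rotated by `120°` about the origin. -/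
noncomputable def rhombTile2 : Set (EucSp 2) :=
  convexHull ℝ {pt2 0 0, pt2 (-(Real.sqrt 3 / 2)) (1/2), pt2 (-(Real.sqrt 3 / 2)) (-(1/2)),
    pt2 0 (-1)}

/-- `rhombTile1` rotated by `240°` about the origin. -/
noncomputable def rhombTile3 : Set (EucSp 2) :=
  convexHull ℝ {pt2 0 0, pt2 0 (-1), pt2 (Real.sqrt 3 / 2) (-(1/2)),
    pt2 (Real.sqrt 3 / 2) (1/2)}

/-- The lattice of translations of the rhombille tiling. -/
noncomputable def rhombilleLattice : Set (EucSp 2) :=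
  {v | ∃ a b : ℤ, v = a • pt2 (Real.sqrt 3) 0 + b • pt2 (Real.sqrt 3 / 2) (3/2)}

/-- The rhombille tiling: the edge-to-edge tiling of the plane by congruent rhombi with
angles `60°` and `120°`, with three tiles meeting at each obtuse vertex and six at each
acute vertex; it is the dual of the trihexagonal tiling. -/
noncomputable def RhombilleTiling : Set (Set (EucSp 2)) :=
  {t | ∃ v ∈ rhombilleLattice,
    (t = (fun x => x + v) '' rhombTile1 ∨ t = (fun x => x + v) '' rhombTile2 ∨
     t = (fun x => x + v) '' rhombTile3)}

section mywork

open scoped Classical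

/-! ### Linear functionals and polygons in the plane -/

/-- The functional `x ↦ a x₀ + b x₁`. -/
noncomputable def lin (a b : ℝ) : StrongDual ℝ (EucSp 2) :=
  a • (EuclideanSpace.proj 0 : EucSp 2 →L[ℝ] ℝ) + b • (EuclideanSpace.proj 1 : EucSp 2 →L[ℝ] ℝ)

@[simp] lemma lin_apply (a b : ℝ) (x : EucSp 2) : lin a b x = a * x 0 + b * x 1 := by
  simp [lin]

lemma dual_eq_lin (l : StrongDual ℝ (EucSp 2)) : ∃ a b, l = lin a b := by
  refine ⟨l (EuclideanSpace.single 0 1), l (EuclideanSpace.single 1 1), ?_⟩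
  ext x
  have : x = x 0 • EuclideanSpace.single (0 : Fin 2) (1 : ℝ)
      + x 1 • EuclideanSpace.single (1 : Fin 2) (1 : ℝ) := by
    ext i; fin_cases i <;> simp
  conv_lhs => rw [this]
  simp [mul_comm]

lemma lin_ne_zero {a b : ℝ} (h : lin a b ≠ 0) : 0 < a ^ 2 + b ^ 2 := by
  by_contra hc
  have ha : a = 0 := by nlinarith [sq_nonneg a, sq_nonneg b]
  have hb : b = 0 := by nlinarith [sq_nonneg a, sq_nonneg b]
  apply h; ext x; simp [ha, hb]

lemma ext2 {x y : EucSp 2} (h0 : x 0 = y 0) (h1 : x 1 = y 1) : x = y := by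
  ext i; fin_cases i <;> assumption

/-- If a nonzero functional is bounded by `c` on `t`, then it is `< c` at interior points. -/
lemma lt_of_interior {t : Set (EucSp 2)} {l : StrongDual ℝ (EucSp 2)} (hl : l ≠ 0) {c : ℝ}
    (hc : ∀ x ∈ t, l x ≤ c) {x : EucSp 2} (hx : x ∈ interior t) : l x < c := by
  obtain ⟨y, hy⟩ : ∃ y, l y ≠ 0 := by
    by_contra h; push Not at h; exact hl (by ext x; simpa using h x)
  have hcont : Filter.Tendsto (fun s : ℝ => x + s • (l y • y)) (nhds 0) (nhds x) := by
    have : Continuous (fun s : ℝ => x + s • (l y • y)) := by fun_prop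
    simpa using this.tendsto 0
  have h1 := hcont.eventually (isOpen_interior.mem_nhds hx)
  have h2 : ∀ᶠ s : ℝ in nhdsWithin 0 (Set.Ioi 0), x + s • (l y • y) ∈ interior t :=
    h1.filter_mono nhdsWithin_le_nhds
  obtain ⟨s, hs, hs0⟩ := (h2.and self_mem_nhdsWithin).exists
  have := hc _ (interior_subset hs)
  simp only [map_add, map_smul, smul_eq_mul] at this
  have hp : 0 < s * (l y * l y) := mul_pos hs0 (mul_self_pos.2 hy)
  linarith

section poly
variable {t : Set (EucSp 2)}

lemma IsConvexPolytope.convex' (ht : IsConvexPolytope t) : Convex ℝ t := by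
  obtain ⟨⟨S, rfl⟩, _⟩ := ht
  exact convex_convexHull _ _

lemma IsConvexPolytope.compact' (ht : IsConvexPolytope t) : IsCompact t := by
  obtain ⟨⟨S, rfl⟩, _⟩ := ht
  exact S.finite_toSet.isCompact_convexHull (𝕜 := ℝ)

lemma IsConvexPolytope.nonempty' (ht : IsConvexPolytope t) : t.Nonempty :=
  ht.2.mono interior_subset

lemma IsConvexPolytope.finite_ext (ht : IsConvexPolytope t) : (t.extremePoints ℝ).Finite := by
  obtain ⟨⟨S, rfl⟩, _⟩ := ht
  exact S.finite_toSet.subset extremePoints_convexHull_subset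

/-- A proper nonempty face comes from a nonzero functional. -/
lemma proper_face {F : Set (EucSp 2)} (hF : IsExposed ℝ t F) (hne : F.Nonempty) (hFt : F ≠ t) :
    ∃ (l : StrongDual ℝ (EucSp 2)) (c : ℝ), l ≠ 0 ∧ (∀ x ∈ t, l x ≤ c) ∧
      F = {x ∈ t | l x = c} := by
  obtain ⟨l, hl⟩ := hF hne
  obtain ⟨x0, hx0⟩ := hne
  have hx0' := hx0
  rw [hl] at hx0'
  refine ⟨l, l x0, ?_, hx0'.2, ?_⟩
  · rintro rfl
    apply hFt; rw [hl]; ext x; simp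
  · rw [hl]; ext x
    constructor
    · rintro ⟨h1, h2⟩
      exact ⟨h1, le_antisymm (hx0'.2 x h1) (h2 x0 hx0'.1)⟩
    · rintro ⟨h1, h2⟩
      exact ⟨h1, fun y hy => h2 ▸ hx0'.2 y hy⟩

lemma exposed_of_lin {l : StrongDual ℝ (EucSp 2)} {c : ℝ} (h : ∀ x ∈ t, l x ≤ c) :
    IsExposed ℝ t {x ∈ t | l x = c} := by
  rintro ⟨x0, hx0, hx0c⟩
  refine ⟨l, ?_⟩
  ext x
  constructor
  · rintro ⟨h1, h2⟩
    exact ⟨h1, fun y hy => h2 ▸ h y hy⟩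
  · rintro ⟨h1, h2⟩
    exact ⟨h1, le_antisymm (h x h1) (hx0c ▸ h2 x0 hx0)⟩

lemma proper_not_interior {F : Set (EucSp 2)} (hF : IsExposed ℝ t F) (hFt : F ≠ t) {x}
    (hx : x ∈ F) : x ∉ interior t := by
  intro hi
  obtain ⟨l, c, hl, h1, h2⟩ := proper_face hF ⟨x, hx⟩ hFt
  rw [h2] at hx
  exact absurd hx.2 (lt_of_interior hl h1 hi).ne

/-- A compact convex subset of a line is a segment. -/
lemma seg_of_line {F : Set (EucSp 2)} (hc : IsCompact F) (hconv : Convex ℝ F) (hne : F.Nonempty)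
    {l : StrongDual ℝ (EucSp 2)} (hl : l ≠ 0) {c : ℝ} (h : ∀ x ∈ F, l x = c) :
    ∃ v w, F = segment ℝ v w := by
  obtain ⟨a, b, rfl⟩ := dual_eq_lin l
  have hab := lin_ne_zero hl
  have hcont : ContinuousOn (fun x => lin (-b) a x) F := (lin (-b) a).continuous.continuousOn
  obtain ⟨v, hv, hvm⟩ := hc.exists_isMinOn hne hcont
  obtain ⟨w, hw, hwm⟩ := hc.exists_isMaxOn hne hcont
  refine ⟨v, w, Set.Subset.antisymm ?_ (hconv.segment_subset hv hw)⟩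
  intro x hx
  have h1 : lin (-b) a v ≤ lin (-b) a x := hvm hx
  have h2 : lin (-b) a x ≤ lin (-b) a w := hwm hx
  have hxc := h x hx
  have hvc := h v hv
  have hwc := h w hw
  simp only [lin_apply] at *
  have key : ∀ y z : EucSp 2, a * y 0 + b * y 1 = a * z 0 + b * z 1 →
      -b * y 0 + a * y 1 = -b * z 0 + a * z 1 → y = z := by
    intro y z e1 e2
    refine ext2 ?_ ?_
    · have : (a ^ 2 + b ^ 2) * (y 0 - z 0) = 0 := by linear_combination a * e1 - b * e2
      rcases mul_eq_zero.1 this with h | h <;> linarith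
    · have : (a ^ 2 + b ^ 2) * (y 1 - z 1) = 0 := by linear_combination b * e1 + a * e2
      rcases mul_eq_zero.1 this with h | h <;> linarith
  set mv := -b * v 0 + a * v 1 with hmv
  set mw := -b * w 0 + a * w 1 with hmw
  set mx := -b * x 0 + a * x 1 with hmx
  by_cases he : mv = mw
  · have : x = v := key x v (by linarith) (by linarith)
    rw [this]; exact left_mem_segment ℝ v w
  · have hlt : 0 < mw - mv := by
      have : mv ≤ mw := h1.trans h2
      have := lt_of_le_of_ne this he
      linarith
    rw [segment_eq_image']
    refine ⟨(mx - mv) / (mw - mv), ⟨div_nonneg (by linarith) hlt.le,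
      (div_le_one hlt).2 (by linarith)⟩, ?_⟩
    refine key _ _ ?_ ?_
    · simp only [PiLp.add_apply, PiLp.smul_apply, PiLp.sub_apply, smul_eq_mul]
      linear_combination hvc + (mx - mv) / (mw - mv) * (hwc - hvc) - hxc
    · simp only [PiLp.add_apply, PiLp.smul_apply, PiLp.sub_apply, smul_eq_mul]
      have e : (mx - mv) / (mw - mv) * (mw - mv) = mx - mv := div_mul_cancel₀ _ hlt.ne'
      have : -b * (v 0 + (mx - mv) / (mw - mv) * (w 0 - v 0)) +
          a * (v 1 + (mx - mv) / (mw - mv) * (w 1 - v 1)) =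
          mv + (mx - mv) / (mw - mv) * (mw - mv) := by rw [hmv, hmw]; ring
      rw [this, e]; ring

lemma face_segment (ht : IsConvexPolytope t) {F : Set (EucSp 2)} (hF : IsExposed ℝ t F)
    (hne : F.Nonempty) (hFt : F ≠ t) : ∃ v w, F = segment ℝ v w := by
  obtain ⟨l, c, hl, h1, h2⟩ := proper_face hF hne hFt
  refine seg_of_line (hF.isCompact ht.compact') (hF.convex ht.convex') hne hl (c := c) ?_
  intro x hx; rw [h2] at hx; exact hx.2

lemma left_ext_segment (v w : EucSp 2) : v ∈ (segment ℝ v w).extremePoints ℝ := by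
  rw [mem_extremePoints_iff_left]
  refine ⟨left_mem_segment ℝ v w, ?_⟩
  rw [segment_eq_image']
  rintro _ ⟨a, ha, rfl⟩ _ ⟨b, hb, rfl⟩ ⟨p, q, hp, hq, hpq, e⟩
  by_cases hvw : w - v = 0
  · simp [hvw]
  have e2 : (p * a + q * b) • (w - v) = 0 := by
    have : p • (v + a • (w - v)) + q • (v + b • (w - v)) =
      (p + q) • v + (p * a + q * b) • (w - v) := by module
    simp only [] at e
    rw [this, hpq, one_smul] at e
    simpa using e
  have : p * a + q * b = 0 := (smul_eq_zero.1 e2).resolve_right hvw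
  have ha0 : a = 0 := by nlinarith [mul_nonneg hp.le ha.1, mul_nonneg hq.le hb.1]
  simp [ha0]

lemma exposed_seg_ext {v w : EucSp 2} (h : IsExposed ℝ t (segment ℝ v w)) :
    v ∈ t.extremePoints ℝ ∧ w ∈ t.extremePoints ℝ :=
  ⟨h.isExtreme.extremePoints_subset_extremePoints (left_ext_segment v w),
   h.isExtreme.extremePoints_subset_extremePoints
    (by rw [segment_symm]; exact left_ext_segment w v)⟩

lemma seg_ne_poly (ht : IsConvexPolytope t) (v w : EucSp 2) : segment ℝ v w ≠ t := by
  intro h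
  obtain ⟨x, hx⟩ := ht.2
  -- the functional `cross (w - v)`, or any functional if `v = w`
  obtain ⟨l, hl, hlvw⟩ : ∃ l : StrongDual ℝ (EucSp 2), l ≠ 0 ∧ l v = l w := by
    by_cases hvw : v = w
    · refine ⟨lin 1 0, ?_, by rw [hvw]⟩
      intro h0
      have := congrArg (fun l => l (pt2 1 0)) h0
      simp [pt2] at this
    · refine ⟨lin (v 1 - w 1) (w 0 - v 0), ?_, by simp; ring⟩
      intro h0
      have e0 := congrArg (fun l => l (pt2 1 0)) h0
      have e1 := congrArg (fun l => l (pt2 0 1)) h0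
      simp [pt2] at e0 e1
      exact hvw (ext2 (by linarith) (by linarith))
  have hall : ∀ y ∈ t, l y = l v := by
    rw [← h]
    rintro y ⟨p, q, hp, hq, hpq, rfl⟩
    simp only [map_add, map_smul, smul_eq_mul, ← hlvw]
    rw [← add_mul, hpq, one_mul]
  exact absurd (hall x (interior_subset hx))
    (lt_of_interior hl (c := l v) (fun y hy => (hall y hy).le) hx).ne

/-- A proper face through two points `v ≠ w` where `[v,w]` is a face equals `[v,w]`. -/
lemma face_eq_seg (ht : IsConvexPolytope t) {v w : EucSp 2} (hvw : v ≠ w)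
    (h : IsExposed ℝ t (segment ℝ v w)) {F : Set (EucSp 2)} (hF : IsExposed ℝ t F) (hFt : F ≠ t)
    (hv : v ∈ F) (hw : w ∈ F) : F = segment ℝ v w := by
  refine Set.Subset.antisymm ?_ ((hF.convex ht.convex').segment_subset hv hw)
  obtain ⟨l, c, hl, h1, h2⟩ := proper_face hF ⟨v, hv⟩ hFt
  obtain ⟨l', c', hl', h1', h2'⟩ := proper_face h ⟨v, left_mem_segment ℝ v w⟩ (seg_ne_poly ht v w)
  have hv' := left_mem_segment ℝ v w
  have hw' := right_mem_segment ℝ v w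
  intro x hx
  rw [h2'] at hv' hw' ⊢
  rw [h2] at hx hv hw
  refine ⟨hx.1, ?_⟩
  obtain ⟨a, b, rfl⟩ := dual_eq_lin l
  obtain ⟨a', b', rfl⟩ := dual_eq_lin l'
  have hab := lin_ne_zero hl
  have hv2 := hv.2; have hw2 := hw.2; have hx2 := hx.2; have hv2' := hv'.2; have hw2' := hw'.2
  simp only [lin_apply] at *
  have hne : w 0 - v 0 ≠ 0 ∨ w 1 - v 1 ≠ 0 := by
    by_contra hcon; push Not at hcon
    exact hvw (ext2 (by linarith [hcon.1]) (by linarith [hcon.2]))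
  have e1 : a * (w 0 - v 0) + b * (w 1 - v 1) = 0 := by linarith
  have e2 : a' * (w 0 - v 0) + b' * (w 1 - v 1) = 0 := by linarith
  have e3 : a * (x 0 - v 0) + b * (x 1 - v 1) = 0 := by linarith
  have det : a * b' - a' * b = 0 := by
    rcases hne with h | h
    · have : (a * b' - a' * b) * (w 0 - v 0) = 0 := by linear_combination b' * e1 - b * e2
      exact (mul_eq_zero.1 this).resolve_right h
    · have : (a * b' - a' * b) * (w 1 - v 1) = 0 := by linear_combination -a' * e1 + a * e2
      exact (mul_eq_zero.1 this).resolve_right h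
  have : (a ^ 2 + b ^ 2) * (a' * (x 0 - v 0) + b' * (x 1 - v 1)) = 0 := by
    linear_combination (a * a' + b * b') * e3 + (-(b * (x 0 - v 0)) + a * (x 1 - v 1)) * det
  have := (mul_eq_zero.1 this).resolve_left hab.ne'
  linarith

/-- A face containing the midpoint of a segment of `t` contains the ends. -/
lemma ends_of_midpoint {F : Set (EucSp 2)} (hF : IsExposed ℝ t F) {v w : EucSp 2} (hv : v ∈ t)
    (hw : w ∈ t) (hm : midpoint ℝ v w ∈ F) : v ∈ F ∧ w ∈ F := by
  have hm' : midpoint ℝ v w ∈ openSegment ℝ v w := by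
    refine ⟨1/2, 1/2, by norm_num, by norm_num, by norm_num, ?_⟩
    rw [midpoint_eq_smul_add]; simp
  exact ⟨hF.isExtreme.2 hv hw hm hm', hF.isExtreme.right_mem_of_mem_openSegment hv hw hm hm'⟩

/-- An extreme point of a polygon is strictly exposed. -/
lemma ext_exposing (ht : IsConvexPolytope t) {v : EucSp 2} (hv : v ∈ t.extremePoints ℝ) :
    ∃ l : StrongDual ℝ (EucSp 2), ∀ x ∈ t, x ≠ v → l x < l v := by
  obtain ⟨⟨S, rfl⟩, _⟩ := ht
  set C := convexHull ℝ ((S : Set (EucSp 2)) \ {v}) with hC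
  have hcv := (Convex.mem_extremePoints_iff_convex_sdiff (convex_convexHull ℝ _)).1 hv
  have hsub : C ⊆ convexHull ℝ (S : Set (EucSp 2)) \ {v} :=
    convexHull_min (fun x hx => ⟨subset_convexHull ℝ _ hx.1, hx.2⟩) hcv.2
  have hvC : v ∉ C := fun h => (hsub h).2 rfl
  have hCc : IsClosed C := ((S.finite_toSet.subset Set.sdiff_subset).isCompact_convexHull (𝕜 := ℝ)).isClosed
  obtain ⟨l, u, h1, h2⟩ := geometric_hahn_banach_closed_point (convex_convexHull ℝ _) hCc hvC
  refine ⟨l, ?_⟩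
  intro x hx hxv
  by_cases hSv : ((S : Set (EucSp 2)) \ {v}).Nonempty
  · have hS : convexHull ℝ (S : Set (EucSp 2)) ⊆ convexHull ℝ (insert v ((S : Set (EucSp 2)) \ {v})) :=
      convexHull_mono (by intro y hy; by_cases hyv : y = v <;> simp [hyv]; exact hy)
    have hx' := hS hx
    rw [convexHull_insert hSv, mem_convexJoin] at hx'
    obtain ⟨v', hv', y, hy, hxy⟩ := hx'
    rw [Set.mem_singleton_iff] at hv'
    subst hv'
    obtain ⟨p, q, hp, hq, hpq, rfl⟩ := hxy
    have hq0 : 0 < q := by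
      rcases hq.lt_or_eq with h | h
      · exact h
      · exfalso; apply hxv; rw [← h] at hpq ⊢; simp at hpq; simp [hpq]
    have := h1 y hy
    simp only [map_add, map_smul, smul_eq_mul]
    have hlt : l y < l v' := by linarith
    have : p = 1 - q := by linarith
    subst this
    nlinarith
  · exfalso
    rw [Set.not_nonempty_iff_eq_empty, Set.sdiff_eq_empty] at hSv
    have := convexHull_mono (𝕜 := ℝ) hSv hx
    simp at this
    exact hxv this

lemma ext_iff_exposed (ht : IsConvexPolytope t) {v : EucSp 2} :
    v ∈ t.extremePoints ℝ ↔ IsExposed ℝ t {v} := by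
  constructor
  · intro hv
    obtain ⟨l, hl⟩ := ext_exposing ht hv
    have : ({v} : Set (EucSp 2)) = {x ∈ t | l x = l v} := by
      ext x; constructor
      · rintro rfl; exact ⟨hv.1, rfl⟩
      · rintro ⟨h1, h2⟩
        by_contra h; exact absurd h2 (hl x h1 h).ne
    rw [this]
    refine exposed_of_lin ?_
    intro x hx
    by_cases h : x = v
    · rw [h]
    · exact (hl x hx h).le
  · intro h
    have := h.isExtreme
    rwa [isExtreme_singleton] at this

end poly

open scoped Classical

section poly
variable {t : Set (EucSp 2)}

lemma ext_seg_end {u a b : EucSp 2} (hu : u ∈ t.extremePoints ℝ) (ha : a ∈ t) (hb : b ∈ t)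
    (h : u ∈ segment ℝ a b) : u = a ∨ u = b := by
  rw [mem_extremePoints_iff_forall_segment] at hu
  rcases hu.2 a ha b hb h with h | h
  · exact Or.inl h.symm
  · exact Or.inr h.symm

lemma seg_left_inj {v w w' : EucSp 2} (hw : v ≠ w) (h : segment ℝ v w = segment ℝ v w') :
    w = w' := by
  have h1 : w ∈ (segment ℝ v w').extremePoints ℝ := by
    rw [← h, segment_symm]; exact left_ext_segment w v
  rcases ext_seg_end h1 (left_mem_segment ℝ v w') (right_mem_segment ℝ v w') h1.1 with h2 | h2
  · exact absurd h2.symm hw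
  · exact h2

lemma lin_key {a b : ℝ} (hab : 0 < a ^ 2 + b ^ 2) (y z : EucSp 2) (e1 : lin a b y = lin a b z)
    (e2 : lin (-b) a y = lin (-b) a z) : y = z := by
  simp only [lin_apply] at e1 e2
  refine ext2 ?_ ?_
  · have : (a ^ 2 + b ^ 2) * (y 0 - z 0) = 0 := by linear_combination a * e1 - b * e2
    rcases mul_eq_zero.1 this with h | h <;> linarith
  · have : (a ^ 2 + b ^ 2) * (y 1 - z 1) = 0 := by linear_combination b * e1 + a * e2
    rcases mul_eq_zero.1 this with h | h <;> linarith

lemma half_edge (ht : IsConvexPolytope t) {v : EucSp 2} (hv : v ∈ t.extremePoints ℝ)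
    {l m : StrongDual ℝ (EucSp 2)} (hl : ∀ x ∈ t, x ≠ v → l x < l v)
    (hm : ∀ σ : ℝ, m + σ • l ≠ 0) :
    ∃ (w : EucSp 2) (σ : ℝ), v ≠ w ∧ w ∈ t ∧ IsExposed ℝ t (segment ℝ v w) ∧
      m w - m v = σ * (l v - l w) ∧ ∀ x ∈ t, m x - m v ≤ σ * (l v - l x) := by
  obtain ⟨S, hS⟩ := ht.1
  have hSt : ∀ x ∈ S, x ∈ t := fun x hx => by rw [hS]; exact subset_convexHull ℝ _ hx
  have hne : (S.filter (fun x => x ≠ v)).Nonempty := by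
    by_contra hcon
    rw [Finset.not_nonempty_iff_eq_empty] at hcon
    have hsub : (S : Set (EucSp 2)) ⊆ {v} := by
      intro x hx
      by_contra hxv
      have : x ∈ S.filter (fun x => x ≠ v) := Finset.mem_filter.2 ⟨hx, hxv⟩
      rw [hcon] at this; simp at this
    apply seg_ne_poly ht v v
    rw [segment_same]
    refine Set.Subset.antisymm (by simpa using hv.1) ?_
    rw [hS]
    exact (convexHull_mono hsub).trans (by simp)
  obtain ⟨w, hw, hmax⟩ := Finset.exists_max_image _ (fun x => (m x - m v) / (l v - l x)) hne
  rw [Finset.mem_filter] at hw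
  set σ := (m w - m v) / (l v - l w) with hσ
  have hS' : ∀ x ∈ S, m x - m v ≤ σ * (l v - l x) := by
    intro x hx
    by_cases hxv : x = v
    · simp [hxv]
    · have h1 := hmax x (Finset.mem_filter.2 ⟨hx, hxv⟩)
      have h2 := hl x (hSt x hx) hxv
      rwa [div_le_iff₀ (by linarith)] at h1
  have hle : ∀ x ∈ t, (m + σ • l) x ≤ (m + σ • l) v := by
    intro x hx
    rw [hS] at hx
    have : convexHull ℝ (S : Set (EucSp 2)) ⊆ {x | (m + σ • l) x ≤ (m + σ • l) v} := by
      refine convexHull_min ?_ (convex_halfSpace_le (m + σ • l).toLinearMap.isLinear _)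
      intro x hx
      have := hS' x hx
      simp only [Set.mem_ofPred_eq, add_apply, smul_apply,
        smul_eq_mul]
      linarith
    exact this hx
  set F := {x ∈ t | (m + σ • l) x = (m + σ • l) v} with hF
  have hFe : IsExposed ℝ t F := exposed_of_lin hle
  have hvF : v ∈ F := ⟨hv.1, rfl⟩
  have hwF : w ∈ F := by
    refine ⟨hSt w hw.1, ?_⟩
    have h2 := hl w (hSt w hw.1) hw.2
    have : σ * (l v - l w) = m w - m v := div_mul_cancel₀ _ (by linarith)
    simp only [add_apply, smul_apply, smul_eq_mul]
    linarith
  have hFt : F ≠ t := by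
    intro h
    obtain ⟨x, hx⟩ := ht.2
    have h1 := lt_of_interior (hm σ) hle hx
    have h2 : x ∈ F := by rw [h]; exact interior_subset hx
    exact absurd h2.2 h1.ne
  obtain ⟨p, q, hpq⟩ := face_segment ht hFe ⟨v, hvF⟩ hFt
  obtain ⟨w', hw'⟩ : ∃ w', F = segment ℝ v w' := by
    have hp : p ∈ t := hFe.subset (by rw [hpq]; exact left_mem_segment ℝ p q)
    have hq : q ∈ t := hFe.subset (by rw [hpq]; exact right_mem_segment ℝ p q)
    rcases ext_seg_end hv hp hq (hpq ▸ hvF) with h | h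
    · exact ⟨q, by rw [h, hpq]⟩
    · exact ⟨p, by rw [h, hpq, segment_symm]⟩
  have hw'F : w' ∈ F := by rw [hw']; exact right_mem_segment ℝ v w'
  refine ⟨w', σ, ?_, hw'F.1, hw' ▸ hFe, ?_, ?_⟩
  · rintro rfl
    rw [hw', segment_same] at hwF
    exact hw.2 hwF
  · have := hw'F.2
    simp only [add_apply, smul_apply, smul_eq_mul] at this
    linarith
  · intro x hx
    have := hle x hx
    simp only [add_apply, smul_apply, smul_eq_mul] at this
    linarith

/-- A vertex of a polygon is on exactly two edges, which span the cone at the vertex. -/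
lemma vertex_edges (ht : IsConvexPolytope t) {v : EucSp 2} (hv : v ∈ t.extremePoints ℝ) :
    ∃ w₁ w₂ : EucSp 2, w₁ ≠ w₂ ∧ v ≠ w₁ ∧ v ≠ w₂ ∧ IsExposed ℝ t (segment ℝ v w₁) ∧
      IsExposed ℝ t (segment ℝ v w₂) ∧
      (∀ w, v ≠ w → IsExposed ℝ t (segment ℝ v w) → w = w₁ ∨ w = w₂) ∧
      (∀ x ∈ t, ∃ α β : ℝ, 0 ≤ α ∧ 0 ≤ β ∧ x - v = α • (w₁ - v) + β • (w₂ - v)) := by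
  obtain ⟨l, hl⟩ := ext_exposing ht hv
  obtain ⟨a, b, rfl⟩ := dual_eq_lin l
  have hab : 0 < a ^ 2 + b ^ 2 := by
    apply lin_ne_zero
    intro h0
    apply seg_ne_poly ht v v
    rw [segment_same]
    refine Set.Subset.antisymm (by simpa using hv.1) ?_
    intro x hx
    by_contra hxv
    have := hl x hx hxv
    rw [h0] at this
    simp at this
  have hind : ∀ s : ℝ, s ^ 2 = 1 → ∀ σ : ℝ, s • lin (-b) a + σ • lin a b ≠ 0 := by
    intro s hs σ h0
    have e0 := congrArg (fun l => l (pt2 (-b) a)) h0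
    simp [pt2] at e0
    have : s * (a ^ 2 + b ^ 2) = 0 := by linear_combination e0
    rcases mul_eq_zero.1 this with h | h
    · rw [h] at hs; norm_num at hs
    · exact hab.ne' h
  obtain ⟨w₁, σ₁, hw₁, hw₁t, he₁, hs₁, hc₁⟩ := half_edge ht hv hl (hind 1 (by norm_num))
  obtain ⟨w₂, σ₂, hw₂, hw₂t, he₂, hs₂, hc₂⟩ := half_edge ht hv hl (hind (-1) (by norm_num))
  simp only [smul_apply, smul_eq_mul, one_mul, neg_mul] at hs₁ hc₁ hs₂ hc₂
  have hL₁ := hl w₁ hw₁t hw₁.symm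
  have hL₂ := hl w₂ hw₂t hw₂.symm
  set l := lin a b
  set m := lin (-b) a
  have hσ : 0 < σ₁ + σ₂ := by
    by_contra hneg
    obtain ⟨x, hx⟩ := ht.2
    have hlt := lt_of_interior (t := t) (l := m + σ₁ • l) (c := m v + σ₁ * l v)
      (by have := hind 1 (by norm_num) σ₁; simpa using this)
      (by
        intro y hy
        have := hc₁ y hy
        simp only [add_apply, smul_apply, smul_eq_mul]
        linarith) hx
    simp only [add_apply, smul_apply, smul_eq_mul] at hlt
    have h2 := hc₂ x (interior_subset hx)
    have h3 : l x ≤ l v := by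
      by_cases h : x = v
      · rw [h]
      · exact (hl x (interior_subset hx) h).le
    nlinarith
  have hcone : ∀ x ∈ t, ∃ α β : ℝ, 0 ≤ α ∧ 0 ≤ β ∧ x - v = α • (w₁ - v) + β • (w₂ - v) := by
    intro x hx
    have h1 := hc₁ x hx
    have h2 := hc₂ x hx
    have p1 : 0 < (σ₁ + σ₂) * (l v - l w₁) := mul_pos hσ (by linarith)
    have p2 : 0 < (σ₁ + σ₂) * (l v - l w₂) := mul_pos hσ (by linarith)
    refine ⟨((m x - m v) + σ₂ * (l v - l x)) / ((σ₁ + σ₂) * (l v - l w₁)),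
      (σ₁ * (l v - l x) - (m x - m v)) / ((σ₁ + σ₂) * (l v - l w₂)),
      div_nonneg (by linarith) p1.le, div_nonneg (by linarith) p2.le, ?_⟩
    have q1 : l v - l w₁ ≠ 0 := by linarith
    have q2 : l v - l w₂ ≠ 0 := by linarith
    apply lin_key hab
    · simp only [map_add, map_smul, map_sub, smul_eq_mul]
      change l x - l v = _ * (l w₁ - l v) + _ * (l w₂ - l v)
      field_simp
      ring
    · simp only [map_add, map_smul, map_sub, smul_eq_mul]
      change m x - m v = _ * (m w₁ - m v) + _ * (m w₂ - m v)
      have e2 : m w₂ - m v = - (σ₂ * (l v - l w₂)) := by linarith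
      rw [hs₁, e2]
      field_simp
      ring
  have huniq : ∀ w', v ≠ w' → w' ∈ t → IsExposed ℝ t (segment ℝ v w') → ∀ w, v ≠ w →
      IsExposed ℝ t (segment ℝ v w) → w' ∈ segment ℝ v w → w = w' := by
    intro w' hw' _ he' w hw he hmem
    have := face_eq_seg ht hw' he' he (seg_ne_poly ht v w) (left_mem_segment ℝ v w) hmem
    exact seg_left_inj hw this
  refine ⟨w₁, w₂, ?_, hw₁, hw₂, he₁, he₂, ?_, hcone⟩
  · rintro rfl
    have : (σ₁ + σ₂) * (l v - l w₁) = 0 := by linarith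
    rcases mul_eq_zero.1 this with h | h <;> linarith
  · intro w hw he
    have hwt : w ∈ t := he.subset (right_mem_segment ℝ v w)
    obtain ⟨α, β, hα, hβ, e⟩ := hcone w hwt
    obtain ⟨l', c, hl', h1, h2⟩ := proper_face he ⟨v, left_mem_segment ℝ v w⟩ (seg_ne_poly ht v w)
    have hvF := left_mem_segment ℝ v w
    have hwF := right_mem_segment ℝ v w
    rw [h2] at hvF hwF
    have e' := congrArg l' e
    simp only [map_add, map_smul, map_sub, smul_eq_mul, hvF.2, hwF.2] at e'
    have i1 := h1 w₁ hw₁t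
    have i2 := h1 w₂ hw₂t
    have z1 : α * (c - l' w₁) = 0 := by
      nlinarith [mul_nonneg hα (sub_nonneg.2 i1), mul_nonneg hβ (sub_nonneg.2 i2)]
    have z2 : β * (c - l' w₂) = 0 := by
      nlinarith [mul_nonneg hα (sub_nonneg.2 i1), mul_nonneg hβ (sub_nonneg.2 i2)]
    by_cases hα0 : α = 0
    · right
      have hβ0 : β ≠ 0 := by
        rintro rfl
        rw [hα0] at e
        simp [sub_eq_zero] at e
        exact hw e.symm
      have := (mul_eq_zero.1 z2).resolve_left hβ0
      exact huniq w₂ hw₂ hw₂t he₂ w hw he (by rw [h2]; exact ⟨hw₂t, by linarith⟩)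
    · left
      have := (mul_eq_zero.1 z1).resolve_left hα0
      exact huniq w₁ hw₁ hw₁t he₁ w hw he (by rw [h2]; exact ⟨hw₁t, by linarith⟩)

end poly

open scoped Classical

section tiling
variable {T : Set (Set (EucSp 2))}

lemma IsLFCTiling.exists_tile (hT : IsLFCTiling T) (x : EucSp 2) : ∃ t ∈ T, x ∈ t := by
  have : x ∈ ⋃₀ T := by rw [hT.covers]; trivial
  simpa using this

lemma IsLFCTiling.inter_ne (hT : IsLFCTiling T) {t s} (ht : t ∈ T) (hs : s ∈ T) (hts : t ≠ s) :
    t ∩ s ≠ t := by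
  intro h
  have he := (hT.face_to_face t ht s hs).2
  rw [h] at he
  obtain ⟨l, c, hl, h1, h2⟩ := proper_face he (hT.polytope t ht).nonempty' hts
  obtain ⟨x, hx⟩ := (hT.polytope t ht).2
  have hsub : t ⊆ s := he.subset
  have := lt_of_interior hl (fun y hy => h1 y (hsub hy)) hx
  have hxt := interior_subset hx
  rw [h2] at hxt
  exact absurd hxt.2 this.ne

lemma IsLFCTiling.eq_of_interior (hT : IsLFCTiling T) {t s} (ht : t ∈ T) (hs : s ∈ T) {x}
    (hx : x ∈ interior t) (hxs : x ∈ s) : s = t := by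
  by_contra h
  exact proper_not_interior (hT.face_to_face t ht s hs).1
    (hT.inter_ne ht hs (Ne.symm h)) ⟨interior_subset hx, hxs⟩ hx

lemma IsLFCTiling.inter_seg (hT : IsLFCTiling T) {t s} (ht : t ∈ T) (hs : s ∈ T) (hts : t ≠ s)
    {y z} (hyz : y ≠ z) (hy : y ∈ t ∩ s) (hz : z ∈ t ∩ s) :
    ∃ v w, v ≠ w ∧ t ∩ s = segment ℝ v w := by
  obtain ⟨v, w, h⟩ := face_segment (hT.polytope t ht) (hT.face_to_face t ht s hs).1 ⟨y, hy⟩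
    (hT.inter_ne ht hs hts)
  refine ⟨v, w, ?_, h⟩
  rintro rfl
  rw [h, segment_same] at hy hz
  exact hyz (hy.trans hz.symm)

lemma IsLFCTiling.ext_transfer (hT : IsLFCTiling T) {t s} (ht : t ∈ T) (hs : s ∈ T) {v}
    (hv : v ∈ t.extremePoints ℝ) (hvs : v ∈ s) : v ∈ s.extremePoints ℝ := by
  have h1 : v ∈ (t ∩ s).extremePoints ℝ :=
    inter_extremePoints_subset_extremePoints_of_subset Set.inter_subset_left ⟨⟨hv.1, hvs⟩, hv⟩
  exact (hT.face_to_face t ht s hs).2.isExtreme.extremePoints_subset_extremePoints h1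

/-- Near `y` all tiles contain `y`. -/
lemma IsLFCTiling.loc (hT : IsLFCTiling T) (y : EucSp 2) :
    ∃ ε > 0, ∀ t ∈ T, (t ∩ Metric.ball y ε).Nonempty → y ∈ t := by
  have hfin := hT.locally_finite (Metric.ball y 1) Metric.isBounded_ball
  set A := ⋃ t ∈ {t ∈ {t ∈ T | (t ∩ Metric.ball y 1).Nonempty} | y ∉ t}, t with hA
  have hcl : IsClosed A := by
    refine Set.Finite.isClosed_biUnion (hfin.subset (fun t h => h.1)) ?_
    intro t h
    exact (hT.polytope t h.1.1).compact'.isClosed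
  have hyA : y ∉ A := by
    intro h
    simp only [hA, Set.mem_iUnion] at h
    obtain ⟨t, h1, h2⟩ := h
    exact h1.2 h2
  obtain ⟨ε, hε, hb⟩ := Metric.isOpen_iff.1 hcl.isOpen_compl y hyA
  refine ⟨min ε 1, lt_min hε one_pos, ?_⟩
  rintro t ht ⟨x, hxt, hx⟩
  by_contra hyt
  have hx1 : x ∈ Metric.ball y 1 := Metric.ball_subset_ball (min_le_right _ _) hx
  have hx2 : x ∈ Metric.ball y ε := Metric.ball_subset_ball (min_le_left _ _) hx
  apply hb hx2
  simp only [hA, Set.mem_iUnion]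
  exact ⟨t, ⟨⟨ht, x, hxt, hx1⟩, hyt⟩, hxt⟩

lemma IsLFCTiling.finite_at (hT : IsLFCTiling T) (y : EucSp 2) : {t ∈ T | y ∈ t}.Finite := by
  refine (hT.locally_finite {y} Bornology.isBounded_singleton).subset ?_
  rintro t ⟨h1, h2⟩
  exact ⟨h1, y, h2, rfl⟩

lemma sum_mem_three {t : Set (EucSp 2)} (ht : Convex ℝ t) {a b c : ℝ} (ha : 0 ≤ a) (hb : 0 ≤ b)
    (hc : 0 ≤ c) (h : a + b + c = 1) {v w p : EucSp 2} (hv : v ∈ t) (hw : w ∈ t) (hp : p ∈ t) :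
    a • v + b • w + c • p ∈ t := by
  have := ht.sum_mem (t := Finset.univ) (w := ![a, b, c]) (z := ![v, w, p]) (by
    intro i _; fin_cases i <;> simpa) (by simp [Fin.sum_univ_three, h]) (by
    intro i _; fin_cases i <;> simpa)
  simpa [Fin.sum_univ_three] using this

/-- the signed area functional -/
noncomputable def cr (u w : EucSp 2) : ℝ := u 0 * w 1 - u 1 * w 0

lemma tri_overlap {t s : Set (EucSp 2)} (ht : Convex ℝ t) (hs : Convex ℝ s) {v w p q : EucSp 2}
    (hvt : v ∈ t) (hwt : w ∈ t) (hvs : v ∈ s) (hws : w ∈ s) (hp : p ∈ t) (hq : q ∈ s)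
    (hfp : 0 < cr (w - v) (p - v)) (hfq : 0 < cr (w - v) (q - v)) :
    ∃ x ∈ t ∩ s, 0 < cr (w - v) (x - v) := by
  set z := midpoint ℝ v w with hz
  have hz' : ∀ i, z i = (v i + w i) / 2 := by
    intro i
    rw [hz, midpoint_eq_smul_add]; simp; ring
  have hzs : z ∈ s := hs.midpoint_mem hvs hws
  -- `q - z = α (w - v) + β (p - z)`
  set P := cr (w - v) (p - v) with hP
  set Q := cr (w - v) (q - v) with hQ
  set β := Q / P with hβ
  have hβ0 : 0 < β := div_pos hfq hfp
  obtain ⟨α, hα⟩ : ∃ α : ℝ, q - z = α • (w - v) + β • (p - z) := by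
    refine ⟨((q 0 - z 0) * (p 1 - z 1) - (q 1 - z 1) * (p 0 - z 0)) / P, ?_⟩
    have hPz : P = (w 0 - v 0) * (p 1 - v 1) - (w 1 - v 1) * (p 0 - v 0) := by simp [hP, cr]
    have hQz : Q = (w 0 - v 0) * (q 1 - v 1) - (w 1 - v 1) * (q 0 - v 0) := by simp [hQ, cr]
    refine ext2 ?_ ?_
    · simp only [PiLp.add_apply, PiLp.smul_apply, PiLp.sub_apply, smul_eq_mul, hβ, hz']
      field_simp
      rw [hPz, hQz]; ring
    · simp only [PiLp.add_apply, PiLp.smul_apply, PiLp.sub_apply, smul_eq_mul, hβ, hz']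
      field_simp
      rw [hPz, hQz]; ring
  obtain ⟨δ, hδ0, hδ1, hδ2⟩ : ∃ δ : ℝ, 0 < δ ∧ δ ≤ 1 ∧ δ * (β + 2 * |α|) ≤ 1 := by
    refine ⟨min 1 (1 / (β + 2 * |α|)), lt_min one_pos (by positivity), min_le_left _ _, ?_⟩
    have hp0 : 0 < β + 2 * |α| := by positivity
    calc min 1 (1 / (β + 2 * |α|)) * (β + 2 * |α|) ≤ 1 / (β + 2 * |α|) * (β + 2 * |α|) := by
          gcongr; exact min_le_right _ _
      _ = 1 := by field_simp
  refine ⟨z + δ • (q - z), ⟨?_, ?_⟩, ?_⟩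
  · have e : z + δ • (q - z) = ((1 - δ * β) / 2 - δ * α) • v + ((1 - δ * β) / 2 + δ * α) • w
        + (δ * β) • p := by
      rw [hα]
      refine ext2 ?_ ?_ <;>
      · simp only [PiLp.add_apply, PiLp.smul_apply, PiLp.sub_apply, smul_eq_mul, hz']
        ring
    rw [e]
    have a1 := le_abs_self α
    have a2 := neg_abs_le α
    refine sum_mem_three ht ?_ ?_ ?_ ?_ hvt hwt hp
    · nlinarith
    · nlinarith
    · positivity
    · ring
  · have := hs hzs hq (a := 1 - δ) (b := δ) (by linarith) hδ0.le (by ring)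
    convert this using 1
    module
  · have : cr (w - v) (z + δ • (q - z) - v) = δ * Q := by
      simp only [cr, hQ, PiLp.add_apply, PiLp.smul_apply, PiLp.sub_apply, smul_eq_mul, hz']
      ring
    rw [this]; positivity

lemma cr_seg {v w x : EucSp 2} (hx : x ∈ segment ℝ v w) : cr (w - v) (x - v) = 0 := by
  rw [segment_eq_image'] at hx
  obtain ⟨θ, _, rfl⟩ := hx
  simp [cr]; ring

/-- a polygon with edge `[v,w]` lies on one side of the line -/
lemma one_side {t : Set (EucSp 2)} (ht : IsConvexPolytope t) {v w : EucSp 2} (hvw : v ≠ w) :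
    (∃ p ∈ t, 0 < cr (w - v) (p - v)) ∨ (∃ p ∈ t, cr (w - v) (p - v) < 0) := by
  by_contra hcon
  push Not at hcon
  have hz : ∀ p ∈ t, cr (w - v) (p - v) = 0 := fun p hp => le_antisymm (hcon.1 p hp) (hcon.2 p hp)
  obtain ⟨x, hx⟩ := ht.2
  have := lt_of_interior (t := t) (l := lin (-(w 1 - v 1)) (w 0 - v 0))
    (c := -(w 1 - v 1) * v 0 + (w 0 - v 0) * v 1) ?_ ?_ hx
  · have h2 := hz x (interior_subset hx)
    simp [cr] at h2 this
    linarith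
  · intro h0
    have e0 := congrArg (fun l => l (pt2 1 0)) h0
    have e1 := congrArg (fun l => l (pt2 0 1)) h0
    simp [pt2] at e0 e1
    exact hvw (ext2 (by linarith) (by linarith))
  · intro y hy
    have h2 := hz y hy
    simp [cr] at h2 ⊢
    linarith

lemma cr_swap (v w p : EucSp 2) : cr (v - w) (p - w) = - cr (w - v) (p - v) := by
  simp [cr]; ring

lemma IsLFCTiling.inter_edge (hT : IsLFCTiling T) {t s} (ht : t ∈ T) (hs : s ∈ T) (hts : t ≠ s)
    {v w} (hvw : v ≠ w) (h : IsExposed ℝ t (segment ℝ v w)) (hv : v ∈ s) (hw : w ∈ s) :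
    t ∩ s = segment ℝ v w :=
  face_eq_seg (hT.polytope t ht) hvw h (hT.face_to_face t ht s hs).1 (hT.inter_ne ht hs hts)
    ⟨h.subset (left_mem_segment ℝ v w), hv⟩ ⟨h.subset (right_mem_segment ℝ v w), hw⟩

/-- An edge of a tile lies on exactly one other tile. -/
lemma IsLFCTiling.other_tile (hT : IsLFCTiling T) {t} (ht : t ∈ T) {v w} (hvw : v ≠ w)
    (h : IsExposed ℝ t (segment ℝ v w)) :
    ∃ s ∈ T, s ≠ t ∧ IsExposed ℝ s (segment ℝ v w) ∧
      ∀ r ∈ T, v ∈ r → w ∈ r → r = t ∨ r = s := by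
  have htp := hT.polytope t ht
  have hvt := h.subset (left_mem_segment ℝ v w)
  have hwt := h.subset (right_mem_segment ℝ v w)
  obtain ⟨l, c, hl, h1, h2⟩ := proper_face h ⟨v, left_mem_segment ℝ v w⟩ (seg_ne_poly htp v w)
  set z := midpoint ℝ v w with hz
  have hzs : z ∈ segment ℝ v w := midpoint_mem_segment v w
  have hzc : l z = c := by rw [h2] at hzs; exact hzs.2
  have hzt : z ∈ t := h.subset hzs
  obtain ⟨ε, hε, hloc⟩ := hT.loc z
  obtain ⟨x, hxb, hxl⟩ : ∃ x ∈ Metric.ball z ε, c < l x := by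
    by_contra hcon
    push Not at hcon
    exact absurd hzc (lt_of_interior hl (t := Metric.ball z ε) hcon
      (by rw [Metric.isOpen_ball.interior_eq]; exact Metric.mem_ball_self hε)).ne
  obtain ⟨s, hs, hxs⟩ := hT.exists_tile x
  have hzS : z ∈ s := hloc s hs ⟨x, hxs, hxb⟩
  have hst : s ≠ t := by
    rintro rfl
    exact absurd (h1 x hxs) (not_le.2 hxl)
  obtain ⟨hvI, hwI⟩ := ends_of_midpoint (hT.face_to_face t ht s hs).1 hvt hwt ⟨hzt, hzS⟩
  have hI := hT.inter_edge ht hs hst.symm hvw h hvI.2 hwI.2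
  have hse : IsExposed ℝ s (segment ℝ v w) := hI ▸ (hT.face_to_face t ht s hs).2
  refine ⟨s, hs, hst, hse, ?_⟩
  intro r hr hvr hwr
  by_contra hcon
  push Not at hcon
  have hre : IsExposed ℝ r (segment ℝ v w) := by
    rw [← hT.inter_edge ht hr hcon.1.symm hvw h hvr hwr]
    exact (hT.face_to_face t ht r hr).2
  -- two distinct tiles with this edge lie on opposite sides
  have key : ∀ a ∈ T, ∀ b ∈ T, a ≠ b → IsExposed ℝ a (segment ℝ v w) →
      IsExposed ℝ b (segment ℝ v w) → (∃ p ∈ a, 0 < cr (w - v) (p - v)) →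
      (∃ p ∈ b, 0 < cr (w - v) (p - v)) → False := by
    rintro a ha b hb hab ea eb ⟨p, hp, hp0⟩ ⟨q, hq, hq0⟩
    have L := left_mem_segment ℝ v w
    have R := right_mem_segment ℝ v w
    obtain ⟨x, hx, hx0⟩ := tri_overlap (hT.polytope a ha).convex' (hT.polytope b hb).convex'
      (ea.subset L) (ea.subset R) (eb.subset L) (eb.subset R) hp hq hp0 hq0
    rw [hT.inter_edge ha hb hab hvw ea (eb.subset L) (eb.subset R)] at hx
    exact absurd (cr_seg hx) hx0.ne'
  have key' : ∀ a ∈ T, ∀ b ∈ T, a ≠ b → IsExposed ℝ a (segment ℝ v w) →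
      IsExposed ℝ b (segment ℝ v w) → (∃ p ∈ a, cr (w - v) (p - v) < 0) →
      (∃ p ∈ b, cr (w - v) (p - v) < 0) → False := by
    rintro a ha b hb hab ea eb ⟨p, hp, hp0⟩ ⟨q, hq, hq0⟩
    have R := left_mem_segment ℝ v w
    have L := right_mem_segment ℝ v w
    obtain ⟨x, hx, hx0⟩ := tri_overlap (v := w) (w := v) (hT.polytope a ha).convex'
      (hT.polytope b hb).convex'
      (ea.subset L) (ea.subset R) (eb.subset L) (eb.subset R) hp hq
      (by rw [cr_swap]; linarith) (by rw [cr_swap]; linarith)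
    rw [hT.inter_edge ha hb hab hvw ea (eb.subset R) (eb.subset L)] at hx
    rw [cr_swap, cr_seg hx] at hx0
    simp at hx0
  have ot := one_side htp hvw
  have os := one_side (hT.polytope s hs) hvw
  have or' := one_side (hT.polytope r hr) hvw
  rcases ot with ot | ot <;> rcases os with os | os <;> rcases or' with or' | or'
  · exact key t ht s hs hst.symm h hse ot os
  · exact key t ht s hs hst.symm h hse ot os
  · exact key t ht r hr hcon.1.symm h hre ot or'
  · exact key' s hs r hr (Ne.symm hcon.2) hse hre os or'
  · exact key s hs r hr (Ne.symm hcon.2) hse hre os or'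
  · exact key' t ht r hr hcon.1.symm h hre ot or'
  · exact key' t ht s hs hst.symm h hse ot os
  · exact key' t ht s hs hst.symm h hse ot os

end tiling

open scoped Classical

/-- A (geometric) flag of a planar tiling: a tile, an edge `[v,w]` of it and the vertex `v`. -/
structure Fl (T : Set (Set (EucSp 2))) where
  tile : Set (EucSp 2)
  v : EucSp 2
  w : EucSp 2
  mem : tile ∈ T
  ne : v ≠ w
  exp : IsExposed ℝ tile (segment ℝ v w)

section flags
variable {T : Set (Set (EucSp 2))}

lemma Fl.ext' {Φ Ψ : Fl T} (h1 : Φ.tile = Ψ.tile) (h2 : Φ.v = Ψ.v) (h3 : Φ.w = Ψ.w) : Φ = Ψ := by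
  cases Φ; cases Ψ; simp at *; exact ⟨h1, h2, h3⟩

lemma Fl.v_mem (Φ : Fl T) : Φ.v ∈ Φ.tile := Φ.exp.subset (left_mem_segment ℝ _ _)
lemma Fl.w_mem (Φ : Fl T) : Φ.w ∈ Φ.tile := Φ.exp.subset (right_mem_segment ℝ _ _)
lemma Fl.v_ext (Φ : Fl T) : Φ.v ∈ Φ.tile.extremePoints ℝ := (exposed_seg_ext Φ.exp).1
lemma Fl.w_ext (Φ : Fl T) : Φ.w ∈ Φ.tile.extremePoints ℝ := (exposed_seg_ext Φ.exp).2

lemma Fl.exists_other (hT : IsLFCTiling T) (Φ : Fl T) :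
    ∃ u, u ≠ Φ.w ∧ Φ.v ≠ u ∧ IsExposed ℝ Φ.tile (segment ℝ Φ.v u) ∧
      ∀ x, Φ.v ≠ x → IsExposed ℝ Φ.tile (segment ℝ Φ.v x) → x = Φ.w ∨ x = u := by
  obtain ⟨w₁, w₂, h12, h1, h2, e1, e2, hu, _⟩ := vertex_edges (hT.polytope _ Φ.mem) Φ.v_ext
  rcases hu Φ.w Φ.ne Φ.exp with h | h
  · refine ⟨w₂, by rw [h]; exact h12.symm, h2, e2, ?_⟩
    rw [h]; exact hu
  · refine ⟨w₁, by rw [h]; exact h12, h1, e1, ?_⟩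
    rw [h]; exact fun x hx hx' => (hu x hx hx').symm

/-- Change the vertex. -/
def Fl.s0 (Φ : Fl T) : Fl T := ⟨Φ.tile, Φ.w, Φ.v, Φ.mem, Φ.ne.symm, by
  rw [segment_symm]; exact Φ.exp⟩

/-- Change the edge. -/
noncomputable def Fl.s1 (hT : IsLFCTiling T) (Φ : Fl T) : Fl T :=
  ⟨Φ.tile, Φ.v, (Φ.exists_other hT).choose, Φ.mem, (Φ.exists_other hT).choose_spec.2.1,
    (Φ.exists_other hT).choose_spec.2.2.1⟩

/-- Change the tile. -/
noncomputable def Fl.s2 (hT : IsLFCTiling T) (Φ : Fl T) : Fl T :=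
  ⟨(hT.other_tile Φ.mem Φ.ne Φ.exp).choose, Φ.v, Φ.w,
    (hT.other_tile Φ.mem Φ.ne Φ.exp).choose_spec.1, Φ.ne,
    (hT.other_tile Φ.mem Φ.ne Φ.exp).choose_spec.2.2.1⟩

@[simp] lemma Fl.s0_tile (Φ : Fl T) : Φ.s0.tile = Φ.tile := rfl
@[simp] lemma Fl.s0_v (Φ : Fl T) : Φ.s0.v = Φ.w := rfl
@[simp] lemma Fl.s0_w (Φ : Fl T) : Φ.s0.w = Φ.v := rfl
@[simp] lemma Fl.s1_tile (hT : IsLFCTiling T) (Φ : Fl T) : (Φ.s1 hT).tile = Φ.tile := rfl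
@[simp] lemma Fl.s1_v (hT : IsLFCTiling T) (Φ : Fl T) : (Φ.s1 hT).v = Φ.v := rfl
@[simp] lemma Fl.s2_v (hT : IsLFCTiling T) (Φ : Fl T) : (Φ.s2 hT).v = Φ.v := rfl
@[simp] lemma Fl.s2_w (hT : IsLFCTiling T) (Φ : Fl T) : (Φ.s2 hT).w = Φ.w := rfl

lemma Fl.s1_w_ne (hT : IsLFCTiling T) (Φ : Fl T) : (Φ.s1 hT).w ≠ Φ.w :=
  (Φ.exists_other hT).choose_spec.1

lemma Fl.s2_tile_ne (hT : IsLFCTiling T) (Φ : Fl T) : (Φ.s2 hT).tile ≠ Φ.tile :=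
  (hT.other_tile Φ.mem Φ.ne Φ.exp).choose_spec.2.1

lemma Fl.s1_uniq (hT : IsLFCTiling T) {Φ Ψ : Fl T} (ht : Ψ.tile = Φ.tile) (hv : Ψ.v = Φ.v) :
    Ψ = Φ ∨ Ψ = Φ.s1 hT := by
  have h := (Φ.exists_other hT).choose_spec.2.2.2 Ψ.w (by rw [← hv]; exact Ψ.ne)
    (by rw [← ht, ← hv]; exact Ψ.exp)
  rcases h with h | h
  · exact Or.inl (Fl.ext' ht hv h)
  · exact Or.inr (Fl.ext' ht hv h)

lemma Fl.s2_uniq (hT : IsLFCTiling T) {Φ Ψ : Fl T} (hv : Ψ.v = Φ.v) (hw : Ψ.w = Φ.w) :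
    Ψ = Φ ∨ Ψ = Φ.s2 hT := by
  have h := (hT.other_tile Φ.mem Φ.ne Φ.exp).choose_spec.2.2.2 Ψ.tile Ψ.mem
    (by rw [← hv]; exact Ψ.v_mem) (by rw [← hw]; exact Ψ.w_mem)
  rcases h with h | h
  · exact Or.inl (Fl.ext' h hv hw)
  · exact Or.inr (Fl.ext' h hv hw)

lemma Fl.s0_ne (Φ : Fl T) : Φ.s0 ≠ Φ := fun h => Φ.ne (congrArg Fl.w h)
lemma Fl.s1_ne (hT : IsLFCTiling T) (Φ : Fl T) : Φ.s1 hT ≠ Φ := fun h =>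
  Φ.s1_w_ne hT (congrArg Fl.w h)
lemma Fl.s2_ne (hT : IsLFCTiling T) (Φ : Fl T) : Φ.s2 hT ≠ Φ := fun h =>
  Φ.s2_tile_ne hT (congrArg Fl.tile h)

@[simp] lemma Fl.s0_s0 (Φ : Fl T) : Φ.s0.s0 = Φ := rfl
@[simp] lemma Fl.s1_s1 (hT : IsLFCTiling T) (Φ : Fl T) : (Φ.s1 hT).s1 hT = Φ := by
  rcases Fl.s1_uniq hT (Φ := Φ) (Ψ := (Φ.s1 hT).s1 hT) rfl rfl with h | h
  · exact h
  · exact absurd h (Fl.s1_ne hT _)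
@[simp] lemma Fl.s2_s2 (hT : IsLFCTiling T) (Φ : Fl T) : (Φ.s2 hT).s2 hT = Φ := by
  rcases Fl.s2_uniq hT (Φ := Φ) (Ψ := (Φ.s2 hT).s2 hT) rfl rfl with h | h
  · exact h
  · exact absurd h (Fl.s2_ne hT _)

lemma Fl.s0_s2 (hT : IsLFCTiling T) (Φ : Fl T) : (Φ.s2 hT).s0 = Φ.s0.s2 hT := by
  rcases Fl.s2_uniq hT (Φ := Φ.s0) (Ψ := (Φ.s2 hT).s0) rfl rfl with h | h
  · exact absurd (congrArg Fl.tile h) (Fl.s2_tile_ne hT _)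
  · exact h

lemma Fl.s2_tile_s0 (hT : IsLFCTiling T) (Φ : Fl T) : (Φ.s0.s2 hT).tile = (Φ.s2 hT).tile := by
  rw [← Fl.s0_s2]; rfl

lemma Fl.inter_s2 (hT : IsLFCTiling T) (Φ : Fl T) :
    Φ.tile ∩ (Φ.s2 hT).tile = segment ℝ Φ.v Φ.w :=
  hT.inter_edge Φ.mem (Φ.s2 hT).mem (Φ.s2_tile_ne hT).symm Φ.ne Φ.exp (Φ.s2 hT).v_mem
    (Φ.s2 hT).w_mem

/-- every vertex of a tile is in a flag -/
lemma exists_flag (hT : IsLFCTiling T) {t} (ht : t ∈ T) {v} (hv : v ∈ t.extremePoints ℝ) :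
    ∃ Φ : Fl T, Φ.tile = t ∧ Φ.v = v := by
  obtain ⟨w₁, w₂, h12, h1, h2, e1, e2, hu, _⟩ := vertex_edges (hT.polytope _ ht) hv
  exact ⟨⟨t, v, w₁, ht, h1, e1⟩, rfl, rfl⟩

lemma exists_vertex {t : Set (EucSp 2)} (ht : IsConvexPolytope t) : (t.extremePoints ℝ).Nonempty :=
  ht.compact'.extremePoints_nonempty ht.nonempty'

lemma exists_flag_tile (hT : IsLFCTiling T) {t} (ht : t ∈ T) : ∃ Φ : Fl T, Φ.tile = t := by
  obtain ⟨v, hv⟩ := exists_vertex (hT.polytope t ht)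
  obtain ⟨Φ, h, _⟩ := exists_flag hT ht hv
  exact ⟨Φ, h⟩

/-- Connectivity of the flags of a tile (a set closed under `s0`, `s1` containing one flag of `t`
contains all flags of `t`). -/
lemma tile_conn (hT : IsLFCTiling T) {P : Fl T → Prop} (h0 : ∀ Φ, P Φ → P Φ.s0)
    (h1 : ∀ Φ, P Φ → P (Φ.s1 hT)) {Φ Ψ : Fl T} (ht : Φ.tile = Ψ.tile) (hΦ : P Φ) : P Ψ := by
  have htp := hT.polytope _ Ψ.mem
  obtain ⟨l, hl⟩ := ext_exposing htp Ψ.v_ext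
  -- it suffices to reach a flag with vertex `Ψ.v`
  suffices H : ∃ Ω : Fl T, P Ω ∧ Ω.tile = Ψ.tile ∧ Ω.v = Ψ.v by
    obtain ⟨Ω, hΩ, h1', h2'⟩ := H
    rcases Fl.s1_uniq hT (Φ := Ω) (Ψ := Ψ) h1'.symm h2'.symm with h | h
    · rw [h]; exact hΩ
    · rw [h]; exact h1 _ hΩ
  -- take a flag in `P` maximizing `l`
  set A := {v ∈ Ψ.tile.extremePoints ℝ | ∃ Ω : Fl T, P Ω ∧ Ω.tile = Ψ.tile ∧ Ω.v = v} with hA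
  have hfin : A.Finite := htp.finite_ext.subset (fun v h => h.1)
  have hne : A.Nonempty := ⟨Φ.v, ht ▸ Φ.v_ext, Φ, hΦ, ht, rfl⟩
  obtain ⟨v, ⟨hv, Ω, hΩ, hΩt, hΩv⟩, hmax⟩ := hfin.exists_maximalFor (fun v => l v) A hne
  by_cases hvv : v = Ψ.v
  · exact ⟨Ω, hΩ, hΩt, hΩv.trans hvv⟩
  exfalso
  obtain ⟨w₁, w₂, h12, hn1, hn2, e1, e2, hu, hcone⟩ := vertex_edges htp hv
  have claim : ∀ w, v ≠ w → IsExposed ℝ Ψ.tile (segment ℝ v w) → l w ≤ l v := by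
    intro w hw he
    have hmem : w ∈ A := by
      refine ⟨(exposed_seg_ext he).2, ?_⟩
      set Ω' : Fl T := ⟨Ψ.tile, v, w, Ψ.mem, hw, he⟩
      have hP : P Ω' := by
        rcases Fl.s1_uniq hT (Φ := Ω) (Ψ := Ω') hΩt.symm hΩv.symm with h | h
        · rw [h]; exact hΩ
        · rw [h]; exact h1 _ hΩ
      exact ⟨Ω'.s0, h0 _ hP, rfl, rfl⟩
    by_contra hlt
    push Not at hlt
    exact absurd (hmax hmem hlt.le) (not_le.2 hlt)
  obtain ⟨α, β, hα, hβ, e⟩ := hcone Ψ.v Ψ.v_mem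
  have := congrArg l e
  simp only [map_sub, map_add, map_smul, smul_eq_mul] at this
  have h3 := hl v hv.1 hvv
  nlinarith [claim w₁ hn1 e1, claim w₂ hn2 e2, mul_nonneg hα (sub_nonneg.2 (claim w₁ hn1 e1)),
    mul_nonneg hβ (sub_nonneg.2 (claim w₂ hn2 e2))]

/-- For every point there is a vertex common to all tiles containing it. -/
lemma exists_common_vertex (hT : IsLFCTiling T) (y : EucSp 2) :
    ∃ v, (∃ t ∈ T, v ∈ t.extremePoints ℝ) ∧ ∀ t ∈ T, y ∈ t → v ∈ t := by
  obtain ⟨t, ht, hyt⟩ := hT.exists_tile y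
  set S := (hT.finite_at y).toFinset.image (fun s => t ∩ s) with hS
  have htS : t ∩ t ∈ S := by
    simp only [hS, Finset.mem_image, Set.Finite.mem_toFinset]
    exact ⟨t, ⟨ht, hyt⟩, rfl⟩
  have hexp : IsExposed ℝ t (⋂₀ (S : Set (Set (EucSp 2)))) := by
    refine IsExposed.sInter (F := S) ⟨_, htS⟩ ?_
    intro B hB
    simp only [hS, Finset.mem_image, Set.Finite.mem_toFinset] at hB
    obtain ⟨s, hs, rfl⟩ := hB
    exact (hT.face_to_face t ht s hs.1).1
  have hyI : y ∈ ⋂₀ (S : Set (Set (EucSp 2))) := by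
    intro B hB
    simp only [hS, Finset.coe_image, Set.mem_image, Set.Finite.coe_toFinset] at hB
    obtain ⟨s, hs, rfl⟩ := hB
    exact ⟨hyt, hs.2⟩
  obtain ⟨v, hv⟩ := (hexp.isCompact (hT.polytope t ht).compact').extremePoints_nonempty ⟨y, hyI⟩
  refine ⟨v, ⟨t, ht, hexp.isExtreme.extremePoints_subset_extremePoints hv⟩, ?_⟩
  intro s hs hys
  have := hv.1 (t ∩ s) (by
    simp only [hS, Finset.coe_image, Set.mem_image, Set.Finite.coe_toFinset]
    exact ⟨s, ⟨hs, hys⟩, rfl⟩)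
  exact this.2
end flags

open scoped Classical

section conn
variable {T : Set (Set (EucSp 2))}

lemma rank_euc2 : 1 < Module.rank ℝ (EucSp 2) := by
  apply Module.one_lt_rank_of_one_lt_finrank; simp

/-- Connectivity of the set of tiles at a point. -/
lemma point_conn (hT : IsLFCTiling T) (y : EucSp 2) {P : Set (EucSp 2) → Prop}
    (h : ∀ Φ : Fl T, y ∈ segment ℝ Φ.v Φ.w → P Φ.tile → P (Φ.s2 hT).tile)
    {t s} (ht : t ∈ T) (hs : s ∈ T) (hyt : y ∈ t) (hys : y ∈ s) (hPt : P t) : P s := by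
  obtain ⟨ε, hε, hloc⟩ := hT.loc y
  have hfin := hT.finite_at y
  obtain ⟨r, hr0, hrε, hr⟩ : ∃ r > 0, r < ε ∧ ∀ t ∈ {t ∈ T | y ∈ t}, ∃ z ∈ t, r ≤ dist z y := by
    have h1 : ∀ᶠ r in nhdsWithin (0 : ℝ) (Set.Ioi 0), ∀ t ∈ {t ∈ T | y ∈ t},
        ∃ z ∈ t, r ≤ dist z y := by
      rw [Filter.eventually_all_finite hfin]
      rintro t ⟨ht, hyt⟩
      obtain ⟨z, hz, hzy⟩ : ∃ z ∈ t, z ≠ y := by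
        by_contra hcon
        push Not at hcon
        refine seg_ne_poly (hT.polytope t ht) y y ?_
        rw [segment_same]
        refine Set.Subset.antisymm (by simpa using hyt) (fun z hz => hcon z hz)
      filter_upwards [Ioo_mem_nhdsGT (dist_pos.2 hzy)] with r hr
      exact ⟨z, hz, hr.2.le⟩
    obtain ⟨r, h1, h2⟩ := (h1.and (Ioo_mem_nhdsGT hε)).exists
    exact ⟨r, h2.1, h2.2, h1⟩
  have hsph : ∀ t ∈ T, y ∈ t → (t ∩ Metric.sphere y r).Nonempty := by
    intro t ht hyt
    obtain ⟨z, hz, hzr⟩ := hr t ⟨ht, hyt⟩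
    have hd : 0 < dist z y := lt_of_lt_of_le hr0 hzr
    refine ⟨AffineMap.lineMap y z (r / dist z y), ?_, ?_⟩
    · exact (hT.polytope t ht).convex'.segment_subset hyt hz
        (by rw [segment_eq_image_lineMap]
            exact ⟨_, ⟨by positivity, by rw [div_le_one hd]; exact hzr⟩, rfl⟩)
    · rw [Metric.mem_sphere, dist_lineMap_left, dist_comm y z]
      simp [abs_of_pos hr0]
      field_simp
  have hsphT : ∀ x ∈ Metric.sphere y r, ∀ t ∈ T, x ∈ t → y ∈ t := by
    intro x hx t ht hxt
    refine hloc t ht ⟨x, hxt, ?_⟩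
    rw [Metric.mem_sphere] at hx
    rw [Metric.mem_ball, hx]; exact hrε
  by_contra hPs
  have hconn := (isConnected_sphere rank_euc2 y hr0.le).isPreconnected
  rw [isPreconnected_closed_iff] at hconn
  set A := ⋃ t ∈ {t ∈ {t ∈ T | y ∈ t} | P t}, t with hA
  set B := ⋃ t ∈ {t ∈ {t ∈ T | y ∈ t} | ¬ P t}, t with hB
  have hAc : IsClosed A := (hfin.subset (fun t h => h.1)).isClosed_biUnion
    (fun t h => (hT.polytope t h.1.1).compact'.isClosed)
  have hBc : IsClosed B := (hfin.subset (fun t h => h.1)).isClosed_biUnion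
    (fun t h => (hT.polytope t h.1.1).compact'.isClosed)
  obtain ⟨x, hx, hxA, hxB⟩ := hconn A B hAc hBc (by
    intro x hx
    obtain ⟨t, ht, hxt⟩ := hT.exists_tile x
    have hyt := hsphT x hx t ht hxt
    by_cases hp : P t
    · left; rw [hA]; simp only [Set.mem_iUnion]; exact ⟨t, ⟨⟨ht, hyt⟩, hp⟩, hxt⟩
    · right; rw [hB]; simp only [Set.mem_iUnion]; exact ⟨t, ⟨⟨ht, hyt⟩, hp⟩, hxt⟩)
    (by
      obtain ⟨x, hx, hxs⟩ := hsph t ht hyt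
      refine ⟨x, hxs, ?_⟩
      rw [hA]; simp only [Set.mem_iUnion]; exact ⟨t, ⟨⟨ht, hyt⟩, hPt⟩, hx⟩)
    (by
      obtain ⟨x, hx, hxs⟩ := hsph s hs hys
      refine ⟨x, hxs, ?_⟩
      rw [hB]; simp only [Set.mem_iUnion]; exact ⟨s, ⟨⟨hs, hys⟩, hPs⟩, hx⟩)
  simp only [hA, hB, Set.mem_iUnion] at hxA hxB
  obtain ⟨a, ⟨⟨ha, hya⟩, hPa⟩, hxa⟩ := hxA
  obtain ⟨b, ⟨⟨hb, hyb⟩, hPb⟩, hxb⟩ := hxB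
  have hab : a ≠ b := by rintro rfl; exact hPb hPa
  have hyx : y ≠ x := by
    rintro rfl
    simp at hx; exact hr0.ne hx
  obtain ⟨v, w, hvw, e⟩ := hT.inter_seg ha hb hab hyx ⟨hya, hyb⟩ ⟨hxa, hxb⟩
  have ea : IsExposed ℝ a (segment ℝ v w) := e ▸ (hT.face_to_face a ha b hb).1
  have eb : IsExposed ℝ b (segment ℝ v w) := e ▸ (hT.face_to_face a ha b hb).2
  set Φ : Fl T := ⟨a, v, w, ha, hvw, ea⟩ with hΦ
  set Ψ : Fl T := ⟨b, v, w, hb, hvw, eb⟩ with hΨ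
  have hy : y ∈ segment ℝ Φ.v Φ.w := by
    show y ∈ segment ℝ v w
    rw [← e]; exact ⟨hya, hyb⟩
  rcases Fl.s2_uniq hT (Φ := Φ) (Ψ := Ψ) rfl rfl with h' | h'
  · exact hab (congrArg Fl.tile h').symm
  · have := h Φ hy hPa
    rw [← h'] at this
    exact hPb this

/-- Connectivity of the flags of tiles at a point. -/
lemma flag_point_conn (hT : IsLFCTiling T) (y : EucSp 2) {P : Fl T → Prop}
    (h0 : ∀ Φ : Fl T, y ∈ Φ.tile → P Φ → P Φ.s0)
    (h1 : ∀ Φ : Fl T, y ∈ Φ.tile → P Φ → P (Φ.s1 hT))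
    (h2 : ∀ Φ : Fl T, y ∈ Φ.tile → y ∈ (Φ.s2 hT).tile → P Φ → P (Φ.s2 hT))
    {Φ Ψ : Fl T} (hΦ : y ∈ Φ.tile) (hΨ : y ∈ Ψ.tile) (h : P Φ) : P Ψ := by
  have key : ∀ Ω Ω' : Fl T, y ∈ Ω.tile → Ω.tile = Ω'.tile → P Ω → P Ω' := by
    intro Ω Ω' hy ht hP
    have := tile_conn hT (P := fun X => y ∈ X.tile → P X) (Φ := Ω) (Ψ := Ω')
      (fun X hX hy => h0 X hy (hX hy)) (fun X hX hy => h1 X hy (hX hy)) ht (fun _ => hP)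
    exact this (ht ▸ hy)
  refine point_conn hT y (P := fun t => ∀ Ω : Fl T, Ω.tile = t → P Ω) ?_ Φ.mem Ψ.mem hΦ hΨ ?_ Ψ rfl
  · intro Ω hy hP Ω' hΩ'
    rw [← Fl.inter_s2 hT Ω] at hy
    exact key (Ω.s2 hT) Ω' hy.2 hΩ'.symm (h2 _ hy.1 hy.2 (hP _ rfl))
  · intro Ω hΩ
    exact key Φ Ω hΦ hΩ.symm h

/-- Connectivity of the flags at a vertex. -/
lemma vertex_conn (hT : IsLFCTiling T) {P : Fl T → Prop}
    (h1 : ∀ Φ : Fl T, P Φ → P (Φ.s1 hT)) (h2 : ∀ Φ : Fl T, P Φ → P (Φ.s2 hT))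
    {Φ Ψ : Fl T} (hv : Φ.v = Ψ.v) (h : P Φ) : P Ψ := by
  have key : ∀ Ω Ω' : Fl T, Ω.v = Ω'.v → Ω.tile = Ω'.tile → P Ω → P Ω' := by
    intro Ω Ω' hv ht hP
    rcases Fl.s1_uniq hT (Φ := Ω) (Ψ := Ω') ht.symm hv.symm with h | h <;> rw [h]
    · exact hP
    · exact h1 _ hP
  refine point_conn hT Φ.v (P := fun t => ∀ Ω : Fl T, Ω.tile = t → Ω.v = Φ.v → P Ω) ?_ Φ.mem Ψ.mem
    Φ.v_mem (hv ▸ Ψ.v_mem) ?_ Ψ rfl hv.symm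
  · intro Ω hy hP Ω' ht hv'
    have hvΩ : Φ.v ∈ Ω.tile := Ω.exp.subset hy
    have hext : Φ.v ∈ Ω.tile.extremePoints ℝ := hT.ext_transfer Φ.mem Ω.mem Φ.v_ext hvΩ
    rcases ext_seg_end hext Ω.v_mem Ω.w_mem hy with e | e
    · exact key (Ω.s2 hT) Ω' (by rw [hv', e]; rfl) ht.symm (h2 _ (hP Ω rfl e.symm))
    · refine key (Ω.s0.s2 hT) Ω' (by rw [hv', e]; rfl) ?_ (h2 _ (hP Ω.s0 rfl e.symm))
      rw [ht, Fl.s2_tile_s0]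
  · intro Ω ht hv'
    exact key Φ Ω hv'.symm ht.symm h

/-- Global flag connectivity. -/
lemma flag_conn (hT : IsLFCTiling T) {P : Fl T → Prop}
    (h0 : ∀ Φ : Fl T, P Φ → P Φ.s0)
    (h1 : ∀ Φ : Fl T, P Φ → P (Φ.s1 hT)) (h2 : ∀ Φ : Fl T, P Φ → P (Φ.s2 hT))
    {Φ : Fl T} (h : P Φ) (Ψ : Fl T) : P Ψ := by
  have aon : ∀ y, ∀ Ω Ω' : Fl T, y ∈ Ω.tile → y ∈ Ω'.tile → P Ω → P Ω' := fun y Ω Ω' hy hy' hP =>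
    flag_point_conn hT y (fun X _ => h0 X) (fun X _ => h1 X) (fun X _ _ => h2 X) hy hy' hP
  set Q := {y | ∀ Ω : Fl T, y ∈ Ω.tile → P Ω} with hQ
  have hopen : IsOpen Q := by
    rw [Metric.isOpen_iff]
    intro y hy
    obtain ⟨ε, hε, hloc⟩ := hT.loc y
    exact ⟨ε, hε, fun z hz Ω hzΩ => hy Ω (hloc _ Ω.mem ⟨z, hzΩ, hz⟩)⟩
  have hopen' : IsOpen Qᶜ := by
    rw [Metric.isOpen_iff]
    intro y hy
    obtain ⟨ε, hε, hloc⟩ := hT.loc y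
    refine ⟨ε, hε, fun z hz hzQ => hy ?_⟩
    obtain ⟨t, ht, hzt⟩ := hT.exists_tile z
    obtain ⟨Ω, rfl⟩ := exists_flag_tile hT ht
    intro Ω' hΩ'
    exact aon y Ω Ω' (hloc _ ht ⟨z, hzt, hz⟩) hΩ' (hzQ Ω hzt)
  have hu : Q = Set.univ := IsClopen.eq_univ ⟨⟨hopen'⟩, hopen⟩
    ⟨Φ.v, fun Ω hΩ => aon Φ.v Φ Ω Φ.v_mem hΩ h⟩
  have : Ψ.v ∈ Q := by rw [hu]; trivial
  exact this Ψ Ψ.v_mem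

end conn

open scoped Classical

/-! Dihedral actions. -/
section dihedral
variable {X Y : Type*}

/-- rotation of a pair of involutions -/
def rot {a b : X → X} (ha : Function.Involutive a) (hb : Function.Involutive b) : Equiv.Perm X :=
  ha.toPerm * hb.toPerm

/-- the orbit of a pair of involutions -/
def dorb {a b : X → X} (ha : Function.Involutive a) (hb : Function.Involutive b) (x : X) : Set X :=
  {z | ∃ k : ℤ, z = (rot ha hb ^ k) x ∨ z = (rot ha hb ^ k) (a x)}

variable {a b : X → X} (ha : Function.Involutive a) (hb : Function.Involutive b)

lemma rot_apply (x : X) : rot ha hb x = a (b x) := rfl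

lemma a_rot (k : ℤ) (x : X) : a ((rot ha hb ^ k) x) = (rot ha hb ^ (-k)) (a x) := by
  have h : ha.toPerm * rot ha hb * ha.toPerm⁻¹ = (rot ha hb)⁻¹ := by
    ext z
    rw [eq_comm, Equiv.Perm.inv_eq_iff_eq]
    simp [rot, hb _, ha _]
  have h2 := congrArg (fun g : Equiv.Perm X => g ^ k) h
  simp only [conj_zpow, inv_zpow'] at h2
  rw [← h2]
  simp [ha x]

lemma b_rot (k : ℤ) (x : X) : b ((rot ha hb ^ k) x) = (rot ha hb ^ (-k - 1)) (a x) := by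
  have : b ((rot ha hb ^ k) x) = a ((rot ha hb ^ (k + 1)) x) := by
    rw [add_comm, zpow_add, zpow_one, Equiv.Perm.mul_apply, rot_apply, ha]
  rw [this, a_rot ha hb]
  congr 2; ring

lemma a_rot' (k : ℤ) (x : X) : a ((rot ha hb ^ k) (a x)) = (rot ha hb ^ (-k)) x := by
  rw [a_rot ha hb, ha]

lemma b_rot' (k : ℤ) (x : X) : b ((rot ha hb ^ k) (a x)) = (rot ha hb ^ (-k - 1)) x := by
  rw [b_rot ha hb, ha]

lemma dorb_a {x z : X} (hz : z ∈ dorb ha hb x) : a z ∈ dorb ha hb x := by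
  obtain ⟨k, rfl | rfl⟩ := hz
  · exact ⟨-k, Or.inr (a_rot ha hb k x)⟩
  · exact ⟨-k, Or.inl (a_rot' ha hb k x)⟩

lemma dorb_b {x z : X} (hz : z ∈ dorb ha hb x) : b z ∈ dorb ha hb x := by
  obtain ⟨k, rfl | rfl⟩ := hz
  · exact ⟨_, Or.inr (b_rot ha hb k x)⟩
  · exact ⟨_, Or.inl (b_rot' ha hb k x)⟩

lemma dorb_self (x : X) : x ∈ dorb ha hb x := ⟨0, Or.inl rfl⟩

lemma rot_pow_ind {P : X → Prop} (h1 : ∀ z, P z → P (a z)) (h2 : ∀ z, P z → P (b z))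
    (k : ℤ) : ∀ x, P x → P ((rot ha hb ^ k) x) := by
  induction k using Int.induction_on with
  | zero => intro x h; exact h
  | succ i ih =>
    intro x h
    rw [zpow_add, zpow_one, Equiv.Perm.mul_apply]
    exact ih _ (h1 _ (h2 _ h))
  | pred i ih =>
    intro x h
    rw [sub_eq_add_neg, zpow_add, zpow_neg_one, Equiv.Perm.mul_apply]
    apply ih
    have : (rot ha hb)⁻¹ x = b (a x) := by
      rw [Equiv.Perm.inv_eq_iff_eq, rot_apply, hb, ha]
    rw [this]
    exact h2 _ (h1 _ h)

lemma dorb_ind {P : X → Prop} (h1 : ∀ z, P z → P (a z)) (h2 : ∀ z, P z → P (b z))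
    {x z : X} (hx : P x) (hz : z ∈ dorb ha hb x) : P z := by
  obtain ⟨k, rfl | rfl⟩ := hz
  · exact rot_pow_ind ha hb h1 h2 k _ hx
  · exact rot_pow_ind ha hb h1 h2 k _ (h1 _ hx)

lemma rot_ne (fa : ∀ z, a z ≠ z) (fb : ∀ z, b z ≠ z) (i j : ℤ) (x : X) :
    (rot ha hb ^ i) x ≠ (rot ha hb ^ j) (a x) := by
  intro h
  have h' : (rot ha hb ^ (i - j)) x = a x := by
    rw [sub_eq_neg_add, zpow_add, Equiv.Perm.mul_apply, h, ← Equiv.Perm.mul_apply, ← zpow_add]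
    simp
  rcases Int.even_or_odd' (i - j) with ⟨m, hm | hm⟩
  · apply fa ((rot ha hb ^ m) x)
    rw [a_rot ha hb, ← h', ← Equiv.Perm.mul_apply, ← zpow_add]
    congr 2; omega
  · apply fb ((rot ha hb ^ m) x)
    rw [b_rot ha hb, ← h', ← Equiv.Perm.mul_apply, ← zpow_add]
    congr 2; omega

lemma rot_period (k : ℤ) (x : X) :
    (rot ha hb ^ k) x = x ↔ ((Function.minimalPeriod (a ∘ b) x : ℕ) : ℤ) ∣ k := by
  have := MulAction.zpow_smul_eq_iff_minimalPeriod_dvd (a := rot ha hb) (b := x) (n := k)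
  exact this

lemma rot_eq_iff (i j : ℤ) (x : X) :
    (rot ha hb ^ i) x = (rot ha hb ^ j) x ↔
      ((Function.minimalPeriod (a ∘ b) x : ℕ) : ℤ) ∣ i - j := by
  rw [← rot_period ha hb, sub_eq_neg_add, zpow_add, Equiv.Perm.mul_apply, zpow_neg,
    Equiv.Perm.inv_eq_iff_eq]

/-- Extension of equivariant maps along dihedral orbits. -/
theorem dih_ext {a b : X → X} (ha : Function.Involutive a) (hb : Function.Involutive b)
    {a' b' : Y → Y} (ha' : Function.Involutive a') (hb' : Function.Involutive b')
    (fa : ∀ z, a z ≠ z) (fb : ∀ z, b z ≠ z) {x : X} {y : Y}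
    (hper : Function.minimalPeriod (a' ∘ b') y = Function.minimalPeriod (a ∘ b) x) :
    ∃ h : X → Y, h x = y ∧ ∀ z ∈ dorb ha hb x, h (a z) = a' (h z) ∧ h (b z) = b' (h z) := by
  set h : X → Y := fun z => if hz : ∃ k : ℤ, z = (rot ha hb ^ k) x then
      (rot ha' hb' ^ hz.choose) y else
      if hz : ∃ k : ℤ, z = (rot ha hb ^ k) (a x) then (rot ha' hb' ^ hz.choose) (a' y) else y
    with hh
  have e1 : ∀ k : ℤ, h ((rot ha hb ^ k) x) = (rot ha' hb' ^ k) y := by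
    intro k
    have hz : ∃ k' : ℤ, (rot ha hb ^ k) x = (rot ha hb ^ k') x := ⟨k, rfl⟩
    simp only [hh, dif_pos hz]
    rw [rot_eq_iff, hper, ← rot_eq_iff ha hb]
    exact hz.choose_spec.symm
  have e2 : ∀ k : ℤ, h ((rot ha hb ^ k) (a x)) = (rot ha' hb' ^ k) (a' y) := by
    intro k
    have hn : ¬ ∃ k' : ℤ, (rot ha hb ^ k) (a x) = (rot ha hb ^ k') x := by
      rintro ⟨k', hk'⟩
      exact rot_ne ha hb fa fb _ _ _ hk'.symm
    have hz : ∃ k' : ℤ, (rot ha hb ^ k) (a x) = (rot ha hb ^ k') (a x) := ⟨k, rfl⟩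
    simp only [hh, dif_neg hn, dif_pos hz]
    have hs := hz.choose_spec
    have hs2 := congrArg a hs
    rw [a_rot' ha hb, a_rot' ha hb, rot_eq_iff, ← hper, ← rot_eq_iff ha' hb'] at hs2
    have := congrArg a' hs2
    rw [a_rot ha' hb', a_rot ha' hb'] at this
    simpa using this.symm
  refine ⟨h, by simpa using e1 0, ?_⟩
  rintro z ⟨k, rfl | rfl⟩
  · rw [a_rot ha hb, b_rot ha hb, e1, e2, e2, a_rot ha' hb', b_rot ha' hb']; exact ⟨rfl, rfl⟩
  · rw [a_rot' ha hb, b_rot' ha hb, e1, e2, e1, a_rot' ha' hb', b_rot' ha' hb']; exact ⟨rfl, rfl⟩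

/-- Counting. -/
theorem dih_count (fa : ∀ z, a z ≠ z) (fb : ∀ z, b z ≠ z) {x : X} {P : Type*} {π : X → P}
    (h1 : ∀ z, π (b z) = π z)
    (h2 : ∀ z ∈ dorb ha hb x, ∀ z' ∈ dorb ha hb x, π z = π z' → z' = z ∨ z' = b z) :
    (π '' dorb ha hb x).ncard = Function.minimalPeriod (a ∘ b) x := by
  have e : π '' dorb ha hb x = π '' (MulAction.orbit (Subgroup.zpowers (rot ha hb)) x) := by
    ext p
    constructor
    · rintro ⟨z, ⟨k, rfl | rfl⟩, rfl⟩
      · exact ⟨_, ⟨⟨rot ha hb ^ k, k, rfl⟩, rfl⟩, rfl⟩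
      · refine ⟨_, ⟨⟨rot ha hb ^ (-k - 1), -k - 1, rfl⟩, rfl⟩, ?_⟩
        show π ((rot ha hb ^ (-k - 1)) x) = _
        rw [← b_rot' ha hb, h1]
    · rintro ⟨z, ⟨⟨_, k, rfl⟩, rfl⟩, rfl⟩
      exact ⟨_, ⟨k, Or.inl rfl⟩, rfl⟩
  have hinj : Set.InjOn π (MulAction.orbit (Subgroup.zpowers (rot ha hb)) x) := by
    rintro _ ⟨⟨_, k, rfl⟩, rfl⟩ _ ⟨⟨_, j, rfl⟩, rfl⟩ hπ
    rcases h2 _ ⟨k, Or.inl rfl⟩ _ ⟨j, Or.inl rfl⟩ hπ with h | h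
    · exact h.symm
    · exfalso
      have : (rot ha hb ^ j) x = b ((rot ha hb ^ k) x) := h
      rw [b_rot ha hb] at this
      exact rot_ne ha hb fa fb _ _ _ this
  rw [e, hinj.ncard_image]
  have := Nat.card_congr (MulAction.orbitZPowersEquiv (rot ha hb) x)
  rw [Nat.card_zmod] at this
  exact this

lemma period_eq_of_iff {a b : X → X} (ha : Function.Involutive a) (hb : Function.Involutive b)
    {x y : X} (h : ∀ k : ℤ, (rot ha hb ^ k) x = x ↔ (rot ha hb ^ k) y = y) :
    Function.minimalPeriod (a ∘ b) x = Function.minimalPeriod (a ∘ b) y := by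
  apply Nat.dvd_antisymm
  · have := (rot_period ha hb _ _).1 ((h _).2 ((rot_period ha hb _ _).2 dvd_rfl))
    exact_mod_cast this
  · have := (rot_period ha hb _ _).1 ((h _).1 ((rot_period ha hb _ _).2 dvd_rfl))
    exact_mod_cast this

/-- the period is constant on dihedral orbits -/
lemma period_a {a b : X → X} (ha : Function.Involutive a) (hb : Function.Involutive b) (x : X) :
    Function.minimalPeriod (a ∘ b) (a x) = Function.minimalPeriod (a ∘ b) x := by
  refine period_eq_of_iff ha hb (fun k => ?_)
  rw [← ha.injective.eq_iff, a_rot ha hb, ha, zpow_neg, Equiv.Perm.inv_eq_iff_eq]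
  exact eq_comm

lemma period_rot {a b : X → X} (ha : Function.Involutive a) (hb : Function.Involutive b) (x : X)
    (j : ℤ) :
    Function.minimalPeriod (a ∘ b) ((rot ha hb ^ j) x) = Function.minimalPeriod (a ∘ b) x := by
  refine period_eq_of_iff ha hb (fun k => ?_)
  rw [← Equiv.Perm.mul_apply, ← zpow_add, add_comm, zpow_add, Equiv.Perm.mul_apply]
  exact (rot ha hb ^ j).injective.eq_iff

lemma period_b {a b : X → X} (ha : Function.Involutive a) (hb : Function.Involutive b) (x : X) :
    Function.minimalPeriod (a ∘ b) (b x) = Function.minimalPeriod (a ∘ b) x := by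
  have h := b_rot ha hb 0 x
  simp only [zpow_zero, Equiv.Perm.coe_one, id] at h
  rw [h, period_rot, period_a ha hb]

end dihedral

open scoped Classical

section numbers
variable {T : Set (Set (EucSp 2))}

lemma inv0 : Function.Involutive (Fl.s0 : Fl T → Fl T) := Fl.s0_s0
lemma inv1 (hT : IsLFCTiling T) : Function.Involutive (Fl.s1 hT) := Fl.s1_s1 hT
lemma inv2 (hT : IsLFCTiling T) : Function.Involutive (Fl.s2 hT) := Fl.s2_s2 hT

/-- number of vertices of the tile of a flag -/
noncomputable def Fl.n (hT : IsLFCTiling T) (Φ : Fl T) : ℕ :=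
  Function.minimalPeriod (Fl.s0 ∘ Fl.s1 hT) Φ

/-- number of tiles at the vertex of a flag -/
noncomputable def Fl.d (hT : IsLFCTiling T) (Φ : Fl T) : ℕ :=
  Function.minimalPeriod (Fl.s2 hT ∘ Fl.s1 hT) Φ

variable (hT : IsLFCTiling T)

@[simp] lemma Fl.n_s0 (Φ : Fl T) : Φ.s0.n hT = Φ.n hT := period_a inv0 (inv1 hT) Φ
@[simp] lemma Fl.n_s1 (Φ : Fl T) : (Φ.s1 hT).n hT = Φ.n hT := period_b inv0 (inv1 hT) Φ
@[simp] lemma Fl.d_s2 (Φ : Fl T) : (Φ.s2 hT).d hT = Φ.d hT := period_a (inv2 hT) (inv1 hT) Φ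
@[simp] lemma Fl.d_s1 (Φ : Fl T) : (Φ.s1 hT).d hT = Φ.d hT := period_b (inv2 hT) (inv1 hT) Φ

lemma dorb_tile (Φ : Fl T) : dorb inv0 (inv1 hT) Φ = {Ψ | Ψ.tile = Φ.tile} := by
  ext Ψ
  constructor
  · intro h
    exact dorb_ind inv0 (inv1 hT) (P := fun Ψ => Ψ.tile = Φ.tile) (fun z hz => hz)
      (fun z hz => hz) rfl h
  · intro h
    exact tile_conn hT (P := fun Ψ => Ψ ∈ dorb inv0 (inv1 hT) Φ) (fun z hz => dorb_a _ _ hz)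
      (fun z hz => dorb_b _ _ hz) (Eq.symm h) (dorb_self _ _ Φ)

lemma dorb_vertex (Φ : Fl T) : dorb (inv2 hT) (inv1 hT) Φ = {Ψ | Ψ.v = Φ.v} := by
  ext Ψ
  constructor
  · intro h
    exact dorb_ind (inv2 hT) (inv1 hT) (P := fun Ψ => Ψ.v = Φ.v) (fun z hz => hz)
      (fun z hz => hz) rfl h
  · intro h
    exact vertex_conn hT (P := fun Ψ => Ψ ∈ dorb (inv2 hT) (inv1 hT) Φ) (fun z hz => dorb_b _ _ hz)
      (fun z hz => dorb_a _ _ hz) (Eq.symm h) (dorb_self _ _ Φ)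

lemma Fl.n_eq (Φ : Fl T) : Φ.n hT = (Φ.tile.extremePoints ℝ).ncard := by
  have h := dih_count inv0 (inv1 hT) Fl.s0_ne (Fl.s1_ne hT) (x := Φ) (π := fun Ψ => Ψ.v)
    (fun z => rfl) ?_
  · rw [Fl.n, ← h]
    congr 1
    ext v
    rw [dorb_tile]
    constructor
    · rintro ⟨Ψ, hΨ, rfl⟩
      have := Ψ.v_ext
      rw [hΨ] at this
      exact this
    · intro hv
      obtain ⟨Ψ, h1, h2⟩ := exists_flag hT Φ.mem hv
      exact ⟨Ψ, h1, h2⟩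
  · rw [dorb_tile]
    intro z hz z' hz' e
    exact Fl.s1_uniq hT (Eq.trans hz' (Eq.symm hz)) e.symm

lemma Fl.d_eq (Φ : Fl T) : Φ.d hT = {t ∈ T | Φ.v ∈ t}.ncard := by
  have h := dih_count (inv2 hT) (inv1 hT) (Fl.s2_ne hT) (Fl.s1_ne hT) (x := Φ)
    (π := fun Ψ => Ψ.tile) (fun z => rfl) ?_
  · rw [Fl.d, ← h]
    congr 1
    ext t
    rw [dorb_vertex]
    constructor
    · rintro ⟨Ψ, hΨ, rfl⟩
      have := Ψ.v_mem
      rw [hΨ] at this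
      exact ⟨Ψ.mem, this⟩
    · rintro ⟨ht, hv⟩
      obtain ⟨Ψ, h1, h2⟩ := exists_flag hT ht (hT.ext_transfer Φ.mem ht Φ.v_ext hv)
      exact ⟨Ψ, h2, h1⟩
  · rw [dorb_vertex]
    intro z hz z' hz' e
    exact Fl.s1_uniq hT e.symm (Eq.trans hz' (Eq.symm hz))

lemma Fl.n_ge (Φ : Fl T) : 3 ≤ Φ.n hT := by
  have hpos : 0 < Φ.n hT := by
    rw [Fl.n_eq, Set.ncard_pos (hT.polytope _ Φ.mem).finite_ext]
    exact ⟨_, Φ.v_ext⟩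
  have hper : Function.IsPeriodicPt (Fl.s0 ∘ Fl.s1 hT) (Φ.n hT) Φ :=
    Function.isPeriodicPt_minimalPeriod _ _
  by_contra hlt
  have h12 : Φ.n hT = 1 ∨ Φ.n hT = 2 := by omega
  rcases h12 with h | h
  · rw [h] at hper
    have e : (Φ.s1 hT).s0 = Φ := hper
    exact (Φ.s1 hT).ne.symm (congrArg Fl.v e)
  · rw [h] at hper
    have e : (((Φ.s1 hT).s0).s1 hT).s0 = Φ := hper
    have e2 := congrArg (fun X : Fl T => (X.s0).s1 hT) e
    simp only [Fl.s0_s0, Fl.s1_s1] at e2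
    exact Φ.s1_w_ne hT (congrArg Fl.v e2)

lemma Fl.d_ge (Φ : Fl T) : 3 ≤ Φ.d hT := by
  have hpos : 0 < Φ.d hT := by
    rw [Fl.d_eq, Set.ncard_pos (hT.finite_at _)]
    exact ⟨_, Φ.mem, Φ.v_mem⟩
  have hper : Function.IsPeriodicPt (Fl.s2 hT ∘ Fl.s1 hT) (Φ.d hT) Φ :=
    Function.isPeriodicPt_minimalPeriod _ _
  by_contra hlt
  have h12 : Φ.d hT = 1 ∨ Φ.d hT = 2 := by omega
  rcases h12 with h | h
  · rw [h] at hper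
    have e : (Φ.s1 hT).s2 hT = Φ := hper
    have e' : ((Φ.s1 hT).s2 hT).tile = Φ.tile := by rw [e]
    exact (Φ.s1 hT).s2_tile_ne hT e' 
  · rw [h] at hper
    have e : ((((Φ.s1 hT).s2 hT)).s1 hT).s2 hT = Φ := hper
    have e2 := congrArg (fun X : Fl T => (X.s2 hT).s1 hT) e
    simp only [Fl.s2_s2, Fl.s1_s1] at e2
    have ht : ((Φ.s1 hT).s2 hT).tile = (Φ.s2 hT).tile := by rw [e2, Fl.s1_tile]
    have hw : (Φ.s1 hT).w ∈ segment ℝ Φ.v Φ.w := by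
      rw [← Fl.inter_s2 hT, ← ht]
      exact ⟨(Φ.s1 hT).w_mem, ((Φ.s1 hT).s2 hT).w_mem⟩
    rcases ext_seg_end (Φ.s1 hT).w_ext Φ.v_mem Φ.w_mem hw with h' | h'
    · exact (Φ.s1 hT).ne h'.symm
    · exact Φ.s1_w_ne hT h'

end numbers

open scoped Classical

/-! Sections of local systems on simply connected spaces. -/

theorem local_system_section {X : Type} [TopologicalSpace X] [SimplyConnectedSpace X]
    [LocallyPathConnectedSpace X] (L : X → Type) (U : X → Set X) (hU : ∀ x, IsOpen (U x))
    (hxU : ∀ x, x ∈ U x) (r : ∀ x y, y ∈ U x → L x ≃ L y)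
    (hr : ∀ x y (hy : y ∈ U x) z (hz : z ∈ U x) (hz' : z ∈ U y) (a : L x),
      r y z hz' (r x y hy a) = r x z hz a) (x0 : X) (a0 : L x0) :
    ∃ F : ∀ x, L x, F x0 = a0 ∧ ∀ x, ∃ V, IsOpen V ∧ x ∈ V ∧ V ⊆ U x ∧
      ∀ y (hy : y ∈ U x), y ∈ V → F y = r x y hy (F x) := by
  -- all the fibres are equivalent
  have hequiv : ∀ x, Nonempty (L x ≃ L x0) := by
    have hu : {x | Nonempty (L x ≃ L x0)} = Set.univ := by
      refine IsClopen.eq_univ ⟨⟨?_⟩, ?_⟩ ⟨x0, ⟨Equiv.refl _⟩⟩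
      · rw [isOpen_iff_mem_nhds]
        intro x hx
        filter_upwards [(hU x).mem_nhds (hxU x)] with y hy h
        exact hx ⟨(r x y hy).trans h.some⟩
      · rw [isOpen_iff_mem_nhds]
        rintro x ⟨e⟩
        filter_upwards [(hU x).mem_nhds (hxU x)] with y hy
        exact ⟨(r x y hy).symm.trans e⟩
    intro x
    have : x ∈ {x | Nonempty (L x ≃ L x0)} := by rw [hu]; trivial
    exact this
  have e : ∀ x, L x ≃ L x0 := fun x => (hequiv x).some
  letI : TopologicalSpace (L x0) := ⊥
  haveI : DiscreteTopology (L x0) := ⟨rfl⟩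
  let cc : X → X → X → L x0 → L x0 := fun i j x a =>
    if h : x ∈ U i ∧ x ∈ U j then e j ((r j x h.2).symm (r i x h.1 ((e i).symm a))) else a
  have cc_eq : ∀ i j x (hi : x ∈ U i) (hj : x ∈ U j) a,
      cc i j x a = e j ((r j x hj).symm (r i x hi ((e i).symm a))) := by
    intro i j x hi hj a
    exact dif_pos ⟨hi, hj⟩
  let Z : FiberBundleCore X X (L x0) :=
    { baseSet := U
      isOpen_baseSet := hU
      indexAt := id
      mem_baseSet_at := hxU
      coordChange := cc
      coordChange_self := by
        intro i x hx v
        rw [cc_eq i i x hx hx]; simp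
      continuousOn_coordChange := by
        intro i j
        rintro ⟨x, a⟩ ⟨⟨hi, hj⟩, _⟩
        apply ContinuousAt.continuousWithinAt
        have : (fun p : X × L x0 => cc i j p.1 p.2) =ᶠ[nhds (x, a)] fun _ => cc i j x a := by
          have h1 : {p : X × L x0 | p.1 ∈ U i ∩ U j ∩ U x} ∈ nhds (x, a) := by
            refine (IsOpen.preimage continuous_fst (((hU i).inter (hU j)).inter (hU x))).mem_nhds ?_
            exact ⟨⟨hi, hj⟩, hxU x⟩
          have h2 : {p : X × L x0 | p.2 = a} ∈ nhds (x, a) := by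
            refine (IsOpen.preimage continuous_snd (isOpen_discrete {a})).mem_nhds rfl
          filter_upwards [h1, h2] with p hp hpa
          obtain ⟨⟨hpi, hpj⟩, hpx⟩ := hp
          rw [cc_eq i j p.1 hpi hpj, cc_eq i j x hi hj, hpa]
          congr 1
          rw [Equiv.symm_apply_eq, ← hr i x hi p.1 hpi hpx, ← hr j x hj p.1 hpj hpx]
          simp
        exact continuousAt_const.congr this.symm
      coordChange_comp := by
        rintro i j k x ⟨⟨hi, hj⟩, hk⟩ v
        rw [cc_eq i j x hi hj, cc_eq j k x hj hk, cc_eq i k x hi hk]; simp }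
  have hcov : IsCoveringMap (Bundle.TotalSpace.proj : Bundle.TotalSpace (L x0) Z.Fiber → X) :=
    FiberBundle.isCoveringMap
  obtain ⟨G, ⟨hG0, hGp⟩, _⟩ := hcov.existsUnique_continuousMap_lifts (ContinuousMap.id X) x0
    (⟨x0, e x0 a0⟩ : Bundle.TotalSpace (L x0) Z.Fiber) rfl
  have hproj : ∀ x, (G x).proj = x := fun x => congrFun hGp x
  -- the section in the chart `x`
  let s : X → L x0 := fun x => (G x).2
  have hs : ∀ x, G x = ⟨x, s x⟩ := by
    intro x
    have h := hproj x
    show G x = ⟨x, (G x).2⟩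
    generalize G x = g at h
    cases g
    simp at h
    subst h
    rfl
  refine ⟨fun x => (e x).symm (s x), ?_, ?_⟩
  · have : s x0 = e x0 a0 := by show (G x0).2 = _; rw [hG0]
    show (e x0).symm (s x0) = a0
    rw [this]; simp
  · intro x
    have hc : ContinuousAt (fun y => ((Z.localTriv x) (G y)).2) x := by
      have h1 : ContinuousAt (Z.localTriv x) (G x) :=
        (Z.localTriv x).continuousAt (by
          rw [FiberBundleCore.mem_localTriv_source, hproj]; exact hxU x)
      exact (ContinuousAt.comp (f := G) (x := x) h1 G.continuous.continuousAt).snd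
    have hc' : ∀ᶠ y in nhds x, ((Z.localTriv x) (G y)).2 = ((Z.localTriv x) (G x)).2 := by
      have := hc.preimage_mem_nhds ((isOpen_discrete {((Z.localTriv x) (G x)).2}).mem_nhds rfl)
      exact this
    obtain ⟨V, hV, hVo, hxV⟩ := eventually_nhds_iff.1 hc'
    refine ⟨V ∩ U x, hVo.inter (hU x), ⟨hxV, hxU x⟩, Set.inter_subset_right, ?_⟩
    rintro y hy ⟨hyV, _⟩
    have h := hV y hyV
    rw [FiberBundleCore.localTriv_apply, FiberBundleCore.localTriv_apply] at h
    have h' : cc y x y (s y) = cc x x x (s x) := by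
      rw [hs y, hs x] at h
      exact h
    rw [cc_eq y x y (hxU y) hy, cc_eq x x x (hxU x) (hxU x)] at h'
    simp only [Equiv.symm_apply_apply, EmbeddingLike.apply_eq_iff_eq] at h'
    rw [Equiv.symm_apply_eq] at h'
    have := hr y y (hxU y) y (hxU y) (hxU y) ((e y).symm (s y))
    rw [EmbeddingLike.apply_eq_iff_eq] at this
    rw [this] at h'
    exact h'

open scoped Classical

section dev
variable {T T' : Set (Set (EucSp 2))}

/-- A relation between flags of two tilings compatible with adjacency and local structure. -/
structure GoodRel (hT : IsLFCTiling T) (hT' : IsLFCTiling T') (R : Fl T → Fl T' → Prop) : Prop where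
  r0 : ∀ Φ Ψ, R Φ Ψ → R Φ.s0 Ψ.s0
  r1 : ∀ Φ Ψ, R Φ Ψ → R (Φ.s1 hT) (Ψ.s1 hT')
  r2 : ∀ Φ Ψ, R Φ Ψ → R (Φ.s2 hT) (Ψ.s2 hT')
  rn : ∀ Φ Ψ, R Φ Ψ → Φ.n hT = Ψ.n hT'
  rd : ∀ Φ Ψ, R Φ Ψ → Φ.d hT = Ψ.d hT'

/-- Equivariant maps of flags. -/
structure Equivar (hT : IsLFCTiling T) (hT' : IsLFCTiling T') (f : Fl T → Fl T') : Prop where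
  e0 : ∀ Φ, f Φ.s0 = (f Φ).s0
  e1 : ∀ Φ, f (Φ.s1 hT) = (f Φ).s1 hT'
  e2 : ∀ Φ, f (Φ.s2 hT) = (f Φ).s2 hT'

variable {hT : IsLFCTiling T} {hT' : IsLFCTiling T'} {R : Fl T → Fl T' → Prop}

lemma tile_ext (hR : GoodRel hT hT' R) {Φ₀ : Fl T} {Ψ₀ : Fl T'} (h : R Φ₀ Ψ₀) :
    ∃ k : Fl T → Fl T', k Φ₀ = Ψ₀ ∧ ∀ Φ, Φ.tile = Φ₀.tile →
      k Φ.s0 = (k Φ).s0 ∧ k (Φ.s1 hT) = (k Φ).s1 hT' ∧ R Φ (k Φ) := by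
  obtain ⟨k, hk0, hk⟩ := dih_ext inv0 (inv1 hT) inv0 (inv1 hT') Fl.s0_ne (Fl.s1_ne hT)
    (x := Φ₀) (y := Ψ₀) (hR.rn _ _ h).symm
  rw [dorb_tile] at hk
  refine ⟨k, hk0, fun Φ hΦ => ⟨(hk Φ hΦ).1, (hk Φ hΦ).2, ?_⟩⟩
  have := tile_conn hT (P := fun Φ => Φ.tile = Φ₀.tile ∧ R Φ (k Φ)) (Φ := Φ₀) (Ψ := Φ)
    (fun X hX => ⟨hX.1, by rw [(hk X hX.1).1]; exact hR.r0 _ _ hX.2⟩)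
    (fun X hX => ⟨hX.1, by rw [(hk X hX.1).2]; exact hR.r1 _ _ hX.2⟩) hΦ.symm
    ⟨rfl, by rw [hk0]; exact h⟩
  exact this.2

/-- local developing maps at a point -/
def IsLoc (hT : IsLFCTiling T) (hT' : IsLFCTiling T') (R : Fl T → Fl T' → Prop) (y : EucSp 2)
    (g : Fl T → Fl T') : Prop :=
  ∀ Φ : Fl T, y ∈ Φ.tile → g Φ.s0 = (g Φ).s0 ∧ g (Φ.s1 hT) = (g Φ).s1 hT' ∧
    (y ∈ (Φ.s2 hT).tile → g (Φ.s2 hT) = (g Φ).s2 hT') ∧ R Φ (g Φ)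

lemma IsLoc.unique {y : EucSp 2} {g g' : Fl T → Fl T'} (hg : IsLoc hT hT' R y g)
    (hg' : IsLoc hT hT' R y g') {Φ : Fl T} (hΦ : y ∈ Φ.tile) (e : g Φ = g' Φ) {Ψ : Fl T}
    (hΨ : y ∈ Ψ.tile) : g Ψ = g' Ψ := by
  refine flag_point_conn hT y (P := fun X => g X = g' X) ?_ ?_ ?_ hΦ hΨ e
  · intro X hX h
    rw [(hg X hX).1, (hg' X hX).1, h]
  · intro X hX h
    rw [(hg X hX).2.1, (hg' X hX).2.1, h]
  · intro X hX hX2 h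
    rw [(hg X hX).2.2.1 hX2, (hg' X hX).2.2.1 hX2, h]

lemma IsLoc.mono {y z : EucSp 2} {g : Fl T → Fl T'} (hg : IsLoc hT hT' R y g)
    (h : ∀ t ∈ T, z ∈ t → y ∈ t) : IsLoc hT hT' R z g := fun Φ hΦ =>
  ⟨(hg Φ (h _ Φ.mem hΦ)).1, (hg Φ (h _ Φ.mem hΦ)).2.1,
    fun h2 => (hg Φ (h _ Φ.mem hΦ)).2.2.1 (h _ (Φ.s2 hT).mem h2), (hg Φ (h _ Φ.mem hΦ)).2.2.2⟩

lemma loc_exists_vertex (hR : GoodRel hT hT' R) {Φ₁ : Fl T} {Ψ₁ : Fl T'} (h : R Φ₁ Ψ₁) :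
    ∃ g, IsLoc hT hT' R Φ₁.v g ∧ g Φ₁ = Ψ₁ := by
  obtain ⟨h', hh0, hh⟩ := dih_ext (inv2 hT) (inv1 hT) (inv2 hT') (inv1 hT') (Fl.s2_ne hT)
    (Fl.s1_ne hT) (x := Φ₁) (y := Ψ₁) (hR.rd _ _ h).symm
  rw [dorb_vertex] at hh
  have hhR : ∀ Φ : Fl T, Φ.v = Φ₁.v → R Φ (h' Φ) := by
    intro Φ hΦ
    have := vertex_conn hT (P := fun X => X.v = Φ₁.v ∧ R X (h' X)) (Φ := Φ₁) (Ψ := Φ)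
      (fun X hX => ⟨hX.1, by rw [(hh X hX.1).2]; exact hR.r1 _ _ hX.2⟩)
      (fun X hX => ⟨hX.1, by rw [(hh X hX.1).1]; exact hR.r2 _ _ hX.2⟩) hΦ.symm
      ⟨rfl, by rw [hh0]; exact h⟩
    exact this.2
  -- base flags of the tiles at the vertex
  have hbase : ∀ t : {t // t ∈ T ∧ Φ₁.v ∈ t}, ∃ Ω : Fl T, Ω.tile = t.1 ∧ Ω.v = Φ₁.v := fun t =>
    exists_flag hT t.2.1 (hT.ext_transfer Φ₁.mem t.2.1 Φ₁.v_ext t.2.2)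
  choose B hBt hBv using hbase
  have hk : ∀ t : {t // t ∈ T ∧ Φ₁.v ∈ t}, ∃ k : Fl T → Fl T', k (B t) = h' (B t) ∧
      ∀ Φ : Fl T, Φ.tile = t.1 → k Φ.s0 = (k Φ).s0 ∧ k (Φ.s1 hT) = (k Φ).s1 hT' ∧ R Φ (k Φ) := by
    intro t
    obtain ⟨k, h1, h2⟩ := tile_ext hR (hhR (B t) (hBv t))
    exact ⟨k, h1, fun Φ hΦ => h2 Φ (hΦ.trans (hBt t).symm)⟩
  choose K hK0 hK using hk
  let g : Fl T → Fl T' := fun Φ => if hv : Φ₁.v ∈ Φ.tile then K ⟨Φ.tile, Φ.mem, hv⟩ Φ else Ψ₁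
  have hg : ∀ Φ : Fl T, ∀ hv : Φ₁.v ∈ Φ.tile, g Φ = K ⟨Φ.tile, Φ.mem, hv⟩ Φ := fun Φ hv =>
    dif_pos hv
  have hg0 : ∀ Φ : Fl T, Φ₁.v ∈ Φ.tile → g Φ.s0 = (g Φ).s0 := by
    intro Φ hv
    rw [hg Φ hv, hg Φ.s0 hv]
    exact (hK ⟨Φ.tile, Φ.mem, hv⟩ Φ rfl).1
  have hgh : ∀ Φ : Fl T, Φ.v = Φ₁.v → g Φ = h' Φ := by
    intro Φ hv
    have hm : Φ₁.v ∈ Φ.tile := hv ▸ Φ.v_mem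
    rw [hg Φ hm]
    set t : {t // t ∈ T ∧ Φ₁.v ∈ t} := ⟨Φ.tile, Φ.mem, hm⟩
    rcases Fl.s1_uniq hT (Φ := B t) (Ψ := Φ) (hBt t).symm (hv.trans (hBv t).symm) with e | e
    · rw [e]; exact hK0 t
    · rw [e, (hK t (B t) (hBt t)).2.1, hK0 t, (hh (B t) (hBv t)).2]
  have hg2 : ∀ Φ : Fl T, Φ.v = Φ₁.v → g (Φ.s2 hT) = (g Φ).s2 hT' := by
    intro Φ hv
    rw [hgh Φ hv, hgh (Φ.s2 hT) hv, (hh Φ hv).1]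
  refine ⟨g, ?_, by rw [hgh Φ₁ rfl, hh0]⟩
  intro Φ hv
  refine ⟨hg0 Φ hv, ?_, ?_, ?_⟩
  · rw [hg Φ hv, hg (Φ.s1 hT) hv]
    exact (hK ⟨Φ.tile, Φ.mem, hv⟩ Φ rfl).2.1
  · intro hv2
    have hs : Φ₁.v ∈ segment ℝ Φ.v Φ.w := by rw [← Fl.inter_s2 hT]; exact ⟨hv, hv2⟩
    rcases ext_seg_end (hT.ext_transfer Φ₁.mem Φ.mem Φ₁.v_ext hv) Φ.v_mem Φ.w_mem hs with e | e
    · exact hg2 Φ e.symm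
    · have e2 := hg2 Φ.s0 e.symm
      rw [← Fl.s0_s2, hg0 _ hv2, hg0 _ hv, ← Fl.s0_s2] at e2
      exact inv0.injective e2
  · rw [hg Φ hv]
    exact (hK ⟨Φ.tile, Φ.mem, hv⟩ Φ rfl).2.2

lemma loc_exists (hR : GoodRel hT hT' R) {Φ₀ : Fl T} {Ψ₀ : Fl T'} (h : R Φ₀ Ψ₀) {y : EucSp 2}
    (hy : y ∈ Φ₀.tile) : ∃ g, IsLoc hT hT' R y g ∧ g Φ₀ = Ψ₀ := by
  obtain ⟨v, ⟨t, ht, hvt⟩, hall⟩ := exists_common_vertex hT y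
  have hv := hall _ Φ₀.mem hy
  obtain ⟨k, hk0, hk⟩ := tile_ext hR h
  obtain ⟨Φ₁, h1, rfl⟩ := exists_flag hT Φ₀.mem (hT.ext_transfer ht Φ₀.mem hvt hv)
  obtain ⟨g, hg, hg1⟩ := loc_exists_vertex hR (hk Φ₁ h1).2.2
  refine ⟨g, hg.mono hall, ?_⟩
  have := tile_conn hT (P := fun X => X.tile = Φ₀.tile ∧ g X = k X) (Φ := Φ₁) (Ψ := Φ₀)
    (fun X hX => ⟨hX.1, by rw [(hk X hX.1).1, (hg X (hX.1 ▸ hv)).1, hX.2]⟩)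
    (fun X hX => ⟨hX.1, by rw [(hk X hX.1).2.1, (hg X (hX.1 ▸ hv)).2.1, hX.2]⟩) h1
    ⟨h1, hg1⟩
  rw [this.2, hk0]

/-- The developing theorem. -/
theorem develop (hR : GoodRel hT hT' R) {Φ₀ : Fl T} {Ψ₀ : Fl T'} (h : R Φ₀ Ψ₀) :
    ∃ f : Fl T → Fl T', Equivar hT hT' f ∧ f Φ₀ = Ψ₀ ∧ ∀ Φ, R Φ (f Φ) := by
  let L : EucSp 2 → Type := fun y =>
    {g : {Φ : Fl T // y ∈ Φ.tile} → Fl T' // ∃ G, IsLoc hT hT' R y G ∧ ∀ Φ, g Φ = G Φ.1}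
  choose ε hε hloc using hT.loc
  let U : EucSp 2 → Set (EucSp 2) := fun y => Metric.ball y (ε y)
  have hUt : ∀ x y, y ∈ U x → ∀ t ∈ T, y ∈ t → x ∈ t := fun x y hy t ht hyt =>
    hloc x t ht ⟨y, hyt, hy⟩
  let res : ∀ x y, y ∈ U x → L x → L y := fun x y hy g =>
    ⟨fun Φ => g.1 ⟨Φ.1, hUt x y hy _ Φ.1.mem Φ.2⟩, by
      obtain ⟨G, hG, e⟩ := g.2
      exact ⟨G, hG.mono (hUt x y hy), fun Φ => e _⟩⟩
  have hbij : ∀ x y hy, Function.Bijective (res x y hy) := by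
    intro x y hy
    obtain ⟨t, ht, hyt⟩ := hT.exists_tile y
    obtain ⟨Ω, rfl⟩ := exists_flag_tile hT ht
    have hxΩ := hUt x y hy _ ht hyt
    constructor
    · rintro ⟨g, G, hG, e⟩ ⟨g', G', hG', e'⟩ hh
      apply Subtype.ext
      funext Φ
      have h1 := congrFun (congrArg Subtype.val hh) ⟨Ω, hyt⟩
      simp only [res] at h1
      rw [e, e'] at h1
      show g Φ = g' Φ
      rw [e, e']
      exact hG.unique hG' hxΩ h1 Φ.2
    · rintro ⟨g, G, hG, e⟩
      obtain ⟨G', hG', e'⟩ := loc_exists hR (hG Ω hyt).2.2.2 hxΩ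
      refine ⟨⟨fun Φ => G' Φ.1, G', hG', fun _ => rfl⟩, ?_⟩
      apply Subtype.ext
      funext Φ
      show G' Φ.1 = g Φ
      rw [e]
      exact (hG'.mono (hUt x y hy)).unique hG hyt e' Φ.2
  obtain ⟨G₀, hG₀, hG₀'⟩ := loc_exists hR h Φ₀.v_mem
  obtain ⟨F, hF0, hF⟩ := local_system_section L U (fun x => Metric.isOpen_ball)
    (fun x => Metric.mem_ball_self (hε x)) (fun x y hy => Equiv.ofBijective _ (hbij x y hy))
    (fun x y hy z hz hz' a => rfl) Φ₀.v ⟨fun Φ => G₀ Φ.1, G₀, hG₀, fun _ => rfl⟩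
  have hconst : ∀ (Φ : Fl T) (y z : EucSp 2) (hy : y ∈ Φ.tile) (hz : z ∈ Φ.tile),
      (F y).1 ⟨Φ, hy⟩ = (F z).1 ⟨Φ, hz⟩ := by
    intro Φ y z hy hz
    haveI : PreconnectedSpace Φ.tile :=
      Subtype.preconnectedSpace (hT.polytope _ Φ.mem).convex'.isPreconnected
    have hlc : IsLocallyConstant (fun y : Φ.tile => (F y.1).1 ⟨Φ, y.2⟩) := by
      rw [IsLocallyConstant.iff_exists_open]
      intro x
      obtain ⟨V, hV, hxV, hVU, hVF⟩ := hF x.1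
      refine ⟨Subtype.val ⁻¹' V, hV.preimage continuous_subtype_val, hxV, ?_⟩
      intro x' hx'
      show (F x'.1).1 ⟨Φ, x'.2⟩ = (F x.1).1 ⟨Φ, x.2⟩
      rw [hVF x'.1 (hVU hx') hx']
      rfl
    exact hlc.apply_eq_of_preconnectedSpace ⟨y, hy⟩ ⟨z, hz⟩
  refine ⟨fun Φ => (F Φ.v).1 ⟨Φ, Φ.v_mem⟩, ⟨?_, ?_, ?_⟩, ?_, ?_⟩
  · intro Φ
    show (F Φ.s0.v).1 ⟨Φ.s0, Φ.s0.v_mem⟩ = _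
    rw [hconst Φ.s0 Φ.s0.v Φ.v Φ.s0.v_mem Φ.v_mem]
    obtain ⟨G, hG, e⟩ := (F Φ.v).2
    rw [e, e]
    exact (hG Φ Φ.v_mem).1
  · intro Φ
    show (F Φ.v).1 ⟨Φ.s1 hT, (Φ.s1 hT).v_mem⟩ = _
    obtain ⟨G, hG, e⟩ := (F Φ.v).2
    rw [e, e]
    exact (hG Φ Φ.v_mem).2.1
  · intro Φ
    show (F Φ.v).1 ⟨Φ.s2 hT, (Φ.s2 hT).v_mem⟩ = _
    obtain ⟨G, hG, e⟩ := (F Φ.v).2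
    rw [e, e]
    exact (hG Φ Φ.v_mem).2.2.1 (Φ.s2 hT).v_mem
  · show (F Φ₀.v).1 _ = _
    rw [hF0]; exact hG₀'
  · intro Φ
    obtain ⟨G, hG, e⟩ := (F Φ.v).2
    show R Φ ((F Φ.v).1 _)
    rw [e]
    exact (hG Φ Φ.v_mem).2.2.2

lemma Equivar.ext {f g : Fl T → Fl T'} (hf : Equivar hT hT' f) (hg : Equivar hT hT' g) {Φ : Fl T}
    (h : f Φ = g Φ) : f = g := by
  funext Ψ
  refine flag_conn hT (P := fun X => f X = g X) ?_ ?_ ?_ h Ψ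
  · intro X hX; rw [hf.e0, hg.e0, hX]
  · intro X hX; rw [hf.e1, hg.e1, hX]
  · intro X hX; rw [hf.e2, hg.e2, hX]

lemma GoodRel.symm (hR : GoodRel hT hT' R) : GoodRel hT' hT (fun Ψ Φ => R Φ Ψ) :=
  ⟨fun _ _ h => hR.r0 _ _ h, fun _ _ h => hR.r1 _ _ h, fun _ _ h => hR.r2 _ _ h,
    fun _ _ h => (hR.rn _ _ h).symm, fun _ _ h => (hR.rd _ _ h).symm⟩

/-- Related flags are matched by an equivariant bijection. -/
theorem develop_equiv (hR : GoodRel hT hT' R) {Φ₀ : Fl T} {Ψ₀ : Fl T'} (h : R Φ₀ Ψ₀) :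
    ∃ f : Fl T ≃ Fl T', Equivar hT hT' f ∧ f Φ₀ = Ψ₀ := by
  obtain ⟨f, hf, hf0, _⟩ := develop hR h
  obtain ⟨g, hg, hg0, _⟩ := develop hR.symm h
  have h1 : g ∘ f = id := by
    refine Equivar.ext (hT := hT) (hT' := hT) (Φ := Φ₀) ⟨?_, ?_, ?_⟩ ⟨fun _ => rfl, fun _ => rfl, fun _ => rfl⟩ ?_
    · intro X; simp [hf.e0, hg.e0]
    · intro X; simp [hf.e1, hg.e1]
    · intro X; simp [hf.e2, hg.e2]
    · simp [hf0, hg0]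
  have h2 : f ∘ g = id := by
    refine Equivar.ext (hT := hT') (hT' := hT') (Φ := Ψ₀) ⟨?_, ?_, ?_⟩ ⟨fun _ => rfl, fun _ => rfl, fun _ => rfl⟩ ?_
    · intro X; simp [hf.e0, hg.e0]
    · intro X; simp [hf.e1, hg.e1]
    · intro X; simp [hf.e2, hg.e2]
    · simp [hf0, hg0]
  exact ⟨⟨f, g, congrFun h1, congrFun h2⟩, hf, hf0⟩

end dev

open scoped Classical

section faceposet
variable {T T' : Set (Set (EucSp 2))}

/-- The members of a flag, as sets. -/
def Fl.fs (Φ : Fl T) : Fin 4 → Set (EucSp 2) :=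
  ![∅, {Φ.v}, segment ℝ Φ.v Φ.w, Φ.tile]

lemma Fl.fs_exp (hT : IsLFCTiling T) (Φ : Fl T) (i : Fin 4) : IsExposed ℝ Φ.tile (Φ.fs i) := by
  fin_cases i
  · exact isExposed_empty
  · exact (ext_iff_exposed (hT.polytope _ Φ.mem)).1 Φ.v_ext
  · exact Φ.exp
  · exact fun _ => ⟨0, by ext; simp [Fl.fs]⟩

lemma Fl.tile_sub (hT : IsLFCTiling T) {Φ Ψ : Fl T} (h : Φ.tile ⊆ Ψ.tile) : Φ.tile = Ψ.tile := by
  obtain ⟨x, hx⟩ := (hT.polytope _ Φ.mem).2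
  exact (hT.eq_of_interior Φ.mem Ψ.mem hx (h (interior_subset hx))).symm

lemma Fl.tile_not_sub_seg (hT : IsLFCTiling T) {Φ Ψ : Fl T}
    (h : Φ.tile ⊆ segment ℝ Ψ.v Ψ.w) : False := by
  have e := Fl.tile_sub hT (h.trans Ψ.exp.subset)
  refine seg_ne_poly (hT.polytope _ Φ.mem) Ψ.v Ψ.w (Set.Subset.antisymm ?_ h)
  rw [e]; exact Ψ.exp.subset

lemma Fl.ends_of_mem_seg (hT : IsLFCTiling T) {Ψ : Fl T} {t} (ht : t ∈ T) {v : EucSp 2}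
    (hv : v ∈ t.extremePoints ℝ) (h : v ∈ segment ℝ Ψ.v Ψ.w) : v = Ψ.v ∨ v = Ψ.w :=
  ext_seg_end (hT.ext_transfer ht Ψ.mem hv (Ψ.exp.subset h)) Ψ.v_mem Ψ.w_mem h

lemma Fl.fs_le (hT : IsLFCTiling T) {Φ Ψ : Fl T} {i j : Fin 4} (h : Φ.fs i ⊆ Ψ.fs j) : i ≤ j := by
  have hv : (1 : Fin 4) ≤ i → Φ.v ∈ Φ.fs i := by
    intro h1
    fin_cases i
    · exact absurd h1 (by decide)
    · exact rfl
    · exact left_mem_segment ℝ _ _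
    · exact Φ.v_mem
  have hw : (2 : Fin 4) ≤ i → Φ.w ∈ Φ.fs i := by
    intro h1
    fin_cases i
    · exact absurd h1 (by decide)
    · exact absurd h1 (by decide)
    · exact right_mem_segment ℝ _ _
    · exact Φ.w_mem
  by_contra hlt
  push Not at hlt
  have hvj := h (hv (by omega))
  by_cases h0 : j = 0
  · subst h0; exact hvj
  have hwj := h (hw (by omega))
  by_cases h1 : j = 1
  · subst h1; exact Φ.ne (Eq.trans hvj (Eq.symm hwj))
  have h2 : j = 2 := by omega
  have h3 : i = 3 := by omega
  subst h2 h3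
  exact Fl.tile_not_sub_seg hT h

lemma Fl.fs_mono (Φ : Fl T) {i j : Fin 4} (h : i ≤ j) : Φ.fs i ⊆ Φ.fs j := by
  have a01 : Φ.fs 0 ⊆ Φ.fs 1 := Set.empty_subset _
  have a12 : Φ.fs 1 ⊆ Φ.fs 2 := Set.singleton_subset_iff.2 (left_mem_segment ℝ _ _)
  have a23 : Φ.fs 2 ⊆ Φ.fs 3 := Φ.exp.subset
  have := Fin.monotone_iff_le_succ (f := Φ.fs) |>.2 (by
    intro k; fin_cases k
    · exact a01
    · exact a12
    · exact a23)
  exact this h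

lemma Fl.fs_rep (hT : IsLFCTiling T) {t} (ht : t ∈ T) {F : Set (EucSp 2)} (hF : IsExposed ℝ t F) :
    ∃ (Φ : Fl T) (i : Fin 4), Φ.tile = t ∧ F = Φ.fs i := by
  obtain ⟨Ω, hΩ⟩ := exists_flag_tile hT ht
  by_cases h0 : F = ∅
  · exact ⟨Ω, 0, hΩ, h0⟩
  by_cases h1 : F = t
  · exact ⟨Ω, 3, hΩ, h1.trans hΩ.symm⟩
  obtain ⟨v, w, e⟩ := face_segment (hT.polytope t ht) hF (Set.nonempty_iff_ne_empty.2 h0) h1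
  by_cases h2 : v = w
  · subst h2
    rw [segment_same] at e
    subst e
    obtain ⟨Φ, h3, h4⟩ := exists_flag hT ht ((ext_iff_exposed (hT.polytope _ ht)).2 hF)
    exact ⟨Φ, 1, h3, by simp [Fl.fs, h4]⟩
  · subst e
    exact ⟨⟨t, v, w, ht, h2, hF⟩, 2, rfl, rfl⟩

lemma Fl.fs_inc (hT : IsLFCTiling T) {Φ Ψ : Fl T} {i j : Fin 4} (h : Φ.fs i ⊆ Ψ.fs j) :
    ∃ Ω : Fl T, Ω.fs i = Φ.fs i ∧ Ω.fs j = Ψ.fs j := by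
  have hij := Fl.fs_le hT h
  have c0 : i = 0 → ∃ Ω : Fl T, Ω.fs i = Φ.fs i ∧ Ω.fs j = Ψ.fs j := by
    rintro rfl; exact ⟨Ψ, rfl, rfl⟩
  have hi : i = 0 ∨ i = 1 ∨ i = 2 ∨ i = 3 := by omega
  rcases hi with rfl | rfl | rfl | rfl
  · exact c0 rfl
  · have hj : j = 1 ∨ j = 2 ∨ j = 3 := by omega
    rcases hj with rfl | rfl | rfl
    · refine ⟨Φ, rfl, ?_⟩
      have : Φ.v = Ψ.v := h rfl
      simp [Fl.fs, this]
    · rcases Fl.ends_of_mem_seg hT Φ.mem Φ.v_ext (h rfl : Φ.v ∈ segment ℝ Ψ.v Ψ.w) with e | e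
      · exact ⟨Ψ, by simp [Fl.fs, e], rfl⟩
      · exact ⟨Ψ.s0, by simp [Fl.fs, e], segment_symm ℝ _ _⟩
    · obtain ⟨Ω, h3, h4⟩ := exists_flag hT Ψ.mem
        (hT.ext_transfer Φ.mem Ψ.mem Φ.v_ext (h rfl : Φ.v ∈ Ψ.tile))
      exact ⟨Ω, by simp [Fl.fs, h4], h3⟩
  · have hj : j = 2 ∨ j = 3 := by omega
    have hv := h (left_mem_segment ℝ _ _)
    have hw := h (right_mem_segment ℝ _ _)
    rcases hj with rfl | rfl
    · refine ⟨Ψ, ?_, rfl⟩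
      have hne := Φ.ne
      change segment ℝ Ψ.v Ψ.w = segment ℝ Φ.v Φ.w
      rcases Fl.ends_of_mem_seg hT Φ.mem Φ.v_ext hv with e | e <;>
      rcases Fl.ends_of_mem_seg hT Φ.mem Φ.w_ext hw with e' | e'
      · exact absurd (e.trans e'.symm) hne
      · rw [e, e']
      · rw [e, e', segment_symm]
      · exact absurd (e.trans e'.symm) hne
    · rcases (hT.other_tile Φ.mem Φ.ne Φ.exp).choose_spec.2.2.2 Ψ.tile Ψ.mem hv hw with e | e
      · exact ⟨Φ, rfl, e.symm⟩
      · exact ⟨Φ.s2 hT, rfl, e.symm⟩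
  · have hj : j = 3 := by omega
    subst hj
    exact ⟨Φ, rfl, Fl.tile_sub hT h⟩

/-- The members of a flag, as faces. -/
def Fl.fc (hT : IsLFCTiling T) (Φ : Fl T) (i : Fin 4) : TFace T :=
  ⟨Φ.fs i, Φ.tile, Φ.mem, Φ.fs_exp hT i⟩

/-- The members of a flag in the face poset. -/
noncomputable def Fl.el (hT : IsLFCTiling T) (Φ : Fl T) (i : Fin 5) : TPoset T :=
  if h : i.1 < 4 then WithTop.some (Φ.fc hT ⟨i.1, h⟩) else ⊤

lemma Fl.el_lt (hT : IsLFCTiling T) (Φ : Fl T) (i : Fin 5) (h : i.1 < 4) :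
    Φ.el hT i = WithTop.some (Φ.fc hT ⟨i.1, h⟩) :=
  dif_pos h

lemma Fl.el_top (hT : IsLFCTiling T) (Φ : Fl T) : Φ.el hT 4 = ⊤ := rfl

lemma Fl.el_le_iff (hT : IsLFCTiling T) {Φ Ψ : Fl T} {i j : Fin 5} (hi : i.1 < 4) (hj : j.1 < 4) :
    Φ.el hT i ≤ Ψ.el hT j ↔ Φ.fs ⟨i, hi⟩ ⊆ Ψ.fs ⟨j, hj⟩ := by
  rw [Fl.el_lt hT Φ i hi, Fl.el_lt hT Ψ j hj, WithTop.coe_le_coe]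
  rfl

lemma Fl.el_eq_iff (hT : IsLFCTiling T) {Φ Ψ : Fl T} {i j : Fin 5} (hi : i.1 < 4) (hj : j.1 < 4) :
    Φ.el hT i = Ψ.el hT j ↔ Φ.fs ⟨i, hi⟩ = Ψ.fs ⟨j, hj⟩ := by
  rw [le_antisymm_iff, Fl.el_le_iff hT hi hj, Fl.el_le_iff hT hj hi]
  exact Set.Subset.antisymm_iff.symm

lemma Fl.el_le (hT : IsLFCTiling T) {Φ Ψ : Fl T} {i j : Fin 5} (h : Φ.el hT i ≤ Ψ.el hT j) :
    i ≤ j := by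
  by_cases hj : j.1 < 4
  · by_cases hi : i.1 < 4
    · have := Fl.fs_le hT ((Fl.el_le_iff hT hi hj).1 h)
      simpa using this
    · have : i = 4 := by omega
      subst this
      rw [Fl.el_top, Fl.el_lt hT Ψ j hj] at h
      exact absurd h (by simp)
  · omega

lemma Fl.el_mono (hT : IsLFCTiling T) (Φ : Fl T) : StrictMono (Φ.el hT) := by
  have hm : Monotone (Φ.el hT) := by
    intro i j hij
    by_cases hj : j.1 < 4
    · have hi : i.1 < 4 := by omega
      rw [Fl.el_le_iff hT hi hj]
      exact Φ.fs_mono hij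
    · have : j = 4 := by omega
      subst this
      exact le_top
  intro i j hij
  refine lt_of_le_of_ne (hm hij.le) (fun h => ?_)
  exact absurd (Fl.el_le hT h.ge) (not_le.2 hij)

lemma Fl.el_rank (hT : IsLFCTiling T) {Φ Ψ : Fl T} {i j : Fin 5} (h : Φ.el hT i = Ψ.el hT j) :
    i = j := le_antisymm (Fl.el_le hT h.le) (Fl.el_le hT h.ge)

lemma exists_fl (hT : IsLFCTiling T) : Nonempty (Fl T) := by
  obtain ⟨t, ht, _⟩ := hT.exists_tile 0
  obtain ⟨Φ, _⟩ := exists_flag_tile hT ht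
  exact ⟨Φ⟩

lemma el_rep (hT : IsLFCTiling T) (x : TPoset T) : ∃ (Φ : Fl T) (i : Fin 5), x = Φ.el hT i := by
  induction x using WithTop.recTopCoe with
  | top => exact ⟨(exists_fl hT).some, 4, rfl⟩
  | coe F =>
    obtain ⟨F, t, ht, hF⟩ := F
    obtain ⟨Φ, i, h1, h2⟩ := Fl.fs_rep hT ht hF
    refine ⟨Φ, i.castSucc, ?_⟩
    rw [Fl.el_lt hT Φ _ i.2]
    congr 1
    exact Subtype.ext h2

lemma el_inc (hT : IsLFCTiling T) {Φ Ψ : Fl T} {i j : Fin 5} (h : Φ.el hT i ≤ Ψ.el hT j) :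
    ∃ Ω : Fl T, Ω.el hT i = Φ.el hT i ∧ Ω.el hT j = Ψ.el hT j := by
  by_cases hj : j.1 < 4
  · have hi : i.1 < 4 := by have := Fl.el_le hT h; omega
    obtain ⟨Ω, h1, h2⟩ := Fl.fs_inc hT ((Fl.el_le_iff hT hi hj).1 h)
    exact ⟨Ω, (Fl.el_eq_iff hT hi hi).2 h1, (Fl.el_eq_iff hT hj hj).2 h2⟩
  · have : j = 4 := by omega
    subst this
    exact ⟨Φ, rfl, rfl⟩

lemma Fl.el1 (hT : IsLFCTiling T) {Φ Ψ : Fl T} : Φ.el hT 1 = Ψ.el hT 1 ↔ Φ.v = Ψ.v := by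
  rw [Fl.el_eq_iff hT (by decide) (by decide)]
  exact Set.singleton_eq_singleton_iff
lemma Fl.el2 (hT : IsLFCTiling T) {Φ Ψ : Fl T} : Φ.el hT 2 = Ψ.el hT 2 ↔
    segment ℝ Φ.v Φ.w = segment ℝ Ψ.v Ψ.w := by
  rw [Fl.el_eq_iff hT (by decide) (by decide)]
  rfl
lemma Fl.el2' (hT : IsLFCTiling T) {Φ Ψ : Fl T} : Φ.el hT 2 = Ψ.el hT 2 ↔
    ((Φ.v = Ψ.v ∧ Φ.w = Ψ.w) ∨ (Φ.v = Ψ.w ∧ Φ.w = Ψ.v)) := by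
  rw [Fl.el2]
  constructor
  · intro h
    have hv : Φ.v ∈ segment ℝ Ψ.v Ψ.w := by rw [← h]; exact left_mem_segment ℝ _ _
    have hw : Φ.w ∈ segment ℝ Ψ.v Ψ.w := by rw [← h]; exact right_mem_segment ℝ _ _
    have hne := Φ.ne
    rcases Fl.ends_of_mem_seg hT Φ.mem Φ.v_ext hv with e | e <;>
      rcases Fl.ends_of_mem_seg hT Φ.mem Φ.w_ext hw with e' | e'
    · exact absurd (e.trans e'.symm) hne
    · exact Or.inl ⟨e, e'⟩
    · exact Or.inr ⟨e, e'⟩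
    · exact absurd (e.trans e'.symm) hne
  · rintro (⟨h1, h2⟩ | ⟨h1, h2⟩)
    · rw [h1, h2]
    · rw [h1, h2, segment_symm]
lemma Fl.el3 (hT : IsLFCTiling T) {Φ Ψ : Fl T} : Φ.el hT 3 = Ψ.el hT 3 ↔ Φ.tile = Ψ.tile := by
  rw [Fl.el_eq_iff hT (by decide) (by decide)]
  rfl
lemma Fl.el0 (hT : IsLFCTiling T) {Φ Ψ : Fl T} : Φ.el hT 0 = Ψ.el hT 0 := by
  rw [Fl.el_eq_iff hT (by decide) (by decide)]
  rfl

lemma Fl.el_s0 (hT : IsLFCTiling T) (Φ : Fl T) {i : Fin 5} (hi : i ≠ 1) :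
    Φ.s0.el hT i = Φ.el hT i := by
  have : i = 0 ∨ i = 2 ∨ i = 3 ∨ i = 4 := by omega
  rcases this with rfl | rfl | rfl | rfl
  · exact Fl.el0 hT
  · rw [Fl.el2]; exact segment_symm ℝ _ _
  · rw [Fl.el3]; rfl
  · rfl
lemma Fl.el_s1 (hT : IsLFCTiling T) (Φ : Fl T) {i : Fin 5} (hi : i ≠ 2) :
    (Φ.s1 hT).el hT i = Φ.el hT i := by
  have : i = 0 ∨ i = 1 ∨ i = 3 ∨ i = 4 := by omega
  rcases this with rfl | rfl | rfl | rfl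
  · exact Fl.el0 hT
  · rw [Fl.el1]; rfl
  · rw [Fl.el3]; rfl
  · rfl
lemma Fl.el_s2 (hT : IsLFCTiling T) (Φ : Fl T) {i : Fin 5} (hi : i ≠ 3) :
    (Φ.s2 hT).el hT i = Φ.el hT i := by
  have : i = 0 ∨ i = 1 ∨ i = 2 ∨ i = 4 := by omega
  rcases this with rfl | rfl | rfl | rfl
  · exact Fl.el0 hT
  · rw [Fl.el1]; rfl
  · rw [Fl.el2]; rfl
  · rfl

lemma Fl.el_ext (hT : IsLFCTiling T) {Φ Ψ : Fl T} (h : ∀ i, Φ.el hT i = Ψ.el hT i) : Φ = Ψ := by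
  have h1 := (Fl.el1 hT).1 (h 1)
  have h3 := (Fl.el3 hT).1 (h 3)
  rcases (Fl.el2' hT).1 (h 2) with ⟨_, h2⟩ | ⟨h2, _⟩
  · exact Fl.ext' h3 h1 h2
  · exact absurd (h1.symm.trans h2) Ψ.ne

lemma Fl.el_adj0 (hT : IsLFCTiling T) {Φ Ψ : Fl T} (h : ∀ i, i ≠ 1 → Ψ.el hT i = Φ.el hT i) :
    Ψ = Φ ∨ Ψ = Φ.s0 := by
  have h3 := (Fl.el3 hT).1 (h 3 (by decide))
  rcases (Fl.el2' hT).1 (h 2 (by decide)) with ⟨h1, h2⟩ | ⟨h1, h2⟩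
  · exact Or.inl (Fl.ext' h3 h1 h2)
  · exact Or.inr (Fl.ext' h3 h1 h2)
lemma Fl.el_adj1 (hT : IsLFCTiling T) {Φ Ψ : Fl T} (h : ∀ i, i ≠ 2 → Ψ.el hT i = Φ.el hT i) :
    Ψ = Φ ∨ Ψ = Φ.s1 hT :=
  Fl.s1_uniq hT ((Fl.el3 hT).1 (h 3 (by decide))) ((Fl.el1 hT).1 (h 1 (by decide)))
lemma Fl.el_adj2 (hT : IsLFCTiling T) {Φ Ψ : Fl T} (h : ∀ i, i ≠ 3 → Ψ.el hT i = Φ.el hT i) :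
    Ψ = Φ ∨ Ψ = Φ.s2 hT := by
  have h1 := (Fl.el1 hT).1 (h 1 (by decide))
  rcases (Fl.el2' hT).1 (h 2 (by decide)) with ⟨_, h2⟩ | ⟨h2, _⟩
  · exact Fl.s2_uniq hT h1 h2
  · exact absurd (h1.symm.trans h2) Φ.ne

/-- Every chain is contained in the chain of a flag. -/
lemma chain_sub (hT : IsLFCTiling T) {C : Set (TPoset T)} (hC : IsChain (· ≤ ·) C) :
    ∃ Φ : Fl T, C ⊆ Set.range (Φ.el hT) := by
  have cmp : ∀ (Φ Ψ : Fl T) (i j : Fin 5), Φ.el hT i ∈ C → Ψ.el hT j ∈ C → i ≤ j →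
      Φ.el hT i ≤ Ψ.el hT j := by
    intro Φ Ψ i j h1 h2 hij
    rcases hC.total h1 h2 with h | h
    · exact h
    · have := le_antisymm hij (Fl.el_le hT h)
      subst this
      obtain ⟨Ω, e1, e2⟩ := el_inc hT h
      rw [← e1, ← e2]
  suffices H : ∃ Φ : Fl T, ∀ (Ψ : Fl T) (i : Fin 5), Ψ.el hT i ∈ C → i = 1 ∨ i = 2 ∨ i = 3 →
      Ψ.el hT i = Φ.el hT i by
    obtain ⟨Φ, h⟩ := H
    refine ⟨Φ, fun x hx => ?_⟩
    obtain ⟨Ψ, i, rfl⟩ := el_rep hT x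
    have : i = 0 ∨ i = 4 ∨ (i = 1 ∨ i = 2 ∨ i = 3) := by omega
    rcases this with rfl | rfl | h'
    · exact ⟨0, Fl.el0 hT⟩
    · exact ⟨4, rfl⟩
    · exact ⟨i, (h Ψ i hx h').symm⟩
  have uni : ∀ (Φ Ψ : Fl T) (i : Fin 5), Φ.el hT i ∈ C → Ψ.el hT i ∈ C →
      Φ.el hT i = Ψ.el hT i := fun Φ Ψ i h1 h2 =>
    le_antisymm (cmp _ _ _ _ h1 h2 le_rfl) (cmp _ _ _ _ h2 h1 le_rfl)
  by_cases hE : ∃ Φ : Fl T, Φ.el hT 2 ∈ C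
  · obtain ⟨Φ, hΦ⟩ := hE
    -- adjust the vertex
    obtain ⟨Φ₁, hΦ₁, hv⟩ : ∃ Φ₁ : Fl T, Φ₁.el hT 2 ∈ C ∧
        ∀ Ψ : Fl T, Ψ.el hT 1 ∈ C → Ψ.el hT 1 = Φ₁.el hT 1 := by
      by_cases hV : ∃ Ψ : Fl T, Ψ.el hT 1 ∈ C
      · obtain ⟨Ψ, hΨ⟩ := hV
        obtain ⟨Ω, h1, h2⟩ := el_inc hT (cmp Ψ Φ 1 2 hΨ hΦ (by decide))
        exact ⟨Ω, by rw [h2]; exact hΦ, fun Ψ' h' => by rw [h1]; exact uni _ _ _ h' hΨ⟩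
      · push Not at hV
        exact ⟨Φ, hΦ, fun Ψ h => absurd h (hV Ψ)⟩
    obtain ⟨Φ₂, h1, h2, h3⟩ : ∃ Φ₂ : Fl T, Φ₂.el hT 1 = Φ₁.el hT 1 ∧ Φ₂.el hT 2 = Φ₁.el hT 2 ∧
        ∀ Ψ : Fl T, Ψ.el hT 3 ∈ C → Ψ.el hT 3 = Φ₂.el hT 3 := by
      by_cases hP : ∃ Ψ : Fl T, Ψ.el hT 3 ∈ C
      · obtain ⟨Ψ, hΨ⟩ := hP
        have hle := cmp Φ₁ Ψ 2 3 hΦ₁ hΨ (by decide)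
        rw [Fl.el_le_iff hT (by decide) (by decide)] at hle
        rcases (hT.other_tile Φ₁.mem Φ₁.ne Φ₁.exp).choose_spec.2.2.2 Ψ.tile Ψ.mem
          (hle (left_mem_segment ℝ _ _)) (hle (right_mem_segment ℝ _ _)) with e | e
        · exact ⟨Φ₁, rfl, rfl, fun Ψ' h' => (uni _ _ _ h' hΨ).trans ((Fl.el3 hT).2 e)⟩
        · exact ⟨Φ₁.s2 hT, Fl.el_s2 hT _ (by decide), Fl.el_s2 hT _ (by decide),
            fun Ψ' h' => (uni _ _ _ h' hΨ).trans ((Fl.el3 hT).2 e)⟩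
      · push Not at hP
        exact ⟨Φ₁, rfl, rfl, fun Ψ h => absurd h (hP Ψ)⟩
    refine ⟨Φ₂, ?_⟩
    rintro Ψ i hi (rfl | rfl | rfl)
    · rw [h1]; exact hv Ψ hi
    · rw [h2]; exact uni _ _ _ hi hΦ₁
    · exact h3 Ψ hi
  · push Not at hE
    suffices H : ∃ Φ : Fl T, (∀ Ψ : Fl T, Ψ.el hT 1 ∈ C → Ψ.el hT 1 = Φ.el hT 1) ∧
        (∀ Ψ : Fl T, Ψ.el hT 3 ∈ C → Ψ.el hT 3 = Φ.el hT 3) by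
      obtain ⟨Φ, h1, h3⟩ := H
      refine ⟨Φ, ?_⟩
      rintro Ψ i hi (rfl | rfl | rfl)
      · exact h1 Ψ hi
      · exact absurd hi (hE Ψ)
      · exact h3 Ψ hi
    by_cases hV : ∃ Ψ : Fl T, Ψ.el hT 1 ∈ C
    · obtain ⟨Ψ, hΨ⟩ := hV
      by_cases hP : ∃ Ψ : Fl T, Ψ.el hT 3 ∈ C
      · obtain ⟨Ψ', hΨ'⟩ := hP
        obtain ⟨Ω, h1, h2⟩ := el_inc hT (cmp Ψ Ψ' 1 3 hΨ hΨ' (by decide))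
        exact ⟨Ω, fun X hX => by rw [h1]; exact uni _ _ _ hX hΨ,
          fun X hX => by rw [h2]; exact uni _ _ _ hX hΨ'⟩
      · push Not at hP
        exact ⟨Ψ, fun X hX => uni _ _ _ hX hΨ, fun X hX => absurd hX (hP X)⟩
    · push Not at hV
      by_cases hP : ∃ Ψ : Fl T, Ψ.el hT 3 ∈ C
      · obtain ⟨Ψ', hΨ'⟩ := hP
        exact ⟨Ψ', fun X hX => absurd hX (hV X), fun X hX => uni _ _ _ hX hΨ'⟩
      · push Not at hP
        exact ⟨(exists_fl hT).some, fun X hX => absurd hX (hV X), fun X hX => absurd hX (hP X)⟩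

/-- The flag of the face poset. -/
noncomputable def Fl.flag (hT : IsLFCTiling T) (Φ : Fl T) : Flag (TPoset T) where
  carrier := Set.range (Φ.el hT)
  Chain' := by
    rintro _ ⟨i, rfl⟩ _ ⟨j, rfl⟩ _
    rcases le_total i j with h | h
    · exact Or.inl ((Φ.el_mono hT).monotone h)
    · exact Or.inr ((Φ.el_mono hT).monotone h)
  max_chain' := by
    intro s hs hsub
    obtain ⟨Ψ, hΨ⟩ := chain_sub hT hs
    have : Φ = Ψ := by
      refine Fl.el_ext hT (fun i => ?_)
      obtain ⟨j, hj⟩ := hΨ (hsub ⟨i, rfl⟩)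
      have := Fl.el_rank hT hj
      subst this
      exact hj.symm
    subst this
    exact Set.Subset.antisymm hsub hΨ

lemma Fl.flag_surj (hT : IsLFCTiling T) (C : Flag (TPoset T)) : ∃ Φ : Fl T, Φ.flag hT = C := by
  obtain ⟨Φ, h⟩ := chain_sub hT C.Chain'
  refine ⟨Φ, ?_⟩
  have := C.max_chain' (Φ.flag hT).Chain' h
  exact SetLike.coe_injective this.symm

end faceposet

open scoped Classical

section faceposet2
variable {T T' : Set (Set (EucSp 2))}

lemma Equivar.el_congr {hT : IsLFCTiling T} {hT' : IsLFCTiling T'} {f : Fl T → Fl T'}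
    (hf : Equivar hT hT' f) {Φ Ψ : Fl T} {i : Fin 5} (h : Φ.el hT i = Ψ.el hT i) :
    (f Φ).el hT' i = (f Ψ).el hT' i := by
  have : i = 0 ∨ i = 1 ∨ i = 2 ∨ i = 3 ∨ i = 4 := by omega
  rcases this with rfl | rfl | rfl | rfl | rfl
  · exact Fl.el0 hT'
  · have hv := (Fl.el1 hT).1 h
    refine vertex_conn hT (P := fun Ω => (f Φ).el hT' 1 = (f Ω).el hT' 1) ?_ ?_ hv rfl
    · intro Ω hΩ
      rw [hΩ, hf.e1, Fl.el_s1 hT' _ (by decide)]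
    · intro Ω hΩ
      rw [hΩ, hf.e2, Fl.el_s2 hT' _ (by decide)]
  · rcases (Fl.el2' hT).1 h with ⟨h1, h2⟩ | ⟨h1, h2⟩
    · rcases Fl.s2_uniq hT h1 h2 with e | e
      · rw [e]
      · rw [e, hf.e2, Fl.el_s2 hT' _ (by decide)]
    · rcases Fl.s2_uniq hT (Φ := Ψ.s0) h1 h2 with e | e
      · rw [e, hf.e0, Fl.el_s0 hT' _ (by decide)]
      · rw [e, hf.e2, Fl.el_s2 hT' _ (by decide), hf.e0, Fl.el_s0 hT' _ (by decide)]
  · have ht := (Fl.el3 hT).1 h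
    refine tile_conn hT (P := fun Ω => (f Φ).el hT' 3 = (f Ω).el hT' 3) ?_ ?_ ht rfl
    · intro Ω hΩ
      rw [hΩ, hf.e0, Fl.el_s0 hT' _ (by decide)]
    · intro Ω hΩ
      rw [hΩ, hf.e1, Fl.el_s1 hT' _ (by decide)]
  · rfl

/-- The map of face posets induced by an equivariant map of flags. -/
lemma Equivar.exists_map {hT : IsLFCTiling T} {hT' : IsLFCTiling T'} {f : Fl T → Fl T'}
    (hf : Equivar hT hT' f) : ∃ F : TPoset T → TPoset T', Monotone F ∧
      ∀ Φ i, F (Φ.el hT i) = (f Φ).el hT' i := by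
  choose X r hX using el_rep hT
  have key : ∀ Φ i, (f (X (Φ.el hT i))).el hT' (r (Φ.el hT i)) = (f Φ).el hT' i := by
    intro Φ i
    have h := hX (Φ.el hT i)
    have e := Fl.el_rank hT h
    rw [← e] at h ⊢
    exact (hf.el_congr h).symm
  refine ⟨fun x => (f (X x)).el hT' (r x), ?_, key⟩
  intro x y hxy
  obtain ⟨Φ, i, rfl⟩ := el_rep hT x
  obtain ⟨Ψ, j, rfl⟩ := el_rep hT y
  have hij := Fl.el_le hT hxy
  obtain ⟨Ω, h1, h2⟩ := el_inc hT hxy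
  rw [← h1, ← h2]
  change (f (X (Ω.el hT i))).el hT' (r (Ω.el hT i)) ≤ (f (X (Ω.el hT j))).el hT' (r (Ω.el hT j))
  rw [key, key]
  exact ((f Ω).el_mono hT').monotone hij

lemma Equivar.symm {hT : IsLFCTiling T} {hT' : IsLFCTiling T'} {f : Fl T ≃ Fl T'}
    (hf : Equivar hT hT' f) : Equivar hT' hT f.symm :=
  ⟨fun Φ => by rw [Equiv.symm_apply_eq, hf.e0, Equiv.apply_symm_apply],
   fun Φ => by rw [Equiv.symm_apply_eq, hf.e1, Equiv.apply_symm_apply],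
   fun Φ => by rw [Equiv.symm_apply_eq, hf.e2, Equiv.apply_symm_apply]⟩

theorem Equivar.exists_iso {hT : IsLFCTiling T} {hT' : IsLFCTiling T'} {f : Fl T ≃ Fl T'}
    (hf : Equivar hT hT' f) : ∃ γ : TPoset T ≃o TPoset T',
      ∀ Φ i, γ (Φ.el hT i) = (f Φ).el hT' i := by
  obtain ⟨F, hF, h1⟩ := hf.exists_map
  obtain ⟨G, hG, h2⟩ := hf.symm.exists_map
  have e1 : ∀ x, G (F x) = x := by
    intro x
    obtain ⟨Φ, i, rfl⟩ := el_rep hT x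
    rw [h1, h2, Equiv.symm_apply_apply]
  have e2 : ∀ x, F (G x) = x := by
    intro x
    obtain ⟨Φ, i, rfl⟩ := el_rep hT' x
    rw [h2, h1, Equiv.apply_symm_apply]
  refine ⟨⟨⟨F, G, e1, e2⟩, ?_⟩, h1⟩
  intro x y
  constructor
  · intro h
    have := hG h
    simpa [e1] using this
  · intro h; exact hF h

lemma iso_el (hT : IsLFCTiling T) (hT' : IsLFCTiling T') (γ : TPoset T ≃o TPoset T') (Φ : Fl T) :
    ∃ Ψ : Fl T', ∀ i, γ (Φ.el hT i) = Ψ.el hT' i := by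
  have hch : IsChain (· ≤ ·) (Set.range (fun i => γ (Φ.el hT i))) := by
    rintro _ ⟨i, rfl⟩ _ ⟨j, rfl⟩ _
    rcases le_total i j with h | h
    · exact Or.inl (γ.monotone ((Φ.el_mono hT).monotone h))
    · exact Or.inr (γ.monotone ((Φ.el_mono hT).monotone h))
  obtain ⟨Ψ, hΨ⟩ := chain_sub hT' hch
  have : ∀ i, ∃ j, Ψ.el hT' j = γ (Φ.el hT i) := fun i => hΨ ⟨i, rfl⟩
  choose r hr using this
  have hm : StrictMono r := by
    intro i j hij
    have h1 : Ψ.el hT' (r i) < Ψ.el hT' (r j) := by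
      rw [hr, hr]
      exact γ.strictMono (Φ.el_mono hT hij)
    exact (Ψ.el_mono hT').lt_iff_lt.1 h1
  refine ⟨Ψ, fun i => ?_⟩
  have h01 := hm (show (0 : Fin 5) < 1 by decide)
  have h12 := hm (show (1 : Fin 5) < 2 by decide)
  have h23 := hm (show (2 : Fin 5) < 3 by decide)
  have h34 := hm (show (3 : Fin 5) < 4 by decide)
  have hi : i = 0 ∨ i = 1 ∨ i = 2 ∨ i = 3 ∨ i = 4 := by omega
  have : r i = i := by
    rcases hi with rfl | rfl | rfl | rfl | rfl <;> omega
  rw [← hr, this]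

theorem exists_equivar (hT : IsLFCTiling T) (γ : TPoset T ≃o TPoset T) :
    ∃ f : Fl T ≃ Fl T, Equivar hT hT f ∧ ∀ Φ i, γ (Φ.el hT i) = (f Φ).el hT i := by
  choose f hf using iso_el hT hT γ
  choose g hg using iso_el hT hT γ.symm
  have e1 : ∀ Φ, g (f Φ) = Φ := fun Φ => Fl.el_ext hT (fun i => by
    rw [← hg, ← hf, OrderIso.symm_apply_apply])
  have e2 : ∀ Φ, f (g Φ) = Φ := fun Φ => Fl.el_ext hT (fun i => by
    rw [← hf, ← hg, OrderIso.apply_symm_apply])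
  have inj : Function.Injective f := Function.LeftInverse.injective e1
  refine ⟨⟨f, g, e1, e2⟩, ⟨?_, ?_, ?_⟩, hf⟩
  · intro Φ
    rcases Fl.el_adj0 hT (Φ := f Φ) (Ψ := f Φ.s0) (fun i hi => by
      rw [← hf, ← hf, Fl.el_s0 hT _ hi]) with h | h
    · exact absurd (inj h) Φ.s0_ne
    · exact h
  · intro Φ
    rcases Fl.el_adj1 hT (Φ := f Φ) (Ψ := f (Φ.s1 hT)) (fun i hi => by
      rw [← hf, ← hf, Fl.el_s1 hT _ hi]) with h | h
    · exact absurd (inj h) (Φ.s1_ne hT)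
    · exact h
  · intro Φ
    rcases Fl.el_adj2 hT (Φ := f Φ) (Ψ := f (Φ.s2 hT)) (fun i hi => by
      rw [← hf, ← hf, Fl.el_s2 hT _ hi]) with h | h
    · exact absurd (inj h) (Φ.s2_ne hT)
    · exact h

/-- Same orbit, for flags. -/
def Fl.Orb (hT : IsLFCTiling T) (Φ Ψ : Fl T) : Prop :=
  ∃ f : Fl T ≃ Fl T, Equivar hT hT f ∧ f Φ = Ψ

lemma Fl.orb_iff (hT : IsLFCTiling T) {Φ Ψ : Fl T} :
    SameFlagOrbit (Φ.flag hT) (Ψ.flag hT) ↔ Fl.Orb hT Φ Ψ := by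
  constructor
  · rintro ⟨γ, hγ⟩
    obtain ⟨f, hf, h⟩ := exists_equivar hT γ
    refine ⟨f, hf, Fl.el_ext hT (fun i => ?_)⟩
    have : γ (Φ.el hT i) ∈ (Ψ.flag hT : Set (TPoset T)) := by
      rw [← hγ]
      exact ⟨_, ⟨i, rfl⟩, rfl⟩
    obtain ⟨j, hj⟩ := this
    rw [h] at hj
    have := Fl.el_rank hT hj
    subst this
    exact hj.symm
  · rintro ⟨f, hf, rfl⟩
    obtain ⟨γ, hγ⟩ := hf.exists_iso
    refine ⟨γ, ?_⟩
    change γ '' (Set.range (Φ.el hT)) = Set.range ((f Φ).el hT)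
    rw [← Set.range_comp]
    congr 1
    funext i
    exact hγ Φ i

theorem two_orb (hT : IsLFCTiling T) (h2 : TwoFlagOrbits (TPoset T)) :
    ∃ Φ Ψ : Fl T, ¬ Fl.Orb hT Φ Ψ ∧ ∀ Ω, Fl.Orb hT Ω Φ ∨ Fl.Orb hT Ω Ψ := by
  obtain ⟨C, D, h1, h2⟩ := h2
  obtain ⟨Φ, rfl⟩ := Fl.flag_surj hT C
  obtain ⟨Ψ, rfl⟩ := Fl.flag_surj hT D
  refine ⟨Φ, Ψ, fun h => h1 ((Fl.orb_iff hT).2 h), fun Ω => ?_⟩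
  rw [← Fl.orb_iff, ← Fl.orb_iff]
  exact h2 _

lemma semiconj_dvd {X Y : Type*} {f : X → X} {g : Y → Y} {h : X → Y} (hs : Function.Semiconj h f g)
    (x : X) : Function.minimalPeriod g (h x) ∣ Function.minimalPeriod f x :=
  ((Function.isPeriodicPt_minimalPeriod f x).map hs).minimalPeriod_dvd

lemma Equivar.n_eq {hT : IsLFCTiling T} {hT' : IsLFCTiling T'} {f : Fl T ≃ Fl T'}
    (hf : Equivar hT hT' f) (Φ : Fl T) : (f Φ).n hT' = Φ.n hT := by
  have hs : Function.Semiconj f (Fl.s0 ∘ Fl.s1 hT) (Fl.s0 ∘ Fl.s1 hT') := fun Φ => by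
    simp only [Function.comp]; rw [hf.e0, hf.e1]
  have hs' : Function.Semiconj f.symm (Fl.s0 ∘ Fl.s1 hT') (Fl.s0 ∘ Fl.s1 hT) := fun Φ => by
    simp only [Function.comp]; rw [hf.symm.e0, hf.symm.e1]
  refine Nat.dvd_antisymm (semiconj_dvd hs Φ) ?_
  have := semiconj_dvd hs' (f Φ)
  rwa [Equiv.symm_apply_apply] at this

lemma Equivar.d_eq {hT : IsLFCTiling T} {hT' : IsLFCTiling T'} {f : Fl T ≃ Fl T'}
    (hf : Equivar hT hT' f) (Φ : Fl T) : (f Φ).d hT' = Φ.d hT := by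
  have hs : Function.Semiconj f (Fl.s2 hT ∘ Fl.s1 hT) (Fl.s2 hT' ∘ Fl.s1 hT') := fun Φ => by
    simp only [Function.comp]; rw [hf.e2, hf.e1]
  have hs' : Function.Semiconj f.symm (Fl.s2 hT' ∘ Fl.s1 hT') (Fl.s2 hT ∘ Fl.s1 hT) := fun Φ => by
    simp only [Function.comp]; rw [hf.symm.e2, hf.symm.e1]
  refine Nat.dvd_antisymm (semiconj_dvd hs Φ) ?_
  have := semiconj_dvd hs' (f Φ)
  rwa [Equiv.symm_apply_apply] at this

end faceposet2

open scoped Classical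

section twoorbit
variable {T : Set (Set (EucSp 2))}

lemma Fl.Orb.symm {hT : IsLFCTiling T} {Φ Ψ : Fl T} (h : Fl.Orb hT Φ Ψ) : Fl.Orb hT Ψ Φ := by
  obtain ⟨f, hf, rfl⟩ := h
  exact ⟨f.symm, hf.symm, f.symm_apply_apply Φ⟩

lemma Fl.Orb.trans {hT : IsLFCTiling T} {Φ Ψ Ω : Fl T} (h : Fl.Orb hT Φ Ψ) (h' : Fl.Orb hT Ψ Ω) :
    Fl.Orb hT Φ Ω := by
  obtain ⟨f, hf, rfl⟩ := h
  obtain ⟨g, hg, rfl⟩ := h'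
  exact ⟨f.trans g, ⟨fun X => by simp [hf.e0, hg.e0], fun X => by simp [hf.e1, hg.e1],
    fun X => by simp [hf.e2, hg.e2]⟩, rfl⟩

lemma flip_aux {X : Type*} {orb : X → X → Prop} (sym : ∀ x y, orb x y → orb y x)
    (tr : ∀ x y z, orb x y → orb y z → orb x z) {col : X → ℕ} {g : X → X}
    (hg : ∀ x y, orb x y → orb (g x) (g y)) (hc : ∀ x y, orb x y → col x = col y) {a b : X}
    (hab : ∀ x, orb x a ∨ orb x b) (hne : col a ≠ col b)
    (conn : ∀ c, (∀ x, col x = c → col (g x) = c) → ∀ x, col x = c → ∀ y, col y = c) (x : X) :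
    col (g x) ≠ col x := by
  intro h
  have key : ∀ y, col y = col x → orb y x := by
    intro y hy
    rcases hab x with hx | hx <;> rcases hab y with hy' | hy'
    · exact tr _ _ _ hy' (sym _ _ hx)
    · exact absurd ((hc _ _ hx).symm.trans (hy.symm.trans (hc _ _ hy'))) hne
    · exact absurd ((hc _ _ hy').symm.trans (hy.trans (hc _ _ hx))) hne
    · exact tr _ _ _ hy' (sym _ _ hx)
  have all := conn (col x) (fun y hy => by
    rw [hc _ _ (hg _ _ (key y hy)), h]) x rfl
  exact hne ((all a).trans (all b).symm)

theorem two_orbit_cases (hT : IsLFCTiling T) (h2 : TwoFlagOrbits (TPoset T)) :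
    (∃ p q D : ℕ, p ≠ q ∧ (∃ Φ : Fl T, Φ.n hT = p) ∧ (∀ Φ : Fl T, Φ.d hT = D) ∧
      (∀ Φ : Fl T, Φ.n hT = p ∨ Φ.n hT = q) ∧ ∀ Φ : Fl T, (Φ.s2 hT).n hT ≠ Φ.n hT) ∨
    (∃ p q D : ℕ, p ≠ q ∧ (∃ Φ : Fl T, Φ.d hT = p) ∧ (∀ Φ : Fl T, Φ.n hT = D) ∧
      (∀ Φ : Fl T, Φ.d hT = p ∨ Φ.d hT = q) ∧ ∀ Φ : Fl T, Φ.s0.d hT ≠ Φ.d hT) := by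
  obtain ⟨a, b, hab, hall⟩ := two_orb hT h2
  have hn : ∀ Φ Ψ : Fl T, Fl.Orb hT Φ Ψ → Φ.n hT = Ψ.n hT := by
    rintro Φ Ψ ⟨f, hf, rfl⟩; exact (hf.n_eq Φ).symm
  have hd : ∀ Φ Ψ : Fl T, Fl.Orb hT Φ Ψ → Φ.d hT = Ψ.d hT := by
    rintro Φ Ψ ⟨f, hf, rfl⟩; exact (hf.d_eq Φ).symm
  have h0 : ∀ Φ Ψ : Fl T, Fl.Orb hT Φ Ψ → Fl.Orb hT Φ.s0 Ψ.s0 := by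
    rintro Φ Ψ ⟨f, hf, rfl⟩; exact ⟨f, hf, hf.e0 Φ⟩
  have h2 : ∀ Φ Ψ : Fl T, Fl.Orb hT Φ Ψ → Fl.Orb hT (Φ.s2 hT) (Ψ.s2 hT) := by
    rintro Φ Ψ ⟨f, hf, rfl⟩; exact ⟨f, hf, hf.e2 Φ⟩
  by_cases hne : a.n hT = b.n hT
  · by_cases hde : a.d hT = b.d hT
    · exfalso
      apply hab
      refine develop_equiv (R := fun _ _ => True) ⟨fun _ _ _ => trivial, fun _ _ _ => trivial,
        fun _ _ _ => trivial, fun Φ Ψ _ => ?_, fun Φ Ψ _ => ?_⟩ trivial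
      · have : ∀ X : Fl T, X.n hT = a.n hT := fun X => by
          rcases hall X with h | h
          · exact hn _ _ h
          · rw [hn _ _ h, hne]
        rw [this, this Ψ]
      · have : ∀ X : Fl T, X.d hT = a.d hT := fun X => by
          rcases hall X with h | h
          · exact hd _ _ h
          · rw [hd _ _ h, hde]
        rw [this, this Ψ]
    · right
      have flip := flip_aux (orb := Fl.Orb hT) (fun _ _ h => h.symm) (fun _ _ _ h h' => h.trans h')
        (col := Fl.d hT) (g := Fl.s0) h0 hd hall hde (fun c hc x hx y => flag_conn hT
          (P := fun z => z.d hT = c) hc (fun z hz => by rw [Fl.d_s1]; exact hz)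
          (fun z hz => by rw [Fl.d_s2]; exact hz) hx y)
      refine ⟨a.d hT, b.d hT, a.n hT, hde, ⟨a, rfl⟩, fun X => ?_, fun X => ?_, flip⟩
      · rcases hall X with h | h
        · exact hn _ _ h
        · rw [hn _ _ h, hne]
      · rcases hall X with h | h
        · exact Or.inl (hd _ _ h)
        · exact Or.inr (hd _ _ h)
  · left
    have flip := flip_aux (orb := Fl.Orb hT) (fun _ _ h => h.symm) (fun _ _ _ h h' => h.trans h')
      (col := Fl.n hT) (g := Fl.s2 hT) h2 hn hall hne (fun c hc x hx y => flag_conn hT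
        (P := fun z => z.n hT = c) (fun z hz => by rw [Fl.n_s0]; exact hz)
        (fun z hz => by rw [Fl.n_s1]; exact hz) hc hx y)
    have hdab : a.d hT = b.d hT := by
      rcases hall (a.s2 hT) with h | h
      · exact absurd (hn _ _ h) (flip a)
      · rw [← hd _ _ h, Fl.d_s2]
    refine ⟨a.n hT, b.n hT, a.d hT, hne, ⟨a, rfl⟩, fun X => ?_, fun X => ?_, flip⟩
    · rcases hall X with h | h
      · exact hd _ _ h
      · rw [hd _ _ h, hdab]
    · rcases hall X with h | h
      · exact Or.inl (hn _ _ h)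
      · exact Or.inr (hn _ _ h)

lemma iterate_flip {X : Type*} {F : X → X} {c : X → Prop} (h : ∀ x, c (F x) ↔ ¬ c x) (k : ℕ) :
    ∀ x, c (F^[k] x) ↔ (if Even k then c x else ¬ c x) := by
  induction k with
  | zero => simp
  | succ k ih =>
    intro x
    rw [Function.iterate_succ_apply', h, ih]
    by_cases hk : Even k
    · rw [if_pos hk, if_neg (by rw [Nat.even_add_one]; exact not_not.2 hk)]
    · rw [if_neg hk, if_pos (by rw [Nat.even_add_one]; exact hk), not_not]

lemma even_period {X : Type*} {F : X → X} {c : X → Prop} (h : ∀ x, c (F x) ↔ ¬ c x) (x : X) :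
    Even (Function.minimalPeriod F x) := by
  by_contra hk
  have h1 := iterate_flip h (Function.minimalPeriod F x) x
  have h2 : F^[Function.minimalPeriod F x] x = x := Function.isPeriodicPt_minimalPeriod F x
  rw [if_neg hk, h2] at h1
  tauto

lemma even_d (hT : IsLFCTiling T) {p q : ℕ} (h : ∀ Φ : Fl T, Φ.n hT = p ∨ Φ.n hT = q)
    (h' : ∀ Φ : Fl T, (Φ.s2 hT).n hT ≠ Φ.n hT) (Φ : Fl T) : Even (Φ.d hT) := by
  refine even_period (c := fun Ψ : Fl T => Ψ.n hT = p) (fun Ψ => ?_) Φ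
  simp only [Function.comp]
  have h1 := h' (Ψ.s1 hT)
  have h2 := h ((Ψ.s1 hT).s2 hT)
  have h3 := h Ψ
  rw [Fl.n_s1] at h1
  omega

lemma even_n (hT : IsLFCTiling T) {p q : ℕ} (h : ∀ Φ : Fl T, Φ.d hT = p ∨ Φ.d hT = q)
    (h' : ∀ Φ : Fl T, (Φ.s0).d hT ≠ Φ.d hT) (Φ : Fl T) : Even (Φ.n hT) := by
  refine even_period (c := fun Ψ : Fl T => Ψ.d hT = p) (fun Ψ => ?_) Φ
  simp only [Function.comp]
  have h1 := h' (Ψ.s1 hT)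
  have h2 := h ((Ψ.s1 hT).s0)
  have h3 := h Ψ
  rw [Fl.d_s1] at h1
  omega

end twoorbit

open scoped Classical

section euler1
variable {T : Set (Set (EucSp 2))}

lemma Fl.cone (hT : IsLFCTiling T) (Φ : Fl T) {x : EucSp 2} (hx : x ∈ Φ.tile) :
    ∃ α β : ℝ, 0 ≤ α ∧ 0 ≤ β ∧ x - Φ.v = α • (Φ.w - Φ.v) + β • ((Φ.s1 hT).w - Φ.v) := by
  obtain ⟨w₁, w₂, h12, h1, h2, e1, e2, hu, hc⟩ := vertex_edges (hT.polytope _ Φ.mem) Φ.v_ext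
  obtain ⟨α, β, hα, hβ, e⟩ := hc x hx
  have hne := Φ.s1_w_ne hT
  rcases hu _ Φ.ne Φ.exp with h | h <;> rcases hu _ (Φ.s1 hT).ne (Φ.s1 hT).exp with h' | h'
  · exact absurd (h'.trans h.symm) hne
  · exact ⟨α, β, hα, hβ, by rw [h, h', e]⟩
  · exact ⟨β, α, hβ, hα, by rw [h, h', e, add_comm]⟩
  · exact absurd (h'.trans h.symm) hne

/-- A functional which is not constant on any edge. -/
def GenFun (T : Set (Set (EucSp 2))) (c : ℝ) : Prop := ∀ Φ : Fl T, lin 1 c (Φ.w - Φ.v) ≠ 0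

/-- `v` is a saddle of the functional in its tile. -/
def Fl.sad (hT : IsLFCTiling T) (c : ℝ) (Φ : Fl T) : Prop :=
  lin 1 c (Φ.w - Φ.v) * lin 1 c ((Φ.s1 hT).w - Φ.v) < 0

lemma Fl.sad_s1 (hT : IsLFCTiling T) (c : ℝ) (Φ : Fl T) : (Φ.s1 hT).sad hT c ↔ Φ.sad hT c := by
  unfold Fl.sad
  rw [Fl.s1_s1, Fl.s1_v, mul_comm]

lemma ker_lin {c : ℝ} {x : EucSp 2} (h : lin 1 c x = 0) : x = x 1 • pt2 (-c) 1 := by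
  simp only [lin_apply] at h
  apply ext2
  · simp [pt2]; linarith
  · simp [pt2]

lemma lin_dir (c : ℝ) : lin 1 c (pt2 (-c) 1) = 0 := by simp [pt2]

lemma Fl.sad_imp (hT : IsLFCTiling T) {c : ℝ} {Φ : Fl T} (h : Φ.sad hT c) :
    (∃ ε : ℝ, 0 < ε ∧ Φ.v + ε • pt2 (-c) 1 ∈ Φ.tile) ∨
    (∃ ε : ℝ, 0 < ε ∧ Φ.v + ε • (-pt2 (-c) 1) ∈ Φ.tile) := by
  unfold Fl.sad at h
  set p := lin 1 c (Φ.w - Φ.v) with hp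
  set q := lin 1 c ((Φ.s1 hT).w - Φ.v) with hq
  have hp0 : p ≠ 0 := by rintro h0; rw [h0] at h; simp at h
  have hq0 : q ≠ 0 := by rintro h0; rw [h0] at h; simp at h
  set μ := |q| / (|p| + |q|) with hμ
  have hs : 0 < |p| + |q| := by positivity
  have h0 : 0 ≤ μ := by positivity
  have hν : 1 - μ = |p| / (|p| + |q|) := by rw [hμ]; field_simp; ring
  have h1 : 0 ≤ 1 - μ := by rw [hν]; positivity
  have hmem : μ • Φ.w + (1 - μ) • (Φ.s1 hT).w ∈ segment ℝ Φ.w (Φ.s1 hT).w :=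
    ⟨μ, 1 - μ, h0, h1, by ring, rfl⟩
  have hmem' : μ • Φ.w + (1 - μ) • (Φ.s1 hT).w ∈ Φ.tile :=
    (hT.polytope _ Φ.mem).convex'.segment_subset Φ.w_mem (Φ.s1 hT).w_mem hmem
  set y := μ • Φ.w + (1 - μ) • (Φ.s1 hT).w with hy
  have hyv : y - Φ.v = μ • (Φ.w - Φ.v) + (1 - μ) • ((Φ.s1 hT).w - Φ.v) := by
    rw [hy]; module
  have hl : lin 1 c (y - Φ.v) = 0 := by
    rw [hyv, map_add, map_smul, map_smul, ← hp, ← hq, hν, hμ, smul_eq_mul, smul_eq_mul]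
    have : |q| * p + |p| * q = 0 := by
      rcases lt_or_gt_of_ne hp0 with hpn | hpp
      · have : 0 < q := by nlinarith
        rw [abs_of_neg hpn, abs_of_pos this]; ring
      · have : q < 0 := by nlinarith
        rw [abs_of_pos hpp, abs_of_neg this]; ring
    field_simp
    linarith
  have hk := ker_lin hl
  have hyne : y - Φ.v ≠ 0 := by
    intro h0
    have hyv' : y = Φ.v := sub_eq_zero.1 h0
    rw [hyv'] at hmem
    rcases ext_seg_end Φ.v_ext Φ.w_mem (Φ.s1 hT).w_mem hmem with e | e
    · exact Φ.ne e
    · exact (Φ.s1 hT).ne e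
  set z := (y - Φ.v) 1 with hz
  have hz0 : z ≠ 0 := by
    intro h0; rw [h0, zero_smul] at hk; exact hyne hk
  have hyeq : y = Φ.v + (y - Φ.v) := by abel
  rcases lt_or_gt_of_ne hz0 with hn | hpz
  · right
    refine ⟨-z, by linarith, ?_⟩
    rw [smul_neg, neg_smul, neg_neg, ← hk, ← hyeq]
    exact hmem'
  · left
    refine ⟨z, hpz, ?_⟩
    rw [← hk, ← hyeq]
    exact hmem'

lemma Fl.sad_of_ray (hT : IsLFCTiling T) {c : ℝ} (hg : GenFun T c) {Φ : Fl T} {h : EucSp 2}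
    (h0 : h ≠ 0) (hl : lin 1 c h = 0) {ε : ℝ} (hε : 0 < ε) (hm : Φ.v + ε • h ∈ Φ.tile) :
    Φ.sad hT c := by
  obtain ⟨α, β, hα, hβ, e⟩ := Φ.cone hT hm
  rw [add_sub_cancel_left] at e
  have e2 := congrArg (lin 1 c) e
  rw [map_smul, hl, map_add, map_smul, map_smul] at e2
  simp only [smul_eq_mul, mul_zero] at e2
  have hp := hg Φ
  have hq := hg (Φ.s1 hT)
  rw [Fl.s1_v] at hq
  unfold Fl.sad
  by_contra hcon
  set p := lin 1 c (Φ.w - Φ.v)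
  set q := lin 1 c ((Φ.s1 hT).w - Φ.v)
  have hpq : 0 < p * q := lt_of_le_of_ne (not_lt.1 hcon) (mul_ne_zero hp hq).symm
  have hα0 : α = 0 := by
    have : 0 < p ^ 2 := by positivity
    have h3 : α * p ^ 2 + β * (p * q) = 0 := by linear_combination (-p) * e2
    nlinarith [mul_nonneg hα this.le, mul_nonneg hβ hpq.le]
  have hβ0 : β = 0 := by
    rw [hα0] at e2
    have : β * q = 0 := by linarith
    exact (mul_eq_zero.1 this).resolve_right hq
  rw [hα0, hβ0, zero_smul, zero_smul, add_zero] at e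
  rcases smul_eq_zero.1 e with h' | h'
  · linarith
  · exact h0 h'

lemma ray_tile (hT : IsLFCTiling T) {c : ℝ} (hg : GenFun T c) (Φ : Fl T) {h : EucSp 2}
    (h0 : h ≠ 0) (hl : lin 1 c h = 0) :
    ∃ t ∈ T, Φ.v ∈ t ∧ (∃ ε : ℝ, 0 < ε ∧ Φ.v + ε • h ∈ t) ∧
      ∀ t' ∈ T, Φ.v ∈ t' → (∃ ε : ℝ, 0 < ε ∧ Φ.v + ε • h ∈ t') → t' = t := by
  obtain ⟨ε, hε, hloc⟩ := hT.loc Φ.v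
  have hn : 0 < ‖h‖ := norm_pos_iff.2 h0
  obtain ⟨t, ht, hmem⟩ := hT.exists_tile (Φ.v + (ε / (2 * ‖h‖)) • h)
  have hvt : Φ.v ∈ t := hloc t ht ⟨_, hmem, by
    rw [Metric.mem_ball, dist_eq_norm, add_sub_cancel_left, norm_smul, Real.norm_eq_abs,
      abs_of_pos (by positivity)]
    field_simp
    linarith⟩
  refine ⟨t, ht, hvt, ⟨_, by positivity, hmem⟩, ?_⟩
  have hpos : 0 < ε / (2 * ‖h‖) := by positivity
  revert hmem hpos
  generalize ε / (2 * ‖h‖) = ε₁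
  intro hmem hpos t' ht' hvt' ⟨ε₂, hε₂, hmem'⟩
  by_contra hne
  set δ := min ε₁ ε₂ with hδ
  have hδ0 : 0 < δ := lt_min hpos hε₂
  have shrink : ∀ s ∈ T, Φ.v ∈ s → ∀ e, δ ≤ e → Φ.v + e • h ∈ s → Φ.v + δ • h ∈ s := by
    intro s hs hvs e he hm
    have he0 : 0 < e := lt_of_lt_of_le hδ0 he
    have := (hT.polytope s hs).convex'.add_smul_sub_mem hvs hm (t := δ / e)
      ⟨by positivity, by rw [div_le_one he0]; exact he⟩
    rw [add_sub_cancel_left, smul_smul, div_mul_cancel₀ _ he0.ne'] at this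
    exact this
  have m1 := shrink t ht hvt _ (min_le_left _ _) hmem
  have m2 := shrink t' ht' hvt' _ (min_le_right _ _) hmem'
  have hvne : Φ.v ≠ Φ.v + δ • h := by
    intro e
    have : δ • h = 0 := by
      have := congrArg (fun z => z - Φ.v) e
      simpa using this.symm
    rcases smul_eq_zero.1 this with h' | h'
    · exact hδ0.ne' h'
    · exact h0 h'
  obtain ⟨a, b, hab, e⟩ := hT.inter_seg ht ht' (Ne.symm hne) hvne ⟨hvt, hvt'⟩ ⟨m1, m2⟩
  have hexp := (hT.face_to_face t ht t' ht').1
  rw [e] at hexp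
  have hvext := hT.ext_transfer Φ.mem ht Φ.v_ext hvt
  have hvseg : Φ.v ∈ segment ℝ a b := by rw [← e]; exact ⟨hvt, hvt'⟩
  have hyseg : Φ.v + δ • h ∈ segment ℝ a b := by rw [← e]; exact ⟨m1, m2⟩
  have fin : ∀ a b : EucSp 2, a ≠ b → IsExposed ℝ t (segment ℝ a b) →
      Φ.v + δ • h ∈ segment ℝ a b → Φ.v = a → False := by
    intro a b hab hexp hy hva
    have hgen := hg ⟨t, a, b, ht, hab, hexp⟩
    simp only at hgen
    rw [segment_eq_image'] at hy
    obtain ⟨θ, _, hθ⟩ := hy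
    have h1 := congrArg (lin 1 c) hθ
    simp only [map_add, map_smul, hl, hva, smul_eq_mul, mul_zero, add_zero] at h1
    have : θ * lin 1 c (b - a) = 0 := by linarith
    have hθ0 := (mul_eq_zero.1 this).resolve_right hgen
    rw [hθ0] at hθ
    simp only [zero_smul, add_zero] at hθ
    exact hvne (hva.trans hθ)
  rcases ext_seg_end hvext (hexp.subset (left_mem_segment ℝ a b))
    (hexp.subset (right_mem_segment ℝ a b)) hvseg with hv | hv
  · exact fin a b hab hexp hyseg hv
  · rw [segment_symm] at hexp hyseg
    exact fin b a hab.symm hexp hyseg hv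

/-- Sets of flags which are two-to-one over something. -/
lemma two_to_one (hT : IsLFCTiling T) {P : Type*} {S : Set (Fl T)} {π : Fl T → P}
    (h1 : ∀ z ∈ S, z.s1 hT ∈ S) (h2 : ∀ z ∈ S, π (z.s1 hT) = π z)
    (h3 : ∀ z ∈ S, ∀ z' ∈ S, π z' = π z → z' = z ∨ z' = z.s1 hT) (hf : (π '' S).Finite) :
    S.Finite ∧ S.ncard = 2 * (π '' S).ncard := by
  have fib : ∀ z ∈ S, {z' ∈ S | π z' = π z} = {z, z.s1 hT} := by
    intro z hz
    ext z'
    constructor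
    · rintro ⟨h, h'⟩
      rcases h3 z hz z' h h' with h | h <;> simp [h]
    · rintro (h | h)
      · rw [h]; exact ⟨hz, rfl⟩
      · have : z' = z.s1 hT := h
        rw [this]; exact ⟨h1 z hz, h2 z hz⟩
  have hS : S.Finite := by
    refine Set.Finite.of_finite_fibers π hf ?_
    rintro y ⟨z, hz, rfl⟩
    have : S ∩ π ⁻¹' {π z} = {z, z.s1 hT} := by rw [← fib z hz]; rfl
    rw [this]
    exact Set.toFinite _
  refine ⟨hS, ?_⟩
  rw [Set.ncard_eq_toFinset_card S hS, Set.ncard_eq_toFinset_card _ hf,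
    Finset.card_eq_sum_card_fiberwise (f := π) (t := hf.toFinset)]
  · rw [Finset.sum_const_nat (m := 2), mul_comm]
    intro y hy
    rw [Set.Finite.mem_toFinset] at hy
    obtain ⟨z, hz, rfl⟩ := hy
    have : (hS.toFinset.filter (fun x => π x = π z)) = {z, z.s1 hT} := by
      ext x
      have := Set.ext_iff.1 (fib z hz) x
      simpa using this
    rw [this, Finset.card_pair (z.s1_ne hT).symm]
  · intro x hx
    simp only [Set.Finite.coe_toFinset] at hx ⊢
    exact ⟨x, hx, rfl⟩

lemma tile_flags (hT : IsLFCTiling T) (Φ : Fl T) : {Ψ : Fl T | Ψ.tile = Φ.tile}.Finite ∧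
    {Ψ : Fl T | Ψ.tile = Φ.tile}.ncard = 2 * Φ.n hT := by
  have e : (fun Ψ : Fl T => Ψ.v) '' {Ψ : Fl T | Ψ.tile = Φ.tile} = Φ.tile.extremePoints ℝ := by
    ext v
    constructor
    · rintro ⟨Ψ, hΨ, rfl⟩
      have := Ψ.v_ext
      rw [hΨ] at this
      exact this
    · intro hv
      obtain ⟨Ψ, h1, h2⟩ := exists_flag hT Φ.mem hv
      exact ⟨Ψ, h1, h2⟩
  have := two_to_one hT (S := {Ψ : Fl T | Ψ.tile = Φ.tile}) (π := fun Ψ => Ψ.v)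
    (fun z hz => hz) (fun z hz => rfl)
    (fun z hz z' hz' h => Fl.s1_uniq hT (Eq.trans hz' (Eq.symm hz)) h)
    (by rw [e]; exact (hT.polytope _ Φ.mem).finite_ext)
  rw [e, ← Fl.n_eq hT] at this
  exact this

lemma vertex_flags (hT : IsLFCTiling T) (Φ : Fl T) : {Ψ : Fl T | Ψ.v = Φ.v}.Finite ∧
    {Ψ : Fl T | Ψ.v = Φ.v}.ncard = 2 * Φ.d hT := by
  have e : (fun Ψ : Fl T => Ψ.tile) '' {Ψ : Fl T | Ψ.v = Φ.v} = {t ∈ T | Φ.v ∈ t} := by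
    ext t
    constructor
    · rintro ⟨Ψ, hΨ, rfl⟩
      have := Ψ.v_mem
      rw [hΨ] at this
      exact ⟨Ψ.mem, this⟩
    · rintro ⟨ht, hv⟩
      obtain ⟨Ψ, h1, h2⟩ := exists_flag hT ht (hT.ext_transfer Φ.mem ht Φ.v_ext hv)
      exact ⟨Ψ, h2, h1⟩
  have := two_to_one hT (S := {Ψ : Fl T | Ψ.v = Φ.v}) (π := fun Ψ => Ψ.tile)
    (fun z hz => hz) (fun z hz => rfl)
    (fun z hz z' hz' h => Fl.s1_uniq hT h (Eq.trans hz' (Eq.symm hz)))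
    (by rw [e]; exact hT.finite_at _)
  rw [e, ← Fl.d_eq hT] at this
  exact this

lemma dir_ne (c : ℝ) : pt2 (-c) 1 ≠ 0 := by
  intro h
  have := congrArg (fun x : EucSp 2 => x 1) h
  simp [pt2] at this

lemma vertex_sad (hT : IsLFCTiling T) {c : ℝ} (hg : GenFun T c) (Φ : Fl T) :
    {Ψ : Fl T | Ψ.v = Φ.v ∧ Ψ.sad hT c}.ncard = 4 := by
  obtain ⟨t₁, ht₁, hv₁, ⟨ε₁, hε₁, m₁⟩, u₁⟩ := ray_tile hT hg Φ (dir_ne c) (lin_dir c)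
  obtain ⟨t₂, ht₂, hv₂, ⟨ε₂, hε₂, m₂⟩, u₂⟩ := ray_tile hT hg Φ (neg_ne_zero.2 (dir_ne c))
    (by rw [map_neg, lin_dir, neg_zero])
  have hne : t₁ ≠ t₂ := by
    rintro rfl
    have hvext := hT.ext_transfer Φ.mem ht₁ Φ.v_ext hv₁
    have hs : 0 < ε₁ + ε₂ := by positivity
    have hseg : Φ.v ∈ segment ℝ (Φ.v + ε₁ • pt2 (-c) 1) (Φ.v + ε₂ • (-pt2 (-c) 1)) := by
      refine ⟨ε₂ / (ε₁ + ε₂), ε₁ / (ε₁ + ε₂), by positivity, by positivity, by field_simp; ring, ?_⟩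
      have h1 : ε₂ / (ε₁ + ε₂) + ε₁ / (ε₁ + ε₂) = 1 := by field_simp; ring
      calc _ = (ε₂ / (ε₁ + ε₂) + ε₁ / (ε₁ + ε₂)) • Φ.v +
            (ε₂ / (ε₁ + ε₂) * ε₁ - ε₁ / (ε₁ + ε₂) * ε₂) • pt2 (-c) 1 := by module
        _ = Φ.v := by
            rw [h1, show ε₂ / (ε₁ + ε₂) * ε₁ - ε₁ / (ε₁ + ε₂) * ε₂ = 0 by field_simp; ring]
            simp
    rcases ext_seg_end hvext m₁ m₂ hseg with e | e
    · have : ε₁ • pt2 (-c) 1 = 0 := by simpa using e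
      rcases smul_eq_zero.1 this with h | h
      · exact hε₁.ne' h
      · exact dir_ne c h
    · have : ε₂ • (-pt2 (-c) 1) = 0 := by simpa using e
      rcases smul_eq_zero.1 this with h | h
      · exact hε₂.ne' h
      · exact neg_ne_zero.2 (dir_ne c) h
  have e : (fun Ψ : Fl T => Ψ.tile) '' {Ψ : Fl T | Ψ.v = Φ.v ∧ Ψ.sad hT c} = {t₁, t₂} := by
    ext t
    constructor
    · rintro ⟨Ψ, ⟨hΨ, hs⟩, rfl⟩
      have hvm := Ψ.v_mem
      have := Fl.sad_imp hT hs
      rw [hΨ] at this hvm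
      rcases this with h | h
      · exact Or.inl (u₁ _ Ψ.mem hvm h)
      · exact Or.inr (u₂ _ Ψ.mem hvm h)
    · rintro (h | h)
      · subst h
        obtain ⟨Ψ, h1, h2⟩ := exists_flag hT ht₁ (hT.ext_transfer Φ.mem ht₁ Φ.v_ext hv₁)
        refine ⟨Ψ, ⟨h2, ?_⟩, h1⟩
        exact Fl.sad_of_ray hT hg (dir_ne c) (lin_dir c) hε₁ (by rw [h1, h2]; exact m₁)
      · have h' : t = t₂ := h
        subst h'
        obtain ⟨Ψ, h1, h2⟩ := exists_flag hT ht₂ (hT.ext_transfer Φ.mem ht₂ Φ.v_ext hv₂)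
        refine ⟨Ψ, ⟨h2, ?_⟩, h1⟩
        exact Fl.sad_of_ray hT hg (neg_ne_zero.2 (dir_ne c))
          (by rw [map_neg, lin_dir, neg_zero]) hε₂ (by rw [h1, h2]; exact m₂)
  have := (two_to_one hT (S := {Ψ : Fl T | Ψ.v = Φ.v ∧ Ψ.sad hT c}) (π := fun Ψ => Ψ.tile)
    (fun z hz => ⟨hz.1, (Fl.sad_s1 hT c z).2 hz.2⟩) (fun z hz => rfl)
    (fun z hz z' hz' h => Fl.s1_uniq hT h (Eq.trans hz'.1 (Eq.symm hz.1)))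
    (by rw [e]; exact Set.toFinite _)).2
  rw [this, e, Set.ncard_pair hne]

/-- Local maxima in a tile are global and unique. -/
lemma loc_max (hT : IsLFCTiling T) {l : StrongDual ℝ (EucSp 2)} {Φ : Fl T}
    (h1 : l (Φ.w - Φ.v) < 0) (h2 : l ((Φ.s1 hT).w - Φ.v) < 0) {x : EucSp 2} (hx : x ∈ Φ.tile)
    (hne : x ≠ Φ.v) : l x < l Φ.v := by
  obtain ⟨α, β, hα, hβ, e⟩ := Φ.cone hT hx
  have e2 := congrArg l e
  rw [map_sub, map_add, map_smul, map_smul, smul_eq_mul, smul_eq_mul] at e2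
  have : 0 < α ∨ 0 < β := by
    by_contra hcon
    push Not at hcon
    have ha : α = 0 := le_antisymm hcon.1 hα
    have hb : β = 0 := le_antisymm hcon.2 hβ
    rw [ha, hb, zero_smul, zero_smul, add_zero, sub_eq_zero] at e
    exact hne e
  rcases this with h | h
  · nlinarith [mul_neg_of_pos_of_neg h h1, mul_nonneg hβ (neg_nonneg.2 h2.le)]
  · nlinarith [mul_neg_of_pos_of_neg h h2, mul_nonneg hα (neg_nonneg.2 h1.le)]

lemma exists_loc_max (hT : IsLFCTiling T) {l : StrongDual ℝ (EucSp 2)}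
    (hl : ∀ Φ : Fl T, l (Φ.w - Φ.v) ≠ 0) (Φ : Fl T) :
    ∃ v ∈ Φ.tile.extremePoints ℝ, ∀ Ψ : Fl T, Ψ.tile = Φ.tile →
      (Ψ.v = v ↔ (l (Ψ.w - Ψ.v) < 0 ∧ l ((Ψ.s1 hT).w - Ψ.v) < 0)) := by
  have hp := hT.polytope _ Φ.mem
  obtain ⟨v, hv, hmax⟩ := hp.finite_ext.exists_maximalFor (fun v => l v) _ ⟨_, Φ.v_ext⟩
  have hmax' : ∀ w ∈ Φ.tile.extremePoints ℝ, l w ≤ l v := by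
    intro w hw
    by_contra hcon
    push Not at hcon
    exact absurd (hmax hw hcon.le) (not_le.2 hcon)
  refine ⟨v, hv, fun Ψ hΨ => ?_⟩
  have hwe : ∀ X : Fl T, X.tile = Φ.tile → X.v = v → l (X.w - X.v) < 0 := by
    intro X hX hXv
    refine lt_of_le_of_ne ?_ (hl X)
    have h1 := X.w_ext
    rw [hX] at h1
    have := hmax' _ h1
    rw [map_sub, hXv]; linarith
  constructor
  · intro h
    exact ⟨hwe Ψ hΨ h, hwe (Ψ.s1 hT) hΨ h⟩
  · rintro ⟨h1, h2⟩
    by_contra hne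
    have := loc_max hT h1 h2 (x := v) (by rw [hΨ]; exact hv.1) (Ne.symm hne)
    have h3 := Ψ.v_ext
    rw [hΨ] at h3
    linarith [hmax' _ h3]

lemma tile_sad (hT : IsLFCTiling T) {c : ℝ} (hg : GenFun T c) (Φ : Fl T) :
    {Ψ : Fl T | Ψ.tile = Φ.tile ∧ ¬ Ψ.sad hT c}.ncard = 4 := by
  obtain ⟨v₁, hv₁, h₁⟩ := exists_loc_max hT (l := lin 1 c) hg Φ
  obtain ⟨v₂, hv₂, h₂⟩ := exists_loc_max hT (l := -lin 1 c) (fun X => by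
    rw [neg_apply]; exact neg_ne_zero.2 (hg X)) Φ
  simp only [neg_apply, neg_lt_zero] at h₂
  have key : ∀ Ψ : Fl T, Ψ.tile = Φ.tile → (¬ Ψ.sad hT c ↔ (Ψ.v = v₁ ∨ Ψ.v = v₂)) := by
    intro Ψ hΨ
    rw [h₁ Ψ hΨ, h₂ Ψ hΨ, Fl.sad, not_lt]
    have hp := hg Ψ
    have hq := hg (Ψ.s1 hT)
    rw [Fl.s1_v] at hq
    constructor
    · intro h
      rcases lt_or_gt_of_ne hp with hp | hp
      · left; refine ⟨hp, ?_⟩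
        rcases lt_or_gt_of_ne hq with hq | hq
        · exact hq
        · nlinarith
      · right; refine ⟨hp, ?_⟩
        rcases lt_or_gt_of_ne hq with hq | hq
        · nlinarith
        · exact hq
    · rintro (⟨h, h'⟩ | ⟨h, h'⟩) <;> nlinarith
  have hne : v₁ ≠ v₂ := by
    intro e
    obtain ⟨Ψ, h3, h4⟩ := exists_flag hT Φ.mem hv₁
    have a := (h₁ Ψ h3).1 h4
    have b := (h₂ Ψ h3).1 (h4.trans e)
    linarith [a.1, b.1]
  have e : (fun Ψ : Fl T => Ψ.v) '' {Ψ : Fl T | Ψ.tile = Φ.tile ∧ ¬ Ψ.sad hT c} = {v₁, v₂} := by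
    ext v
    constructor
    · rintro ⟨Ψ, ⟨hΨ, hs⟩, rfl⟩
      exact (key Ψ hΨ).1 hs
    · intro h
      have hv : v ∈ Φ.tile.extremePoints ℝ := by
        rcases h with h | h
        · rw [h]; exact hv₁
        · have h' : v = v₂ := h
          rw [h']; exact hv₂
      obtain ⟨Ψ, h3, h4⟩ := exists_flag hT Φ.mem hv
      refine ⟨Ψ, ⟨h3, (key Ψ h3).2 ?_⟩, h4⟩
      rw [h4]; exact h
  have := (two_to_one hT (S := {Ψ : Fl T | Ψ.tile = Φ.tile ∧ ¬ Ψ.sad hT c}) (π := fun Ψ => Ψ.v)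
    (fun z hz => ⟨hz.1, fun h => hz.2 ((Fl.sad_s1 hT c z).1 h)⟩) (fun z hz => rfl)
    (fun z hz z' hz' h => Fl.s1_uniq hT (Eq.trans hz'.1 (Eq.symm hz.1)) h)
    (by rw [e]; exact Set.toFinite _)).2
  rw [this, e, Set.ncard_pair hne]

end euler1

open scoped Classical

section euler2
variable {T : Set (Set (EucSp 2))}

/-- Flags whose tile meets the ball of radius `R`. -/
def FR (T : Set (Set (EucSp 2))) (R : ℝ) : Set (Fl T) :=
  {Φ | (Φ.tile ∩ Metric.closedBall 0 R).Nonempty}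

lemma FR_finite (hT : IsLFCTiling T) (R : ℝ) : (FR T R).Finite := by
  have h1 := hT.locally_finite (Metric.closedBall 0 R) Metric.isBounded_closedBall
  have h2 : (⋃ t ∈ {t ∈ T | (t ∩ Metric.closedBall 0 R).Nonempty},
      {Ψ : Fl T | Ψ.tile = t}).Finite := by
    apply h1.biUnion
    rintro t ⟨ht, -⟩
    obtain ⟨Φ, rfl⟩ := exists_flag_tile hT ht
    exact (tile_flags hT Φ).1
  refine h2.subset fun Φ hΦ => ?_
  simp only [Set.mem_iUnion]
  exact ⟨Φ.tile, ⟨Φ.mem, hΦ⟩, rfl⟩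

lemma fl_countable (hT : IsLFCTiling T) : Countable (Fl T) := by
  have : (Set.univ : Set (Fl T)) = ⋃ k : ℕ, FR T k := by
    symm
    rw [Set.eq_univ_iff_forall]
    intro Φ
    obtain ⟨k, hk⟩ := exists_nat_ge ‖Φ.v‖
    exact Set.mem_iUnion.2 ⟨k, Φ.v, Φ.v_mem, by simpa using hk⟩
  rw [← Set.countable_univ_iff, this]
  exact Set.countable_iUnion fun k => (FR_finite hT k).countable

lemma exists_gen (hT : IsLFCTiling T) : ∃ c, GenFun T c := by
  have := fl_countable hT
  have h : (⋃ Φ : Fl T, {c : ℝ | lin 1 c (Φ.w - Φ.v) = 0}).Countable := by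
    apply Set.countable_iUnion
    intro Φ
    apply Set.Subsingleton.countable
    intro a ha b hb
    simp only [Set.mem_ofPred_eq, lin_apply, one_mul] at ha hb
    have h0 : (Φ.w - Φ.v) ≠ 0 := sub_ne_zero.2 Φ.ne.symm
    by_contra hab
    have h1 : (a - b) * (Φ.w - Φ.v) 1 = 0 := by linarith
    rcases mul_eq_zero.1 h1 with h1 | h1
    · exact hab (sub_eq_zero.1 h1)
    · rw [h1] at ha
      apply h0
      apply ext2
      · simpa using ha
      · simpa using h1
  by_contra hc
  push Not at hc
  have : (⋃ Φ : Fl T, {c : ℝ | lin 1 c (Φ.w - Φ.v) = 0}) = Set.univ := by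
    rw [Set.eq_univ_iff_forall]
    intro c
    have := hc c
    unfold GenFun at this
    push Not at this
    obtain ⟨Φ, hΦ⟩ := this
    exact Set.mem_iUnion.2 ⟨Φ, hΦ⟩
  rw [this] at h
  exact Cardinal.not_countable_real h

/-- Indicator of saddles. -/
noncomputable def Fl.al (hT : IsLFCTiling T) (c : ℝ) (Φ : Fl T) : ℝ := if Φ.sad hT c then 1 else 0

lemma sum_fib {P : Type*} (F : Finset (Fl T)) (π : Fl T → P) (f : Fl T → ℝ)
    (h : ∀ Φ ∈ F, ∀ G : Finset (Fl T), (∀ Ψ, Ψ ∈ G ↔ Ψ ∈ F ∧ π Ψ = π Φ) → ∑ Ψ ∈ G, f Ψ = 0) : ∑ Φ ∈ F, f Φ = 0 := by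
  rw [← Finset.sum_fiberwise_of_maps_to (t := F.image π) (g := π)
    (fun x hx => Finset.mem_image_of_mem _ hx)]
  apply Finset.sum_eq_zero
  intro p hp
  obtain ⟨Φ, hΦ, rfl⟩ := Finset.mem_image.1 hp
  exact h Φ hΦ _ fun Ψ => by rw [Finset.mem_filter]

lemma sumA (hT : IsLFCTiling T) {c : ℝ} (hg : GenFun T c) (F : Finset (Fl T))
    (hF : ∀ Φ ∈ F, ∀ Ψ : Fl T, Ψ.tile = Φ.tile → Ψ ∈ F) :
    ∑ Φ ∈ F, (Φ.al hT c - 1 + 2 / (Φ.n hT : ℝ)) = 0 := by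
  apply sum_fib F Fl.tile
  intro Φ hΦ G hG
  have e1 : (G : Set (Fl T)) = {Ψ | Ψ.tile = Φ.tile} := by
    ext Ψ
    rw [Finset.mem_coe, hG]
    simp only [Set.mem_ofPred_eq, and_iff_right_iff_imp]
    exact fun h => hF Φ hΦ Ψ h
  have e2 : ((G.filter fun Ψ => ¬ Ψ.sad hT c : Finset (Fl T)) : Set (Fl T)) =
      {Ψ | Ψ.tile = Φ.tile ∧ ¬ Ψ.sad hT c} := by
    rw [Finset.coe_filter]
    ext Ψ
    have : Ψ ∈ G ↔ Ψ.tile = Φ.tile := by rw [← Finset.mem_coe, e1]; rfl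
    simp [this]
  have c1 := (tile_flags hT Φ).2
  rw [← e1, Set.ncard_coe_finset] at c1
  have c2 := tile_sad hT hg Φ
  rw [← e2, Set.ncard_coe_finset] at c2
  have h1 : ∀ Ψ ∈ G, Ψ.al hT c - 1 + 2 / (Ψ.n hT : ℝ) =
      -(if ¬ Ψ.sad hT c then 1 else 0) + 2 / (Φ.n hT : ℝ) := by
    intro Ψ h
    have : Ψ.tile = Φ.tile := by
      have := Finset.mem_coe.2 h
      rwa [e1] at this
    rw [Fl.n_eq hT Ψ, this, ← Fl.n_eq hT]
    unfold Fl.al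
    split_ifs <;> simp_all
  rw [Finset.sum_congr rfl h1, Finset.sum_add_distrib, Finset.sum_neg_distrib, ← Finset.sum_filter,
    Finset.sum_const, Finset.sum_const, c1, c2]
  have : (Φ.n hT : ℝ) ≠ 0 := by have := Φ.n_ge hT; positivity
  simp only [nsmul_eq_mul]
  push_cast
  field_simp
  norm_num

lemma sumB (hT : IsLFCTiling T) {c : ℝ} (hg : GenFun T c) (F : Finset (Fl T))
    (hF : ∀ Φ ∈ F, ∀ Ψ : Fl T, Ψ.v = Φ.v → Ψ ∈ F) :
    ∑ Φ ∈ F, (Φ.al hT c - 2 / (Φ.d hT : ℝ)) = 0 := by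
  apply sum_fib F Fl.v
  intro Φ hΦ G hG
  have e1 : (G : Set (Fl T)) = {Ψ | Ψ.v = Φ.v} := by
    ext Ψ
    rw [Finset.mem_coe, hG]
    simp only [Set.mem_ofPred_eq, and_iff_right_iff_imp]
    exact fun h => hF Φ hΦ Ψ h
  have e2 : ((G.filter fun Ψ => Ψ.sad hT c : Finset (Fl T)) : Set (Fl T)) =
      {Ψ | Ψ.v = Φ.v ∧ Ψ.sad hT c} := by
    rw [Finset.coe_filter]
    ext Ψ
    have : Ψ ∈ G ↔ Ψ.v = Φ.v := by rw [← Finset.mem_coe, e1]; rfl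
    simp [this]
  have c1 := (vertex_flags hT Φ).2
  rw [← e1, Set.ncard_coe_finset] at c1
  have c2 := vertex_sad hT hg Φ
  rw [← e2, Set.ncard_coe_finset] at c2
  have h1 : ∀ Ψ ∈ G, Ψ.al hT c - 2 / (Ψ.d hT : ℝ) =
      (if Ψ.sad hT c then 1 else 0) - 2 / (Φ.d hT : ℝ) := by
    intro Ψ h
    have : Ψ.v = Φ.v := by
      have := Finset.mem_coe.2 h
      rwa [e1] at this
    rw [Fl.d_eq, this, ← Fl.d_eq]
    rfl
  rw [Finset.sum_congr rfl h1, Finset.sum_sub_distrib, ← Finset.sum_filter,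
    Finset.sum_const, Finset.sum_const, c1, c2]
  have : (Φ.d hT : ℝ) ≠ 0 := by have := Φ.d_ge hT; positivity
  simp only [nsmul_eq_mul]
  push_cast
  field_simp
  norm_num

/-- Flag curvature. -/
noncomputable def Fl.ka (hT : IsLFCTiling T) (Φ : Fl T) : ℝ :=
  2 / (Φ.n hT : ℝ) + 2 / (Φ.d hT : ℝ) - 1

lemma frac_bd {k : ℕ} (h : 3 ≤ k) : 0 ≤ 2 / (k : ℝ) ∧ 2 / (k : ℝ) ≤ 2 / 3 := by
  have : (3 : ℝ) ≤ k := by exact_mod_cast h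
  constructor
  · positivity
  · rw [div_le_div_iff₀ (by linarith) (by norm_num)]; linarith

lemma FR_diam (hT : IsLFCTiling T) {U : ℝ} (hU : ∀ t ∈ T, ∃ x, t ⊆ Metric.closedBall x U) {R : ℝ}
    {Φ Ψ : Fl T} (h : Φ.v ∈ Ψ.tile) (hΦ : Φ ∈ FR T (R - 2 * U)) : Ψ ∈ FR T R := by
  obtain ⟨y, hy, hyR⟩ := hΦ
  obtain ⟨x, hx⟩ := hU _ Φ.mem
  have a1 := hx hy
  have a2 := hx Φ.v_mem
  refine ⟨Φ.v, h, ?_⟩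
  rw [Metric.mem_closedBall] at *
  have := dist_triangle Φ.v x 0
  have := dist_triangle x y 0
  rw [dist_comm] at a1
  linarith

lemma FR_mono {R R' : ℝ} (h : R ≤ R') : FR T R ⊆ FR T R' := fun _ ⟨y, hy, hyR⟩ =>
  ⟨y, hy, Metric.closedBall_subset_closedBall h hyR⟩

lemma sum_outer {F G H : Finset (Fl T)} (f : Fl T → ℝ) (hf : ∀ Φ, |f Φ| ≤ 1)
    (hHG : H ⊆ G) (hGF : G ⊆ F) : |∑ Φ ∈ F, f Φ - ∑ Φ ∈ G, f Φ| ≤ (F.card : ℝ) - H.card := by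
  rw [← Finset.sum_sdiff hGF, add_sub_cancel_right]
  refine (Finset.abs_sum_le_sum_abs _ _).trans ?_
  refine (Finset.sum_le_sum fun Φ _ => hf Φ).trans ?_
  rw [Finset.sum_const, Finset.card_sdiff_of_subset hGF, nsmul_eq_mul, mul_one,
    Nat.cast_sub (Finset.card_le_card hGF)]
  have : (H.card : ℝ) ≤ G.card := by exact_mod_cast Finset.card_le_card hHG
  linarith

lemma euler_step (hT : IsLFCTiling T) {U : ℝ} (hU0 : 0 < U)
    (hU : ∀ t ∈ T, ∃ x, t ⊆ Metric.closedBall x U)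
    (σ : Fl T → Fl T) (hσ : ∀ Φ, σ (σ Φ) = Φ)
    (hσ' : ∀ Φ, (σ Φ).v = Φ.v ∨ (σ Φ).tile = Φ.tile) {k : ℝ}
    (hk : ∀ Φ, Φ.ka hT + (σ Φ).ka hT = 2 * k) (R : ℝ) :
    |k| * (FR T R).ncard ≤ (3 + |k|) * ((FR T R).ncard - (FR T (R - 2 * U)).ncard) := by
  obtain ⟨c, hg⟩ := exists_gen hT
  set F := (FR_finite hT R).toFinset with hF
  set H := (FR_finite hT (R - 2 * U)).toFinset with hH
  rw [Set.ncard_eq_toFinset_card _ (FR_finite hT R),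
    Set.ncard_eq_toFinset_card _ (FR_finite hT (R - 2 * U)), ← hF, ← hH]
  have mF : ∀ Φ, Φ ∈ F ↔ Φ ∈ FR T R := by simp [hF]
  have mH : ∀ Φ, Φ ∈ H ↔ Φ ∈ FR T (R - 2 * U) := by simp [hH]
  have hA := sumA hT hg F (fun Φ hΦ Ψ e => by rw [mF] at *; unfold FR at *; simpa [e] using hΦ)
  set G := F.filter fun Φ => ∀ Ψ : Fl T, Ψ.v = Φ.v → Ψ ∈ F with hG
  have hB := sumB hT hg G (fun Φ hΦ Ψ e => by
    rw [hG, Finset.mem_filter] at hΦ ⊢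
    refine ⟨hΦ.2 _ e, fun Ω h => hΦ.2 _ (h.trans e)⟩)
  set I := F.filter fun Φ => σ Φ ∈ F with hI
  have hHF : H ⊆ F := fun Φ h => by
    rw [mF]; exact FR_mono (by linarith) ((mH _).1 h)
  have hHG : H ⊆ G := fun Φ h => by
    rw [hG, Finset.mem_filter]
    refine ⟨hHF h, fun Ψ e => ?_⟩
    rw [mF]
    exact FR_diam hT hU (e ▸ Ψ.v_mem) ((mH _).1 h)
  have hHI : H ⊆ I := fun Φ h => by
    rw [hI, Finset.mem_filter]
    refine ⟨hHF h, ?_⟩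
    rw [mF]
    refine FR_diam hT hU ?_ ((mH _).1 h)
    rcases hσ' Φ with e | e
    · exact e ▸ (σ Φ).v_mem
    · exact e ▸ Φ.v_mem
  have hGF : G ⊆ F := Finset.filter_subset _ _
  have hIF : I ⊆ F := Finset.filter_subset _ _
  have hIs : ∑ Φ ∈ I, Φ.ka hT = ∑ Φ ∈ I, (σ Φ).ka hT := by
    symm
    refine Finset.sum_nbij' σ σ ?_ ?_ (fun a _ => hσ a) (fun a _ => hσ a) (fun _ _ => rfl)
    all_goals
      intro a ha
      rw [hI, Finset.mem_filter] at *
      exact ⟨ha.2, by rw [hσ]; exact ha.1⟩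
  have hIk : ∑ Φ ∈ I, Φ.ka hT = k * I.card := by
    have : ∑ Φ ∈ I, (Φ.ka hT + (σ Φ).ka hT) = I.card * (2 * k) := by
      rw [Finset.sum_congr rfl (fun Φ _ => hk Φ), Finset.sum_const, nsmul_eq_mul]
    rw [Finset.sum_add_distrib, ← hIs] at this
    linarith
  have bk : ∀ Φ : Fl T, |Φ.ka hT| ≤ 1 := fun Φ => by
    have := frac_bd (Φ.n_ge hT); have := frac_bd (Φ.d_ge hT)
    unfold Fl.ka
    rw [abs_le]; constructor <;> linarith
  have bB : ∀ Φ : Fl T, |Φ.al hT c - 2 / (Φ.d hT : ℝ)| ≤ 1 := fun Φ => by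
    have := frac_bd (Φ.d_ge hT)
    unfold Fl.al
    split_ifs <;> rw [abs_le] <;> constructor <;> linarith
  have o1 := sum_outer (fun Φ : Fl T => Φ.ka hT) bk hHI hIF
  have o2 := sum_outer _ bB hHG hGF
  have hAB : ∑ Φ ∈ F, Φ.ka hT = - ∑ Φ ∈ F, (Φ.al hT c - 2 / (Φ.d hT : ℝ)) := by
    rw [eq_neg_iff_add_eq_zero, ← Finset.sum_add_distrib, ← hA]
    apply Finset.sum_congr rfl
    intro Φ _
    unfold Fl.ka
    ring
  rw [hB, sub_zero] at o2
  simp only [hAB, hIk] at o1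
  have cI : (H.card : ℝ) ≤ I.card := by exact_mod_cast Finset.card_le_card hHI
  have cF : (H.card : ℝ) ≤ F.card := by exact_mod_cast Finset.card_le_card hHF
  have e : |k| * I.card ≤ 2 * (F.card - H.card) := by
    rw [← Nat.abs_cast I.card, ← abs_mul]
    rw [abs_le] at o1 o2 ⊢
    constructor <;> linarith
  have := mul_le_mul_of_nonneg_left cI (abs_nonneg k)
  nlinarith

lemma tile_count (hT : IsLFCTiling T) {u U : ℝ} (hu : 0 < u)
    (hN : ∀ t ∈ T, (∃ x, Metric.closedBall x u ⊆ t) ∧ (∃ x, t ⊆ Metric.closedBall x U)) (R : ℝ)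
    (K : ℕ) (hK : (R + 2 * U) / u + 1 ≤ K) :
    {t ∈ T | (t ∩ Metric.closedBall 0 R).Nonempty}.ncard ≤ (2 * K + 1) ^ 2 := by
  choose! x hx using fun t ht => (hN t ht).1
  set g : Set (EucSp 2) → ℤ × ℤ := fun t => (round (x t 0 / u), round (x t 1 / u)) with hgdef
  set Q : Finset (ℤ × ℤ) := Finset.Icc (-(K : ℤ)) K ×ˢ Finset.Icc (-(K : ℤ)) K with hQ
  have hQc : Q.card = (2 * K + 1) ^ 2 := by
    rw [hQ, Finset.card_product, Int.card_Icc, sq]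
    congr 1 <;> omega
  rw [← hQc, ← Set.ncard_coe_finset]
  have hin : ∀ t ∈ T, pt2 (u * (g t).1) (u * (g t).2) ∈ interior t := by
    intro t ht
    apply interior_mono (hx t ht)
    rw [interior_closedBall _ hu.ne', Metric.mem_ball, EuclideanSpace.dist_eq, Real.sqrt_lt' hu,
      Fin.sum_univ_two]
    have a0 := abs_sub_round (x t 0 / u)
    have a1 := abs_sub_round (x t 1 / u)
    have b : ∀ a : ℝ, |a / u - round (a / u)| ≤ 1 / 2 → dist (u * round (a / u)) a ^ 2 ≤ u ^ 2 / 4 := by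
      intro a h
      have e : u * round (a / u) - a = - (u * (a / u - round (a / u))) := by field_simp; ring
      rw [Real.dist_eq, e, abs_neg, abs_mul, abs_of_pos hu, mul_pow]
      have : |a / u - round (a / u)| ^ 2 ≤ (1 / 2) ^ 2 := by gcongr
      nlinarith [sq_nonneg u]
    have b0 := b _ a0
    have b1 := b _ a1
    have : 0 < u ^ 2 := by positivity
    simp only [pt2, hgdef]
    simp
    linarith
  refine Set.ncard_le_ncard_of_injOn g ?_ ?_ Q.finite_toSet
  · rintro t ⟨ht, y, hy, hyR⟩
    obtain ⟨z, hz⟩ := (hN t ht).2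
    have hxt : x t ∈ t := hx t ht (Metric.mem_closedBall_self hu.le)
    have a1 := hz hy
    have a2 := hz hxt
    rw [Metric.mem_closedBall] at *
    have nx : ‖x t‖ ≤ R + 2 * U := by
      rw [← dist_zero_right]
      have := dist_triangle (x t) z 0
      have := dist_triangle z y 0
      rw [dist_comm] at a1
      linarith
    have b : ∀ i, round (x t i / u) ∈ Finset.Icc (-(K : ℤ)) K := by
      intro i
      have h1 : |x t i| ≤ ‖x t‖ := by
        simpa using PiLp.norm_apply_le (x t) i
      have h2 := abs_sub_round (x t i / u)
      have h3 : |x t i / u| ≤ (R + 2 * U) / u := by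
        rw [abs_div, abs_of_pos hu]; gcongr; linarith
      rw [abs_le] at h2 h3
      rw [Finset.mem_Icc]
      constructor
      · have : (-(K : ℝ)) ≤ round (x t i / u) := by linarith
        exact_mod_cast this
      · have : (round (x t i / u) : ℝ) ≤ K := by linarith
        exact_mod_cast this
    rw [hQ, Finset.mem_coe, Finset.mem_product]
    exact ⟨b 0, b 1⟩
  · rintro t ⟨ht, -⟩ s ⟨hs, -⟩ e
    have h1 := hin t ht
    have h2 := hin s hs
    rw [← e] at h2
    exact (hT.eq_of_interior ht hs h1 (interior_subset h2)).symm

lemma FR_count (hT : IsLFCTiling T) {M : ℕ} (hM : ∀ Φ : Fl T, Φ.n hT ≤ M) (R : ℝ) :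
    (FR T R).ncard ≤ 2 * M * {t ∈ T | (t ∩ Metric.closedBall 0 R).Nonempty}.ncard := by
  have hf := hT.locally_finite (Metric.closedBall 0 R) Metric.isBounded_closedBall
  rw [Set.ncard_eq_toFinset_card _ (FR_finite hT R), Set.ncard_eq_toFinset_card _ hf]
  refine Finset.card_le_mul_card_image_of_maps_to (f := Fl.tile) ?_ _ ?_
  · intro Φ h
    simp only [Set.Finite.mem_toFinset] at *
    exact ⟨Φ.mem, h⟩
  · intro t h
    simp only [Set.Finite.mem_toFinset] at h
    obtain ⟨Φ, rfl⟩ := exists_flag_tile hT h.1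
    obtain ⟨h1, h2⟩ := tile_flags hT Φ
    refine le_trans ?_ (Nat.mul_le_mul_left 2 (hM Φ))
    rw [← h2, ← Set.ncard_coe_finset]
    refine Set.ncard_le_ncard ?_ h1
    intro Ψ hΨ
    simp at hΨ
    exact hΨ.2

theorem euler (hT : IsLFCTiling T) (hnorm : IsNormalTiling T)
    (σ : Fl T → Fl T) (hσ : ∀ Φ, σ (σ Φ) = Φ)
    (hσ' : ∀ Φ, (σ Φ).v = Φ.v ∨ (σ Φ).tile = Φ.tile) {k : ℝ}
    (hk : ∀ Φ, Φ.ka hT + (σ Φ).ka hT = 2 * k) {M : ℕ} (hM : ∀ Φ : Fl T, Φ.n hT ≤ M) : k = 0 := by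
  obtain ⟨u, U, hu, hU, hN⟩ := hnorm
  by_contra hk0
  have kp : 0 < |k| := abs_pos.2 hk0
  set r : ℝ := 3 / (3 + |k|) with hr
  have r0 : 0 ≤ r := by positivity
  have r1 : r < 1 := by rw [hr, div_lt_one (by positivity)]; linarith
  obtain ⟨Φ⟩ := exists_fl hT
  set R0 := ‖Φ.v‖
  set N : ℝ → ℝ := fun R => ((FR T R).ncard : ℝ) with hNd
  have step : ∀ R, N (R - 2 * U) ≤ r * N R := by
    intro R
    have := euler_step hT hU (fun t ht => (hN t ht).2) σ hσ hσ' hk R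
    rw [hr, div_mul_eq_mul_div, le_div_iff₀ (by positivity)]
    simp only [hNd]
    linarith
  have n0 : 1 ≤ N R0 := by
    have : 0 < (FR T R0).ncard := by
      rw [Set.ncard_pos (FR_finite hT R0)]
      exact ⟨Φ, Φ.v, Φ.v_mem, by simp [R0]⟩
    simp only [hNd]
    exact_mod_cast this
  have iter : ∀ j : ℕ, 1 ≤ r ^ j * N (R0 + 2 * U * j) := by
    intro j
    induction j with
    | zero => simpa using n0
    | succ j ih =>
      refine ih.trans ?_
      rw [pow_succ, mul_assoc (r ^ j)]
      apply mul_le_mul_of_nonneg_left _ (pow_nonneg r0 j)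
      have := step (R0 + 2 * U * (j + 1 : ℕ))
      have e : R0 + 2 * U * (j + 1 : ℕ) - 2 * U = R0 + 2 * U * j := by push_cast; ring
      rwa [e] at this
  obtain ⟨a, ha⟩ := exists_nat_ge ((R0 + 2 * U) / u + 1)
  obtain ⟨b, hb⟩ := exists_nat_ge (2 * U / u)
  have up : ∀ j : ℕ, N (R0 + 2 * U * j) ≤ 2 * M * (2 * (a + b * j : ℕ) + 1) ^ 2 := by
    intro j
    have h1 := FR_count hT hM (R0 + 2 * U * j)
    have h2 := tile_count hT hu hN (R0 + 2 * U * j) (a + b * j) (by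
      push_cast
      have e : (R0 + 2 * U * j + 2 * U) / u + 1 = ((R0 + 2 * U) / u + 1) + 2 * U / u * j := by
        field_simp; ring
      rw [e]; gcongr)
    have h3 := h1.trans (Nat.mul_le_mul_left _ h2)
    simp only [hNd]
    exact_mod_cast h3
  set C : ℝ := 2 * M * (2 * (a + b) + 1) ^ 2 with hC
  have lim := ((tendsto_pow_const_mul_const_pow_of_lt_one 2 r0 r1).const_mul C)
  rw [mul_zero] at lim
  have ev := lim.eventually (gt_mem_nhds (show (0 : ℝ) < 1 by norm_num))
  obtain ⟨j, hj, hj1⟩ := (ev.and (Filter.eventually_ge_atTop 1)).exists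
  have h1 := iter j
  have h2 := up j
  have jr : (1 : ℝ) ≤ j := by exact_mod_cast hj1
  have h3 : (2 : ℝ) * M * (2 * (a + b * j : ℕ) + 1) ^ 2 ≤ C * j ^ 2 := by
    rw [hC, mul_assoc _ _ ((j : ℝ) ^ 2), ← mul_pow]
    gcongr
    push_cast
    have : (0 : ℝ) ≤ a := by positivity
    nlinarith
  have h4 : r ^ j * N (R0 + 2 * U * j) ≤ r ^ j * (C * j ^ 2) :=
    mul_le_mul_of_nonneg_left (h2.trans h3) (pow_nonneg r0 j)
  nlinarith

end euler2

open scoped Classical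

section euler3
variable {T : Set (Set (EucSp 2))}

lemma numeric {p q D : ℕ} (hp : 3 ≤ p) (hq : 3 ≤ q) (hD : 3 ≤ D) (he : Even D) (hpq : p ≠ q)
    (h : (2 / (p : ℝ) + 2 / D - 1) + (2 / (q : ℝ) + 2 / D - 1) = 0) :
    D = 4 ∧ (p = 3 ∧ q = 6 ∨ p = 6 ∧ q = 3) := by
  obtain ⟨k, rfl⟩ := he
  have hk : 2 ≤ k := by omega
  have h1 : (q : ℝ) * k + p * k + p * q = p * q * k := by
    have : (p : ℝ) ≠ 0 := by positivity
    have : (q : ℝ) ≠ 0 := by positivity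
    have : (k : ℝ) ≠ 0 := by positivity
    push_cast at h
    field_simp at h
    linarith
  have h2 : q * k + p * k + p * q = p * q * k := by exact_mod_cast h1
  have k2 : k = 2 := by
    by_contra hne
    have hk3 : 3 ≤ k := by omega
    rcases lt_or_gt_of_ne hpq with hl | hl
    · have : 4 ≤ q := by omega
      zify at *
      nlinarith [mul_nonneg (sub_nonneg.2 hp) (sub_nonneg.2 this), mul_nonneg (mul_nonneg (sub_nonneg.2 hp) (sub_nonneg.2 this)) (sub_nonneg.2 hk3), mul_nonneg (sub_nonneg.2 hp) (sub_nonneg.2 hk3), mul_nonneg (sub_nonneg.2 this) (sub_nonneg.2 hk3)]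
    · have : 4 ≤ p := by omega
      zify at *
      nlinarith [mul_nonneg (sub_nonneg.2 hq) (sub_nonneg.2 this), mul_nonneg (mul_nonneg (sub_nonneg.2 hq) (sub_nonneg.2 this)) (sub_nonneg.2 hk3), mul_nonneg (sub_nonneg.2 hq) (sub_nonneg.2 hk3), mul_nonneg (sub_nonneg.2 this) (sub_nonneg.2 hk3)]
  subst k2
  refine ⟨rfl, ?_⟩
  have h3 : 2 * q + 2 * p = p * q := by linarith
  have hp6 : p ≤ 6 := by
    by_contra hc
    push Not at hc
    zify at *
    nlinarith
  interval_cases p <;> omega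

lemma two_orbit_numeric (hT : IsLFCTiling T) (hnorm : IsNormalTiling T)
    (h2 : TwoFlagOrbits (TPoset T)) :
    (∀ Φ : Fl T, Φ.d hT = 4 ∧ (Φ.n hT = 3 ∨ Φ.n hT = 6) ∧ (Φ.s2 hT).n hT ≠ Φ.n hT) ∨
    (∀ Φ : Fl T, Φ.n hT = 4 ∧ (Φ.d hT = 3 ∨ Φ.d hT = 6) ∧ Φ.s0.d hT ≠ Φ.d hT) := by
  rcases two_orbit_cases hT h2 with ⟨p, q, D, hpq, ⟨Φ₀, h0⟩, hd, hn, hf⟩ |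
    ⟨p, q, D, hpq, ⟨Φ₀, h0⟩, hd, hn, hf⟩
  · left
    have h0' : (Φ₀.s2 hT).n hT = q := by
      have := hn (Φ₀.s2 hT); have := hf Φ₀; omega
    have hev := even_d hT hn hf Φ₀
    have hk := euler hT hnorm (fun Φ => Φ.s2 hT) (fun Φ => Φ.s2_s2 hT) (fun Φ => Or.inl rfl)
      (k := ((2 / (p : ℝ) + 2 / D - 1) + (2 / (q : ℝ) + 2 / D - 1)) / 2) (M := p + q) (by
        intro Φ
        unfold Fl.ka
        rw [hd, hd]
        have h1 := hn Φ; have h2 := hn (Φ.s2 hT); have h3 := hf Φ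
        have : (Φ.n hT = p ∧ (Φ.s2 hT).n hT = q) ∨ (Φ.n hT = q ∧ (Φ.s2 hT).n hT = p) := by omega
        rcases this with ⟨a, b⟩ | ⟨a, b⟩ <;> rw [a, b] <;> ring) (by
        intro Φ; have := hn Φ; omega)
    have hD := Φ₀.d_ge hT
    rw [hd] at hD hev
    have := numeric (h0 ▸ Φ₀.n_ge hT) (h0' ▸ (Φ₀.s2 hT).n_ge hT) hD hev hpq (by linarith)
    intro Φ
    have h1 := hn Φ
    refine ⟨(hd Φ).trans this.1, by omega, hf Φ⟩
  · right
    have h0' : Φ₀.s0.d hT = q := by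
      have := hn Φ₀.s0; have := hf Φ₀; omega
    have hev := even_n hT hn hf Φ₀
    have hk := euler hT hnorm (fun Φ => Φ.s0) (fun Φ => Φ.s0_s0) (fun Φ => Or.inr rfl)
      (k := ((2 / (p : ℝ) + 2 / D - 1) + (2 / (q : ℝ) + 2 / D - 1)) / 2) (M := D) (by
        intro Φ
        unfold Fl.ka
        rw [hd, hd]
        have h1 := hn Φ; have h2 := hn Φ.s0; have h3 := hf Φ
        have : (Φ.d hT = p ∧ Φ.s0.d hT = q) ∨ (Φ.d hT = q ∧ Φ.s0.d hT = p) := by omega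
        rcases this with ⟨a, b⟩ | ⟨a, b⟩ <;> rw [a, b] <;> ring) (by
        intro Φ; exact (hd Φ).le)
    have hD := Φ₀.n_ge hT
    rw [hd] at hD hev
    have := numeric (h0 ▸ Φ₀.d_ge hT) (h0' ▸ Φ₀.s0.d_ge hT) hD hev hpq (by linarith)
    intro Φ
    have h1 := hn Φ
    refine ⟨(hd Φ).trans this.1, by omega, hf Φ⟩

end euler3

open scoped Classical

section rec
variable {T T' : Set (Set (EucSp 2))}

/-- Type (3.6)². -/
def TypA (hT : IsLFCTiling T) : Prop :=
  ∀ Φ : Fl T, Φ.d hT = 4 ∧ (Φ.n hT = 3 ∨ Φ.n hT = 6) ∧ (Φ.s2 hT).n hT ≠ Φ.n hT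

/-- The dual type. -/
def TypB (hT : IsLFCTiling T) : Prop :=
  ∀ Φ : Fl T, Φ.n hT = 4 ∧ (Φ.d hT = 3 ∨ Φ.d hT = 6) ∧ Φ.s0.d hT ≠ Φ.d hT

lemma TypA.iso {hT : IsLFCTiling T} {hT' : IsLFCTiling T'} (h : TypA hT) (h' : TypA hT') :
    Nonempty (TPoset T ≃o TPoset T') := by
  have hR : GoodRel hT hT' (fun Φ Ψ => Φ.n hT = Ψ.n hT') := by
    refine ⟨?_, ?_, ?_, fun _ _ h => h, fun Φ Ψ _ => (h Φ).1.trans (h' Ψ).1.symm⟩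
    · intro Φ Ψ e; simpa using e
    · intro Φ Ψ e; simpa using e
    · intro Φ Ψ e
      have a1 := (h Φ).2; have a2 := (h' Ψ).2
      have a3 := (h (Φ.s2 hT)).2.1; have a4 := (h' (Ψ.s2 hT')).2.1
      show (Φ.s2 hT).n hT = (Ψ.s2 hT').n hT'
      omega
  obtain ⟨Φ⟩ := exists_fl hT
  obtain ⟨Ψ⟩ := exists_fl hT'
  have : ∃ Ω : Fl T', Φ.n hT = Ω.n hT' := by
    by_cases e : Φ.n hT = Ψ.n hT'
    · exact ⟨Ψ, e⟩
    · refine ⟨Ψ.s2 hT', ?_⟩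
      have a1 := (h Φ).2; have a2 := (h' Ψ).2; have a4 := (h' (Ψ.s2 hT')).2.1
      omega
  obtain ⟨Ω, hΩ⟩ := this
  obtain ⟨f, hf, -⟩ := develop_equiv hR hΩ
  obtain ⟨γ, -⟩ := hf.exists_iso
  exact ⟨γ⟩

lemma TypB.iso {hT : IsLFCTiling T} {hT' : IsLFCTiling T'} (h : TypB hT) (h' : TypB hT') :
    Nonempty (TPoset T ≃o TPoset T') := by
  have hR : GoodRel hT hT' (fun Φ Ψ => Φ.d hT = Ψ.d hT') := by
    refine ⟨?_, ?_, ?_, fun Φ Ψ _ => (h Φ).1.trans (h' Ψ).1.symm, fun _ _ h => h⟩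
    · intro Φ Ψ e
      have a1 := (h Φ).2; have a2 := (h' Ψ).2
      have a3 := (h Φ.s0).2.1; have a4 := (h' Ψ.s0).2.1
      show Φ.s0.d hT = Ψ.s0.d hT'
      omega
    · intro Φ Ψ e; simpa using e
    · intro Φ Ψ e; simpa using e
  obtain ⟨Φ⟩ := exists_fl hT
  obtain ⟨Ψ⟩ := exists_fl hT'
  have : ∃ Ω : Fl T', Φ.d hT = Ω.d hT' := by
    by_cases e : Φ.d hT = Ψ.d hT'
    · exact ⟨Ψ, e⟩
    · refine ⟨Ψ.s0, ?_⟩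
      have a1 := (h Φ).2; have a2 := (h' Ψ).2; have a4 := (h' Ψ.s0).2.1
      omega
  obtain ⟨Ω, hΩ⟩ := this
  obtain ⟨f, hf, -⟩ := develop_equiv hR hΩ
  obtain ⟨γ, -⟩ := hf.exists_iso
  exact ⟨γ⟩

end rec

open scoped Classical

/-- Linear coordinates on the plane. -/
structure Crd where
  A : StrongDual ℝ (EucSp 2)
  B : StrongDual ℝ (EucSp 2)
  P : ℝ → ℝ → EucSp 2
  hA : ∀ a b, A (P a b) = a
  hB : ∀ a b, B (P a b) = b
  hP : ∀ x, P (A x) (B x) = x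

section crd
attribute [simp] Crd.hA Crd.hB Crd.hP

lemma Crd.ext (K : Crd) {x y : EucSp 2} (h1 : K.A x = K.A y) (h2 : K.B x = K.B y) : x = y := by
  rw [← K.hP x, ← K.hP y, h1, h2]

/-- Convex combinations of three points. -/
lemma Crd.mem3 (K : Crd) {S : Set (EucSp 2)} (hS : Convex ℝ S) {u v w x : EucSp 2} (hu : u ∈ S)
    (hv : v ∈ S) (hw : w ∈ S) (α β γ : ℝ) (h1 : 0 ≤ α) (h2 : 0 ≤ β) (h3 : 0 ≤ γ)
    (h : α + β + γ = 1)
    (ha : K.A x = α * K.A u + β * K.A v + γ * K.A w)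
    (hb : K.B x = α * K.B u + β * K.B v + γ * K.B w) : x ∈ S := by
  have e : x = α • u + β • v + γ • w := by
    apply K.ext <;> simp [ha, hb]
  have := hS.sum_mem (t := Finset.univ) (w := ![α, β, γ]) (z := ![u, v, w])
    (by intro i _; fin_cases i <;> simpa) (by simp [Fin.sum_univ_three, h])
    (by intro i _; fin_cases i <;> simpa)
  rw [e]
  simpa [Fin.sum_univ_three] using this

/-- A vertex cut out by two independent functionals. -/
lemma Crd.ext_pt (K : Crd) {t : Set (EucSp 2)} {v : EucSp 2} (hv : v ∈ t)
    (l m : StrongDual ℝ (EucSp 2)) (hl : ∀ x ∈ t, l x ≤ l v) (hm : ∀ x ∈ t, m x ≤ m v)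
    (h : ∀ x, l x = l v → m x = m v → x = v) : v ∈ t.extremePoints ℝ := by
  rw [mem_extremePoints]
  refine ⟨hv, fun x hx y hy hxy => ?_⟩
  obtain ⟨α, β, h1, h2, h3, e⟩ := hxy
  have key : ∀ l : StrongDual ℝ (EucSp 2), (∀ x ∈ t, l x ≤ l v) → l x = l v ∧ l y = l v := by
    intro l hl
    have a := hl x hx
    have b := hl y hy
    have c : α * l x + β * l y = l v := by rw [← e]; simp
    have c' : α * (l v - l x) + β * (l v - l y) = 0 := by linear_combination (l v) * h3 - c
    constructor
    · by_contra hne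
      have : l x < l v := lt_of_le_of_ne a hne
      linarith [mul_pos h1 (sub_pos.2 this), mul_nonneg h2.le (sub_nonneg.2 b)]
    · by_contra hne
      have : l y < l v := lt_of_le_of_ne b hne
      linarith [mul_pos h2 (sub_pos.2 this), mul_nonneg h1.le (sub_nonneg.2 a)]
  exact ⟨h x (key l hl).1 (key m hm).1, h y (key l hl).2 (key m hm).2⟩

lemma exposed_slab {t : Set (EucSp 2)} (l : StrongDual ℝ (EucSp 2)) {lo hi : ℝ} (hh : lo ≤ hi)
    (h : (∀ x ∈ t, hi ≤ l x) ∨ (∀ x ∈ t, l x ≤ lo) ∨ (∀ x ∈ t, lo ≤ l x ∧ l x ≤ hi)) :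
    IsExposed ℝ t {x ∈ t | lo ≤ l x ∧ l x ≤ hi} := by
  rcases h with h | h | h
  · rintro ⟨y, hy, hy1, hy2⟩
    refine ⟨-l, ?_⟩
    ext x
    simp only [Set.mem_ofPred_eq, neg_apply, neg_le_neg_iff]
    constructor
    · rintro ⟨hx, h1, h2⟩
      exact ⟨hx, fun z hz => h2.trans (h z hz)⟩
    · rintro ⟨hx, h1⟩
      exact ⟨hx, hh.trans (h x hx), (h1 y hy).trans hy2⟩
  · rintro ⟨y, hy, hy1, hy2⟩
    refine ⟨l, ?_⟩
    ext x
    simp only [Set.mem_ofPred_eq]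
    constructor
    · rintro ⟨hx, h1, h2⟩
      exact ⟨hx, fun z hz => (h z hz).trans h1⟩
    · rintro ⟨hx, h1⟩
      exact ⟨hx, hy1.trans (h1 y hy), (h x hx).trans hh⟩
  · have : {x ∈ t | lo ≤ l x ∧ l x ≤ hi} = t := by
      ext x
      simp only [Set.mem_ofPred_eq, and_iff_left_iff_imp]
      exact fun hx => h x hx
    rw [this]

/-- Integer slabs of the same width. -/
lemma exposed_slab_int {t : Set (EucSp 2)} (l : StrongDual ℝ (EucSp 2)) (k n : ℤ) (a b : ℝ)
    (ha : 0 < a) (h : ∀ x ∈ t, a * k + b ≤ l x ∧ l x ≤ a * (k + 1) + b) :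
    IsExposed ℝ t {x ∈ t | a * n + b ≤ l x ∧ l x ≤ a * (n + 1) + b} := by
  apply exposed_slab l (by linarith)
  rcases lt_trichotomy n k with hn | rfl | hn
  · left
    intro x hx
    have : (n : ℝ) + 1 ≤ k := by exact_mod_cast hn
    nlinarith [h x hx]
  · right; right; exact h
  · right; left
    intro x hx
    have : (k : ℝ) + 1 ≤ n := by exact_mod_cast hn
    nlinarith [h x hx]

lemma translate_hull (S : Set (EucSp 2)) (v : EucSp 2) :
    (fun x => x + v) '' convexHull ℝ S = convexHull ℝ ((fun x => x + v) '' S) := by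
  have := (AffineEquiv.constVAdd ℝ (EucSp 2) v).toAffineMap.image_convexHull S
  simpa [add_comm, Function.comp_def] using this

/-- A diagonal is not an edge. -/
lemma not_diag {t : Set (EucSp 2)} {v w x y : EucSp 2} (he : IsExposed ℝ t (segment ℝ v w))
    (hv : v ∈ t) (hw : w ∈ t) (hx : x ∈ t.extremePoints ℝ) (hy : y ∈ t) (h : x + y = v + w) :
    x = v ∨ x = w := by
  have hm : (1 / 2 : ℝ) • v + (1 / 2 : ℝ) • w ∈ segment ℝ v w :=
    ⟨1 / 2, 1 / 2, by norm_num, by norm_num, by norm_num, rfl⟩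
  have hm' : (1 / 2 : ℝ) • v + (1 / 2 : ℝ) • w ∈ openSegment ℝ x y :=
    ⟨1 / 2, 1 / 2, by norm_num, by norm_num, by norm_num, by rw [← smul_add, ← smul_add, h]⟩
  have := he.isExtreme.2 hx.1 hy hm hm'
  exact ext_seg_end hx hv hw this

end crd

open scoped Classical

section trihex

/-- Cells of the arrangement of lines of the trihexagonal tiling. -/
def cell (K : Crd) (m p q : ℤ) : Set (EucSp 2) :=
  {x | (2 * (p : ℝ) - 1 ≤ K.A x ∧ K.A x ≤ 2 * p + 1) ∧ (2 * (q : ℝ) - 1 ≤ K.B x ∧ K.B x ≤ 2 * q + 1) ∧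
    (2 * ((p : ℝ) - q + m) - 1 ≤ K.A x - K.B x ∧ K.A x - K.B x ≤ 2 * ((p : ℝ) - q + m) + 1)}

lemma mem_cell {K : Crd} {m p q : ℤ} {x : EucSp 2} : x ∈ cell K m p q ↔
  (2 * (p : ℝ) - 1 ≤ K.A x ∧ K.A x ≤ 2 * p + 1) ∧ (2 * (q : ℝ) - 1 ≤ K.B x ∧ K.B x ≤ 2 * q + 1) ∧
    (2 * ((p : ℝ) - q + m) - 1 ≤ K.A x - K.B x ∧ K.A x - K.B x ≤ 2 * ((p : ℝ) - q + m) + 1) := Iff.rfl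

lemma cell_convex (K : Crd) (m p q : ℤ) : Convex ℝ (cell K m p q) := by
  have : cell K m p q = (K.A : EucSp 2 →ₗ[ℝ] ℝ) ⁻¹' Set.Icc (2 * (p : ℝ) - 1) (2 * p + 1) ∩
    ((K.B : EucSp 2 →ₗ[ℝ] ℝ) ⁻¹' Set.Icc (2 * (q : ℝ) - 1) (2 * q + 1) ∩
    ((K.A - K.B : StrongDual ℝ (EucSp 2)) : EucSp 2 →ₗ[ℝ] ℝ) ⁻¹'
      Set.Icc (2 * ((p : ℝ) - q + m) - 1) (2 * ((p : ℝ) - q + m) + 1)) := by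
    ext x
    simp [mem_cell]
  rw [this]
  exact ((convex_Icc _ _).linear_preimage _).inter
    (((convex_Icc _ _).linear_preimage _).inter ((convex_Icc _ _).linear_preimage _))

/-- Relative positions of the corners. -/
def cornS (m : ℤ) : Finset (ℤ × ℤ) :=
  if m = 0 then {(1, 1), (1, 0), (0, -1), (-1, -1), (-1, 0), (0, 1)}
  else {(-m, m), (-m, 0), (0, m)}

/-- The corners of a cell. -/
def corn (K : Crd) (m p q : ℤ) : Set (EucSp 2) :=
  (fun z : ℤ × ℤ => K.P (2 * p + z.1) (2 * q + z.2)) '' ((cornS (-m) : Finset (ℤ × ℤ)) : Set (ℤ × ℤ))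

lemma corn_inj (K : Crd) (p q : ℤ) :
    Function.Injective (fun z : ℤ × ℤ => K.P (2 * p + z.1) (2 * q + z.2)) := by
  rintro ⟨a, b⟩ ⟨c, d⟩ h
  have h1 := congrArg K.A h
  have h2 := congrArg K.B h
  simp at h1 h2
  rw [h1, h2]

lemma corn_zero (K : Crd) (p q : ℤ) : corn K 0 p q =
    {K.P (2 * p + 1) (2 * q + 1), K.P (2 * p + 1) (2 * q), K.P (2 * p) (2 * q - 1),
     K.P (2 * p - 1) (2 * q - 1), K.P (2 * p - 1) (2 * q), K.P (2 * p) (2 * q + 1)} := by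
  simp [corn, cornS, Set.image_insert_eq, sub_eq_add_neg]

lemma corn_neg (K : Crd) (p q : ℤ) : corn K (-1) p q =
    {K.P (2 * p - 1) (2 * q + 1), K.P (2 * p - 1) (2 * q), K.P (2 * p) (2 * q + 1)} := by
  simp [corn, cornS, Set.image_insert_eq, sub_eq_add_neg]

lemma corn_one (K : Crd) (p q : ℤ) : corn K 1 p q =
    {K.P (2 * p + 1) (2 * q - 1), K.P (2 * p + 1) (2 * q), K.P (2 * p) (2 * q - 1)} := by
  simp [corn, cornS, Set.image_insert_eq, sub_eq_add_neg]

lemma cell_hull (K : Crd) {m : ℤ} (hm : m = -1 ∨ m = 0 ∨ m = 1) (p q : ℤ) :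
    cell K m p q = convexHull ℝ (corn K m p q) := by
  apply subset_antisymm
  · intro x hx
    obtain ⟨⟨a1, a2⟩, ⟨b1, b2⟩, c1, c2⟩ := mem_cell.1 hx
    have hc := convex_convexHull ℝ (corn K m p q)
    have hs := subset_convexHull ℝ (corn K m p q)
    set S := convexHull ℝ (corn K m p q)
    rcases hm with rfl | rfl | rfl
    · rw [corn_neg] at hs
      push_cast at c1 c2
      refine K.mem3 hc (hs (by simp : K.P (2 * p - 1) (2 * q + 1) ∈ _))
        (hs (by simp : K.P (2 * p - 1) (2 * q) ∈ _))
        (hs (by simp : K.P (2 * p) (2 * q + 1) ∈ _)) (K.B x - K.A x + 2 * p - 2 * q - 1)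
        (2 * q + 1 - K.B x) (K.A x - 2 * p + 1) ?_ ?_ ?_ ?_ ?_ ?_
      · linarith
      · linarith
      · linarith
      · ring
      · simp only [K.hA]; ring
      · simp only [K.hB]; ring
    · rw [corn_zero] at hs
      push_cast at c1 c2
      have v1 := hs (by simp : K.P (2 * p + 1) (2 * q + 1) ∈ _)
      have v2 := hs (by simp : K.P (2 * p + 1) (2 * q) ∈ _)
      have v3 := hs (by simp : K.P (2 * p) (2 * q - 1) ∈ _)
      have v4 := hs (by simp : K.P (2 * p - 1) (2 * q - 1) ∈ _)
      have v5 := hs (by simp : K.P (2 * p - 1) (2 * q) ∈ _)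
      have v6 := hs (by simp : K.P (2 * p) (2 * q + 1) ∈ _)
      have v0 : K.P (2 * p) (2 * q) ∈ S := by
        refine K.mem3 hc v1 v4 v4 (1 / 2) (1 / 2) 0 ?_ ?_ ?_ ?_ ?_ ?_ <;> norm_num <;> ring
      have key : ∀ {u v : EucSp 2}, u ∈ S → v ∈ S → ∀ α β : ℝ, 0 ≤ α → 0 ≤ β → α + β ≤ 1 →
          K.A x = 2 * p + α * (K.A u - 2 * p) + β * (K.A v - 2 * p) →
          K.B x = 2 * q + α * (K.B u - 2 * q) + β * (K.B v - 2 * q) → x ∈ S := by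
        intro u v hu hv α β hα hβ hs h1 h2
        refine K.mem3 hc hu hv v0 α β (1 - α - β) hα hβ (by linarith) (by ring) ?_ ?_
        · rw [h1, K.hA]; ring
        · rw [h2, K.hB]; ring
      rcases le_total (2 * (p : ℝ)) (K.A x) with ha | ha <;>
        rcases le_total (2 * (q : ℝ)) (K.B x) with hb | hb
      · rcases le_total (K.A x - 2 * p) (K.B x - 2 * q) with hab | hab
        · refine key v1 v6 (K.A x - 2 * p) ((K.B x - 2 * q) - (K.A x - 2 * p)) ?_ ?_ ?_ ?_ ?_ <;>
            (try simp only [K.hA, K.hB]) <;> linarith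
        · refine key v1 v2 (K.B x - 2 * q) ((K.A x - 2 * p) - (K.B x - 2 * q)) ?_ ?_ ?_ ?_ ?_ <;>
            (try simp only [K.hA, K.hB]) <;> linarith
      · refine key v2 v3 (K.A x - 2 * p) (-(K.B x - 2 * q)) ?_ ?_ ?_ ?_ ?_ <;>
            (try simp only [K.hA, K.hB]) <;> linarith
      · refine key v5 v6 (-(K.A x - 2 * p)) (K.B x - 2 * q) ?_ ?_ ?_ ?_ ?_ <;>
            (try simp only [K.hA, K.hB]) <;> linarith
      · rcases le_total (K.A x - 2 * p) (K.B x - 2 * q) with hab | hab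
        · refine key v4 v5 (-(K.B x - 2 * q)) ((K.B x - 2 * q) - (K.A x - 2 * p)) ?_ ?_ ?_ ?_ ?_ <;>
            (try simp only [K.hA, K.hB]) <;> linarith
        · refine key v4 v3 (-(K.A x - 2 * p)) ((K.A x - 2 * p) - (K.B x - 2 * q)) ?_ ?_ ?_ ?_ ?_ <;>
            (try simp only [K.hA, K.hB]) <;> linarith
    · rw [corn_one] at hs
      push_cast at c1 c2
      refine K.mem3 hc (hs (by simp : K.P (2 * p + 1) (2 * q - 1) ∈ _))
        (hs (by simp : K.P (2 * p + 1) (2 * q) ∈ _))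
        (hs (by simp : K.P (2 * p) (2 * q - 1) ∈ _)) (K.A x - K.B x - 2 * p + 2 * q - 1)
        (K.B x - 2 * q + 1) (2 * p + 1 - K.A x) ?_ ?_ ?_ ?_ ?_ ?_
      · linarith
      · linarith
      · linarith
      · ring
      · simp only [K.hA]; ring
      · simp only [K.hB]; ring
  · apply convexHull_min _ (cell_convex K m p q)
    rcases hm with rfl | rfl | rfl
    · rw [corn_neg]
      rintro x (rfl | rfl | rfl) <;> rw [mem_cell] <;> push_cast <;> simp only [K.hA, K.hB] <;>
        refine ⟨⟨?_, ?_⟩, ⟨?_, ?_⟩, ?_, ?_⟩ <;> linarith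
    · rw [corn_zero]
      rintro x (rfl | rfl | rfl | rfl | rfl | rfl) <;> rw [mem_cell] <;> push_cast <;>
        simp only [K.hA, K.hB] <;> refine ⟨⟨?_, ?_⟩, ⟨?_, ?_⟩, ?_, ?_⟩ <;> linarith
    · rw [corn_one]
      rintro x (rfl | rfl | rfl) <;> rw [mem_cell] <;> push_cast <;> simp only [K.hA, K.hB] <;>
        refine ⟨⟨?_, ?_⟩, ⟨?_, ?_⟩, ?_, ?_⟩ <;> linarith

lemma cell_polytope (K : Crd) {m : ℤ} (hm : m = -1 ∨ m = 0 ∨ m = 1) (p q : ℤ) :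
    IsConvexPolytope (cell K m p q) := by
  constructor
  · have : (corn K m p q).Finite := (Finset.finite_toSet _).image _
    refine ⟨this.toFinset, ?_⟩
    rw [Set.Finite.coe_toFinset]
    exact cell_hull K hm p q
  · set O : Set (EucSp 2) := {x | (2 * (p : ℝ) - 1 < K.A x ∧ K.A x < 2 * p + 1) ∧
      (2 * (q : ℝ) - 1 < K.B x ∧ K.B x < 2 * q + 1) ∧
      (2 * ((p : ℝ) - q + m) - 1 < K.A x - K.B x ∧ K.A x - K.B x < 2 * ((p : ℝ) - q + m) + 1)}
      with hO
    have ho : IsOpen O := by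
      have : O = K.A ⁻¹' Set.Ioo (2 * (p : ℝ) - 1) (2 * p + 1) ∩
          (K.B ⁻¹' Set.Ioo (2 * (q : ℝ) - 1) (2 * q + 1) ∩
          (K.A - K.B) ⁻¹' Set.Ioo (2 * ((p : ℝ) - q + m) - 1) (2 * ((p : ℝ) - q + m) + 1)) := by
        ext x
        simp [hO]
      rw [this]
      exact (isOpen_Ioo.preimage K.A.continuous).inter
        ((isOpen_Ioo.preimage K.B.continuous).inter (isOpen_Ioo.preimage (K.A - K.B).continuous))
    have hs : O ⊆ cell K m p q := by
      rintro x ⟨⟨a1, a2⟩, ⟨b1, b2⟩, c1, c2⟩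
      exact ⟨⟨a1.le, a2.le⟩, ⟨b1.le, b2.le⟩, c1.le, c2.le⟩
    refine ⟨K.P (2 * p + 2 * m / 3) (2 * q - 2 * m / 3), interior_maximal hs ho ?_⟩
    rw [hO]
    simp only [Set.mem_ofPred_eq, K.hA, K.hB]
    rcases hm with rfl | rfl | rfl <;> push_cast <;>
      refine ⟨⟨?_, ?_⟩, ⟨?_, ?_⟩, ?_, ?_⟩ <;> linarith

/-- The trihexagonal tiling in coordinates. -/
def TH (K : Crd) : Set (Set (EucSp 2)) :=
  {t | ∃ m p q : ℤ, (m = -1 ∨ m = 0 ∨ m = 1) ∧ t = cell K m p q}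

lemma cell_exposed (K : Crd) (m p q m' p' q' : ℤ) :
    IsExposed ℝ (cell K m p q) (cell K m p q ∩ cell K m' p' q') := by
  set t := cell K m p q with ht
  have h1 := exposed_slab_int (t := t) K.A p p' 2 (-1) (by norm_num)
    (fun x hx => by have := mem_cell.1 hx; constructor <;> linarith)
  have h2 := exposed_slab_int (t := t) K.B q q' 2 (-1) (by norm_num)
    (fun x hx => by have := mem_cell.1 hx; constructor <;> linarith)
  have h3 := exposed_slab_int (t := t) (K.A - K.B) (p - q + m) (p' - q' + m') 2 (-1) (by norm_num)
    (fun x hx => by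
      have := mem_cell.1 hx
      simp only [sub_apply]
      push_cast
      constructor <;> linarith)
  have := (h1.inter h2).inter h3
  refine Eq.mp (congrArg (IsExposed ℝ t) ?_) this
  symm
  ext x
  simp only [Set.mem_inter_iff, Set.mem_ofPred_eq, mem_cell (m := m'), sub_apply]
  push_cast
  constructor
  · rintro ⟨hx, ⟨a1, a2⟩, ⟨b1, b2⟩, c1, c2⟩
    refine ⟨⟨⟨hx, ?_, ?_⟩, ⟨hx, ?_, ?_⟩⟩, hx, ?_, ?_⟩ <;> linarith
  · rintro ⟨⟨⟨hx, a1, a2⟩, ⟨-, b1, b2⟩⟩, -, c1, c2⟩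
    refine ⟨hx, ⟨?_, ?_⟩, ⟨?_, ?_⟩, ?_, ?_⟩ <;> linarith

lemma dual_bdd (l : StrongDual ℝ (EucSp 2)) {B : Set (EucSp 2)} (hB : Bornology.IsBounded B) :
    ∃ M : ℕ, ∀ x ∈ B, |l x| ≤ M := by
  obtain ⟨r, hr⟩ := hB.exists_norm_le
  obtain ⟨M, hM⟩ := exists_nat_ge (‖l‖ * r)
  refine ⟨M, fun x hx => le_trans ?_ hM⟩
  have := l.le_opNorm x
  rw [Real.norm_eq_abs] at this
  exact this.trans (mul_le_mul_of_nonneg_left (hr x hx) (norm_nonneg _))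

lemma TH_tiling (K : Crd) : IsLFCTiling (TH K) := by
  constructor
  · rintro t ⟨m, p, q, hm, rfl⟩
    exact cell_polytope K hm p q
  · rw [Set.eq_univ_iff_forall]
    intro x
    set p := round (K.A x / 2)
    set q := round (K.B x / 2)
    set r := round ((K.A x - K.B x) / 2)
    have a := abs_sub_round (K.A x / 2)
    have b := abs_sub_round (K.B x / 2)
    have c := abs_sub_round ((K.A x - K.B x) / 2)
    rw [abs_le] at a b c
    have h1 : ((r - p + q : ℤ) : ℝ) < 2 := by push_cast; linarith
    have h2 : (-2 : ℝ) < ((r - p + q : ℤ) : ℝ) := by push_cast; linarith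
    have h1' : r - p + q < 2 := by exact_mod_cast h1
    have h2' : -2 < r - p + q := by exact_mod_cast h2
    refine ⟨cell K (r - p + q) p q, ⟨_, p, q, by omega, rfl⟩, ?_⟩
    rw [mem_cell]
    push_cast
    refine ⟨⟨?_, ?_⟩, ⟨?_, ?_⟩, ?_, ?_⟩ <;> linarith
  · rintro t ⟨m, p, q, hm, rfl⟩ s ⟨m', p', q', hm', rfl⟩
    exact ⟨cell_exposed K _ _ _ _ _ _, by rw [Set.inter_comm]; exact cell_exposed K _ _ _ _ _ _⟩
  · intro B hB
    obtain ⟨M, hM⟩ := dual_bdd K.A hB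
    obtain ⟨N, hN⟩ := dual_bdd K.B hB
    have hf : ((Set.Icc (-1 : ℤ) 1 ×ˢ (Set.Icc (-(M : ℤ) - 1) (M + 1) ×ˢ
      Set.Icc (-(N : ℤ) - 1) (N + 1)))).Finite :=
      (Set.finite_Icc _ _).prod ((Set.finite_Icc _ _).prod (Set.finite_Icc _ _))
    refine (hf.image (fun z => cell K z.1 z.2.1 z.2.2)).subset ?_
    rintro t ⟨⟨m, p, q, hm, rfl⟩, x, hx, hxB⟩
    refine ⟨(m, p, q), ?_, rfl⟩
    obtain ⟨⟨a1, a2⟩, ⟨b1, b2⟩, -⟩ := mem_cell.1 hx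
    have h1 := abs_le.1 (hM x hxB)
    have h2 := abs_le.1 (hN x hxB)
    have e1 : ((2 * p : ℤ) : ℝ) ≤ (M + 1 : ℤ) := by push_cast; linarith
    have e2 : ((-M - 1 : ℤ) : ℝ) ≤ (2 * p : ℤ) := by push_cast; linarith
    have e3 : ((2 * q : ℤ) : ℝ) ≤ (N + 1 : ℤ) := by push_cast; linarith
    have e4 : ((-N - 1 : ℤ) : ℝ) ≤ (2 * q : ℤ) := by push_cast; linarith
    rw [Int.cast_le] at e1 e2 e3 e4
    simp only [Set.mem_prod, Set.mem_Icc]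
    omega

end trihex

open scoped Classical

section trihex2

lemma hex_ext (K : Crd) (p q : ℤ) : (cell K 0 p q).extremePoints ℝ = corn K 0 p q := by
  apply subset_antisymm
  · rw [cell_hull K (by simp)]
    exact extremePoints_convexHull_subset
  · have hsub : corn K 0 p q ⊆ cell K 0 p q := by
      rw [cell_hull K (by simp)]; exact subset_convexHull ℝ _
    have key : ∀ v ∈ corn K 0 p q, ∀ l m : StrongDual ℝ (EucSp 2), (∀ x ∈ cell K 0 p q, l x ≤ l v) →
        (∀ x ∈ cell K 0 p q, m x ≤ m v) →
        (∀ x, l x = l v → m x = m v → K.A x = K.A v ∧ K.B x = K.B v) →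
        v ∈ (cell K 0 p q).extremePoints ℝ := fun v hv l m h1 h2 h3 =>
      K.ext_pt (hsub hv) l m h1 h2 (fun x a b => K.ext (h3 x a b).1 (h3 x a b).2)
    intro v hv
    have hv' := hv
    rw [corn_zero] at hv
    rcases hv with rfl | rfl | rfl | rfl | rfl | rfl
    · refine key _ hv' K.A K.B ?_ ?_ ?_ <;> intro x hx
      · simp only [K.hA]; linarith [mem_cell.1 hx]
      · simp only [K.hB]; linarith [mem_cell.1 hx]
      · exact fun h => ⟨hx, h⟩
    · refine key _ hv' K.A (K.A - K.B) ?_ ?_ ?_ <;> intro x hx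
      · simp only [K.hA]; linarith [mem_cell.1 hx]
      · have := mem_cell.1 hx
        push_cast at this
        simp only [sub_apply, K.hA, K.hB]; linarith
      · simp only [sub_apply, K.hA, K.hB] at *; intro h; constructor <;> linarith
    · refine key _ hv' (-K.B) (K.A - K.B) ?_ ?_ ?_ <;> intro x hx
      · simp only [neg_apply, K.hB]; linarith [mem_cell.1 hx]
      · have := mem_cell.1 hx
        push_cast at this
        simp only [sub_apply, K.hA, K.hB]; linarith
      · simp only [sub_apply, neg_apply, K.hA, K.hB] at *; intro h; constructor <;> linarith
    · refine key _ hv' (-K.A) (-K.B) ?_ ?_ ?_ <;> intro x hx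
      · simp only [neg_apply, K.hA]; linarith [mem_cell.1 hx]
      · simp only [neg_apply, K.hB]; linarith [mem_cell.1 hx]
      · simp only [neg_apply, K.hA, K.hB] at *; intro h; constructor <;> linarith
    · refine key _ hv' (-K.A) (K.B - K.A) ?_ ?_ ?_ <;> intro x hx
      · simp only [neg_apply, K.hA]; linarith [mem_cell.1 hx]
      · have := mem_cell.1 hx
        push_cast at this
        simp only [sub_apply, K.hA, K.hB]; linarith
      · simp only [sub_apply, neg_apply, K.hA, K.hB] at *; intro h; constructor <;> linarith
    · refine key _ hv' K.B (K.B - K.A) ?_ ?_ ?_ <;> intro x hx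
      · simp only [K.hB]; linarith [mem_cell.1 hx]
      · have := mem_cell.1 hx
        push_cast at this
        simp only [sub_apply, K.hA, K.hB]; linarith
      · simp only [sub_apply, K.hA, K.hB] at *; intro h; constructor <;> linarith

lemma TH_n0 (K : Crd) {Φ : Fl (TH K)} {p q : ℤ} (h : Φ.tile = cell K 0 p q) :
    Φ.n (TH_tiling K) = 6 := by
  rw [Fl.n_eq, h, hex_ext, corn, Set.ncard_image_of_injective _ (corn_inj K p q),
    Set.ncard_coe_finset]
  rfl

lemma TH_n1 (K : Crd) {Φ : Fl (TH K)} {m p q : ℤ} (hm : m = -1 ∨ m = 1)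
    (h : Φ.tile = cell K m p q) : Φ.n (TH_tiling K) = 3 := by
  apply le_antisymm _ (Φ.n_ge _)
  rw [Fl.n_eq, h, cell_hull K (by tauto)]
  refine (Set.ncard_le_ncard extremePoints_convexHull_subset ((Finset.finite_toSet _).image _)).trans ?_
  have e : (corn K m p q).ncard = (cornS (-m)).card := by
    unfold corn
    rw [Set.ncard_image_of_injective _ (corn_inj K p q), Set.ncard_coe_finset]
  refine le_trans e.le ?_
  rcases hm with rfl | rfl <;> decide

lemma two_choice (f : ℝ) : ∃ a b : ℤ, (a = b ∨ f = 2 * a + 1) ∧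
    ∀ k : ℤ, 2 * (k : ℝ) - 1 ≤ f → f ≤ 2 * k + 1 → k = a ∨ k = b := by
  by_cases h : ∃ a : ℤ, f = 2 * a + 1
  · obtain ⟨a, ha⟩ := h
    refine ⟨a, a + 1, Or.inr ha, fun k h1 h2 => ?_⟩
    have e1 : ((2 * k - 1 : ℤ) : ℝ) ≤ (2 * a + 1 : ℤ) := by push_cast; linarith
    have e2 : ((2 * a + 1 : ℤ) : ℝ) ≤ (2 * k + 1 : ℤ) := by push_cast; linarith
    rw [Int.cast_le] at e1 e2
    omega
  · refine ⟨round (f / 2), round (f / 2), Or.inl rfl, fun k h1 h2 => ?_⟩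
    have h3 := abs_le.1 (abs_sub_round (f / 2))
    have l1 : 2 * (k : ℝ) - 1 < f := lt_of_le_of_ne h1 fun e => h ⟨k - 1, by push_cast; linarith⟩
    have l2 : f < 2 * k + 1 := lt_of_le_of_ne h2 fun e => h ⟨k, by linarith⟩
    have e1 : (k : ℝ) < (round (f / 2) + 1 : ℤ) := by push_cast; linarith
    have e2 : (round (f / 2) : ℝ) < (k + 1 : ℤ) := by push_cast; linarith
    rw [Int.cast_lt] at e1 e2
    omega

lemma TH_d_le (K : Crd) (v : EucSp 2) : {t ∈ TH K | v ∈ t}.ncard ≤ 4 := by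
  obtain ⟨a1, b1, o1, h1⟩ := two_choice (K.A v)
  obtain ⟨a2, b2, o2, h2⟩ := two_choice (K.B v)
  obtain ⟨a3, b3, o3, h3⟩ := two_choice (K.A v - K.B v)
  -- the index triples
  set g : ℤ × ℤ × ℤ → Set (EucSp 2) := fun z => cell K (z.2.2 - z.1 + z.2.1) z.1 z.2.1 with hg
  have hin : {t ∈ TH K | v ∈ t} ⊆ g '' ((({a1, b1} : Finset ℤ) ×ˢ (({a2, b2} : Finset ℤ) ×ˢ
      ({a3, b3} : Finset ℤ)) : Finset (ℤ × ℤ × ℤ)) : Set (ℤ × ℤ × ℤ)) := by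
    rintro t ⟨⟨m, p, q, hm, rfl⟩, hv⟩
    refine ⟨(p, q, p - q + m), ?_, by simp only [hg]; congr 1; ring⟩
    obtain ⟨⟨x1, x2⟩, ⟨y1, y2⟩, z1, z2⟩ := mem_cell.1 hv
    have j1 := h1 p x1 x2
    have j2 := h2 q y1 y2
    have j3 := h3 (p - q + m) (by push_cast; linarith) (by push_cast; linarith)
    simp only [Finset.coe_product, Set.mem_prod, Finset.coe_insert, Finset.coe_singleton,
      Set.mem_insert_iff, Set.mem_singleton_iff]
    exact ⟨j1, j2, j3⟩
  refine (Set.ncard_le_ncard hin ((Finset.finite_toSet _).image _)).trans ?_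
  refine (Set.ncard_image_le (Finset.finite_toSet _)).trans ?_
  rw [Set.ncard_coe_finset, Finset.card_product, Finset.card_product]
  have c : ∀ a b : ℤ, ({a, b} : Finset ℤ).card ≤ 2 := fun a b => Finset.card_le_two
  have c' : ∀ a b : ℤ, a = b → ({a, b} : Finset ℤ).card = 1 := fun a b h => by simp [h]
  have k1 := c a1 b1
  have k2 := c a2 b2
  have k3 := c a3 b3
  have : ({a1, b1} : Finset ℤ).card = 1 ∨ ({a2, b2} : Finset ℤ).card = 1 ∨
      ({a3, b3} : Finset ℤ).card = 1 := by
    by_cases e1 : a1 = b1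
    · exact Or.inl (c' _ _ e1)
    by_cases e2 : a2 = b2
    · exact Or.inr (Or.inl (c' _ _ e2))
    by_cases e3 : a3 = b3
    · exact Or.inr (Or.inr (c' _ _ e3))
    have f1 := o1.resolve_left e1
    have f2 := o2.resolve_left e2
    have f3 := o3.resolve_left e3
    exfalso
    have : ((2 * a1 + 1 - (2 * a2 + 1) : ℤ) : ℝ) = (2 * a3 + 1 : ℤ) := by
      push_cast; linarith
    rw [Int.cast_inj] at this
    omega
  clear hin hg g
  generalize ({a1, b1} : Finset ℤ).card = c1 at *
  generalize ({a2, b2} : Finset ℤ).card = c2 at *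
  generalize ({a3, b3} : Finset ℤ).card = c3 at *
  rcases this with h | h | h <;> subst h <;> nlinarith

lemma TH_flip (K : Crd) {m p q m' p' q' : ℤ} (hm : m = -1 ∨ m = 0 ∨ m = 1)
    (hm' : m' = -1 ∨ m' = 0 ∨ m' = 1) (hne : cell K m p q ≠ cell K m' p' q') {v w : EucSp 2}
    (hvw : v ≠ w) (hv : v ∈ cell K m p q) (hw : w ∈ cell K m p q) (hv' : v ∈ cell K m' p' q')
    (hw' : w ∈ cell K m' p' q') : m = 0 ↔ m' ≠ 0 := by
  rw [mem_cell] at hv hw hv' hw'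
  have key : ∀ (f g : ℝ) (k k' : ℤ), 2 * (k : ℝ) - 1 ≤ f → f ≤ 2 * k + 1 → 2 * (k : ℝ) - 1 ≤ g →
      g ≤ 2 * k + 1 → 2 * (k' : ℝ) - 1 ≤ f → f ≤ 2 * k' + 1 → 2 * (k' : ℝ) - 1 ≤ g →
      g ≤ 2 * k' + 1 → k = k' ∨ (f = g ∧ (k' = k + 1 ∨ k' = k - 1)) := by
    intro f g k k' h1 h2 h3 h4 h5 h6 h7 h8
    have e1 : (k : ℝ) ≤ (k' + 1 : ℤ) := by push_cast; linarith
    have e2 : (k' : ℝ) ≤ (k + 1 : ℤ) := by push_cast; linarith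
    rw [Int.cast_le] at e1 e2
    have : k' = k ∨ k' = k + 1 ∨ k' = k - 1 := by omega
    rcases this with h | h | h
    · exact Or.inl h.symm
    · right
      subst h
      push_cast at h5 h6 h7 h8
      exact ⟨by linarith, Or.inl rfl⟩
    · right
      subst h
      push_cast at h5 h6 h7 h8
      exact ⟨by linarith, Or.inr rfl⟩
  have k1 := key (K.A v) (K.A w) p p' hv.1.1 hv.1.2 hw.1.1 hw.1.2 hv'.1.1 hv'.1.2 hw'.1.1 hw'.1.2
  have k2 := key (K.B v) (K.B w) q q' hv.2.1.1 hv.2.1.2 hw.2.1.1 hw.2.1.2 hv'.2.1.1 hv'.2.1.2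
    hw'.2.1.1 hw'.2.1.2
  have k3 := key (K.A v - K.B v) (K.A w - K.B w) (p - q + m) (p' - q' + m')
    (by push_cast; linarith) (by push_cast; linarith) (by push_cast; linarith)
    (by push_cast; linarith) (by push_cast; linarith) (by push_cast; linarith)
    (by push_cast; linarith) (by push_cast; linarith)
  have hn : ¬ (K.A v = K.A w ∧ K.B v = K.B w) := fun h => hvw (K.ext h.1 h.2)
  have hn2 : ¬ (K.A v = K.A w ∧ K.A v - K.B v = K.A w - K.B w) := fun h =>
    hn ⟨h.1, by linarith⟩
  have hn3 : ¬ (K.B v = K.B w ∧ K.A v - K.B v = K.A w - K.B w) := fun h =>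
    hn ⟨by linarith, h.1⟩
  have hz : ¬ (p = p' ∧ q = q' ∧ m = m') := by
    rintro ⟨rfl, rfl, rfl⟩; exact hne rfl
  clear hv hw hv' hw' key
  rcases k1 with k1 | ⟨k1, k1'⟩
  · rcases k2 with k2 | ⟨k2, k2'⟩
    · rcases k3 with k3 | ⟨k3, k3'⟩
      · exact absurd ⟨k1, k2, by omega⟩ hz
      · omega
    · rcases k3 with k3 | ⟨k3, k3'⟩
      · omega
      · exact absurd (And.intro k2 k3) hn3
  · rcases k2 with k2 | ⟨k2, k2'⟩
    · rcases k3 with k3 | ⟨k3, k3'⟩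
      · omega
      · exact absurd (And.intro k1 k3) hn2
    · exact absurd (And.intro k1 k2) hn

lemma TH_typA (K : Crd) : TypA (TH_tiling K) := by
  have hn : ∀ Φ : Fl (TH K), Φ.n (TH_tiling K) = 3 ∨ Φ.n (TH_tiling K) = 6 := by
    intro Φ
    obtain ⟨m, p, q, hm, e⟩ := Φ.mem
    rcases hm with rfl | rfl | rfl
    · exact Or.inl (TH_n1 K (Or.inl rfl) e)
    · exact Or.inr (TH_n0 K e)
    · exact Or.inl (TH_n1 K (Or.inr rfl) e)
  have hf : ∀ Φ : Fl (TH K), (Φ.s2 (TH_tiling K)).n (TH_tiling K) ≠ Φ.n (TH_tiling K) := by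
    intro Φ
    set Ψ := Φ.s2 (TH_tiling K) with hΨ
    obtain ⟨m, p, q, hm, e⟩ := Φ.mem
    obtain ⟨m', p', q', hm', e'⟩ := Ψ.mem
    have h1 := Φ.v_mem
    have h2 := Φ.w_mem
    have h3 := Ψ.v_mem
    have h4 := Ψ.w_mem
    have h5 := Φ.s2_tile_ne (TH_tiling K)
    rw [← hΨ, e, e'] at h5
    rw [e] at h1 h2
    rw [e'] at h3 h4
    have := TH_flip K hm hm' h5.symm Φ.ne h1 h2 h3 h4
    by_cases h0 : m = 0
    · have h0' := this.1 h0
      subst h0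
      rw [TH_n0 K e, TH_n1 K (by tauto) e']
      norm_num
    · have h0' : m' = 0 := by tauto
      subst h0'
      rw [TH_n0 K e', TH_n1 K (by tauto) e]
      norm_num
  intro Φ
  refine ⟨?_, hn Φ, hf Φ⟩
  have h1 := even_d (TH_tiling K) hn hf Φ
  have h2 := Φ.d_ge (TH_tiling K)
  have h3 : Φ.d (TH_tiling K) ≤ 4 := by rw [Fl.d_eq]; exact TH_d_le K _
  obtain ⟨r, hr⟩ := h1
  omega

/-- Coordinates for the trihexagonal tiling. -/
noncomputable def KTH : Crd where
  A := lin 1 (1 / Real.sqrt 3)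
  B := lin 1 (-(1 / Real.sqrt 3))
  P := fun a b => pt2 ((a + b) / 2) (Real.sqrt 3 * (a - b) / 2)
  hA := by
    intro a b
    have : Real.sqrt 3 ≠ 0 := by positivity
    simp [pt2]; field_simp; ring
  hB := by
    intro a b
    have : Real.sqrt 3 ≠ 0 := by positivity
    simp [pt2]; field_simp; ring
  hP := by
    intro x
    have : Real.sqrt 3 ≠ 0 := by positivity
    apply ext2
    · simp [pt2]; ring
    · simp [pt2]; field_simp; ring

lemma KTH_P (a b c d a' b' : ℝ) (h1 : a + c = (a' + b') / 2)
    (h2 : b + d = Real.sqrt 3 * (a' - b') / 2) : pt2 a b + pt2 c d = KTH.P a' b' := by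
  apply ext2
  · simpa [pt2, KTH] using h1
  · simpa [pt2, KTH] using h2

lemma lat_pt (a b : ℤ) : a • pt2 2 0 + b • pt2 1 (Real.sqrt 3) =
    pt2 (2 * a + b) (b * Real.sqrt 3) := by
  apply ext2 <;> simp [pt2] <;> ring

lemma hex_eq (a b : ℤ) : (fun x => x + (a • pt2 2 0 + b • pt2 1 (Real.sqrt 3))) '' hexTile =
    cell KTH 0 (a + b) a := by
  rw [cell_hull _ (by simp), corn_zero, hexTile, translate_hull, lat_pt]
  simp only [Set.image_insert_eq, Set.image_singleton]
  congr 1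
  push_cast
  congr 1
  · apply KTH_P <;> ring
  congr 1
  · apply KTH_P <;> ring
  congr 1
  · apply KTH_P <;> ring
  congr 1
  · apply KTH_P <;> ring
  congr 1
  · apply KTH_P <;> ring
  congr 1
  · apply KTH_P <;> ring

lemma up_eq (a b : ℤ) : (fun x => x + (a • pt2 2 0 + b • pt2 1 (Real.sqrt 3))) '' triTileUp =
    cell KTH (-1) (a + b + 1) a := by
  rw [cell_hull _ (by simp), corn_neg, triTileUp, translate_hull, lat_pt]
  simp only [Set.image_insert_eq, Set.image_singleton]
  congr 1
  push_cast
  congr 1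
  · apply KTH_P <;> ring
  congr 1
  · apply KTH_P <;> ring
  congr 1
  · apply KTH_P <;> ring

lemma down_eq (a b : ℤ) : (fun x => x + (a • pt2 2 0 + b • pt2 1 (Real.sqrt 3))) '' triTileDown =
    cell KTH 1 (a + b) (a + 1) := by
  rw [cell_hull _ (by simp), corn_one, triTileDown, translate_hull, lat_pt, Set.pair_comm]
  simp only [Set.image_insert_eq, Set.image_singleton]
  congr 1
  push_cast
  congr 1
  · apply KTH_P <;> ring
  congr 1
  · apply KTH_P <;> ring
  congr 1
  · apply KTH_P <;> ring

lemma trihex_eq : TrihexagonalTiling = TH KTH := by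
  ext t
  constructor
  · rintro ⟨v, ⟨a, b, rfl⟩, rfl | rfl | rfl⟩
    · exact ⟨0, _, _, by simp, hex_eq a b⟩
    · exact ⟨-1, _, _, by simp, up_eq a b⟩
    · exact ⟨1, _, _, by simp, down_eq a b⟩
  · rintro ⟨m, p, q, rfl | rfl | rfl, rfl⟩
    · refine ⟨_, ⟨q, p - q - 1, rfl⟩, Or.inr (Or.inl ?_)⟩
      rw [up_eq]; congr 1; ring
    · refine ⟨_, ⟨q, p - q, rfl⟩, Or.inl ?_⟩
      rw [hex_eq]; congr 1; ring
    · refine ⟨_, ⟨q - 1, p - q + 1, rfl⟩, Or.inr (Or.inr ?_)⟩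
      rw [down_eq]; congr 1 <;> ring

end trihex2

open scoped Classical

section rhomb

/-- Rotation of coordinates. -/
noncomputable def Crd.rot (K : Crd) : Crd where
  A := K.B
  B := -K.A - K.B
  P := fun s t => K.P (-s - t) s
  hA := by intro a b; simp
  hB := by intro a b; simp
  hP := by
    intro x
    apply K.ext
    · simp; ring
    · simp

lemma Crd.rot_A (K : Crd) (x : EucSp 2) : K.rot.A x = K.B x := rfl

lemma Crd.rot_B (K : Crd) (x : EucSp 2) : K.rot.B x = -K.A x - K.B x := rfl

/-- Unit boxes in coordinates. -/
def box (K : Crd) (n m : ℤ) : Set (EucSp 2) :=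
  {x | ((n : ℝ) ≤ K.A x ∧ K.A x ≤ n + 1) ∧ ((m : ℝ) ≤ K.B x ∧ K.B x ≤ m + 1)}

lemma mem_box {K : Crd} {n m : ℤ} {x : EucSp 2} : x ∈ box K n m ↔
  ((n : ℝ) ≤ K.A x ∧ K.A x ≤ n + 1) ∧ ((m : ℝ) ≤ K.B x ∧ K.B x ≤ m + 1) := Iff.rfl

lemma box_rot3 (K : Crd) (n m : ℤ) : box K.rot.rot.rot n m = box K n m := by
  ext x
  simp only [mem_box, Crd.rot_A, Crd.rot_B]
  have e1 : -K.B x - (-K.A x - K.B x) = K.A x := by ring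
  have e2 : -(-K.A x - K.B x) - (-K.B x - (-K.A x - K.B x)) = K.B x := by ring
  rw [e2, e1]

lemma box_convex (K : Crd) (n m : ℤ) : Convex ℝ (box K n m) := by
  have : box K n m = (K.A : EucSp 2 →ₗ[ℝ] ℝ) ⁻¹' Set.Icc (n : ℝ) (n + 1) ∩
    (K.B : EucSp 2 →ₗ[ℝ] ℝ) ⁻¹' Set.Icc (m : ℝ) (m + 1) := by
    ext x
    simp [mem_box]
  rw [this]
  exact ((convex_Icc _ _).linear_preimage _).inter ((convex_Icc _ _).linear_preimage _)

/-- The corners of a box. -/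
def bcorn (K : Crd) (n m : ℤ) : Set (EucSp 2) :=
  {K.P n (m + 1), K.P n m, K.P (n + 1) m, K.P (n + 1) (m + 1)}

lemma bcorn_sub (K : Crd) (n m : ℤ) : bcorn K n m ⊆ box K n m := by
  rintro x (rfl | rfl | rfl | rfl) <;> rw [mem_box] <;> simp only [K.hA, K.hB] <;>
    refine ⟨⟨?_, ?_⟩, ?_, ?_⟩ <;> linarith

lemma box_hull (K : Crd) (n m : ℤ) : box K n m = convexHull ℝ (bcorn K n m) := by
  apply subset_antisymm
  · intro x hx
    obtain ⟨⟨a1, a2⟩, b1, b2⟩ := mem_box.1 hx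
    have hc := convex_convexHull ℝ (bcorn K n m)
    have hs := subset_convexHull ℝ (bcorn K n m)
    have v1 := hs (by simp [bcorn] : K.P n (m + 1) ∈ _)
    have v2 := hs (by simp [bcorn] : K.P n m ∈ _)
    have v3 := hs (by simp [bcorn] : K.P (n + 1) m ∈ _)
    have v4 := hs (by simp [bcorn] : K.P (n + 1) (m + 1) ∈ _)
    rcases le_total (K.A x - n) (K.B x - m) with h | h
    · refine K.mem3 hc v2 v1 v4 (1 - (K.B x - m)) (K.B x - m - (K.A x - n)) (K.A x - n)
        ?_ ?_ ?_ ?_ ?_ ?_ <;> (try simp only [K.hA, K.hB]) <;> linarith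
    · refine K.mem3 hc v2 v3 v4 (1 - (K.A x - n)) (K.A x - n - (K.B x - m)) (K.B x - m)
        ?_ ?_ ?_ ?_ ?_ ?_ <;> (try simp only [K.hA, K.hB]) <;> linarith
  · exact convexHull_min (bcorn_sub K n m) (box_convex K n m)

lemma bcorn_ext (K : Crd) (n m : ℤ) : (box K n m).extremePoints ℝ = bcorn K n m := by
  apply subset_antisymm
  · rw [box_hull K]
    exact extremePoints_convexHull_subset
  · have key : ∀ v ∈ bcorn K n m, ∀ l m' : StrongDual ℝ (EucSp 2), (∀ x ∈ box K n m, l x ≤ l v) →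
        (∀ x ∈ box K n m, m' x ≤ m' v) →
        (∀ x, l x = l v → m' x = m' v → K.A x = K.A v ∧ K.B x = K.B v) →
        v ∈ (box K n m).extremePoints ℝ := fun v hv l m' h1 h2 h3 =>
      K.ext_pt (bcorn_sub K n m hv) l m' h1 h2 (fun x a b => K.ext (h3 x a b).1 (h3 x a b).2)
    intro v hv
    have hv' := hv
    rcases hv with rfl | rfl | rfl | rfl
    · refine key _ hv' (-K.A) K.B ?_ ?_ ?_ <;> intro x hx
      · simp only [neg_apply, K.hA]; linarith [mem_box.1 hx]
      · simp only [K.hB]; linarith [mem_box.1 hx]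
      · simp only [neg_apply, K.hA, K.hB] at *; intro h; constructor <;> linarith
    · refine key _ hv' (-K.A) (-K.B) ?_ ?_ ?_ <;> intro x hx
      · simp only [neg_apply, K.hA]; linarith [mem_box.1 hx]
      · simp only [neg_apply, K.hB]; linarith [mem_box.1 hx]
      · simp only [neg_apply, K.hA, K.hB] at *; intro h; constructor <;> linarith
    · refine key _ hv' K.A (-K.B) ?_ ?_ ?_ <;> intro x hx
      · simp only [K.hA]; linarith [mem_box.1 hx]
      · simp only [neg_apply, K.hB]; linarith [mem_box.1 hx]
      · simp only [neg_apply, K.hA, K.hB] at *; intro h; constructor <;> linarith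
    · refine key _ hv' K.A K.B ?_ ?_ ?_ <;> intro x hx
      · simp only [K.hA]; linarith [mem_box.1 hx]
      · simp only [K.hB]; linarith [mem_box.1 hx]
      · exact fun h => ⟨hx, h⟩

lemma bcorn_card (K : Crd) (n m : ℤ) : (bcorn K n m).ncard = 4 := by
  have hne : ∀ a b c d : ℝ, (a ≠ c ∨ b ≠ d) → K.P a b ≠ K.P c d := by
    intro a b c d h e
    have h1 := congrArg K.A e
    have h2 := congrArg K.B e
    simp only [K.hA, K.hB] at h1 h2
    tauto
  unfold bcorn
  rw [Set.ncard_insert_of_notMem, Set.ncard_insert_of_notMem, Set.ncard_pair]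
  · exact hne _ _ _ _ (Or.inr (by simp))
  · simp only [Set.mem_insert_iff, Set.mem_singleton_iff, not_or]
    exact ⟨hne _ _ _ _ (Or.inl (by simp)), hne _ _ _ _ (Or.inl (by simp))⟩
  · simp only [Set.mem_insert_iff, Set.mem_singleton_iff, not_or]
    exact ⟨hne _ _ _ _ (Or.inr (by simp)), hne _ _ _ _ (Or.inl (by simp)),
      hne _ _ _ _ (Or.inl (by simp))⟩

lemma box_polytope (K : Crd) (n m : ℤ) : IsConvexPolytope (box K n m) := by
  constructor
  · have : (bcorn K n m).Finite := by unfold bcorn; exact Set.toFinite _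
    refine ⟨this.toFinset, ?_⟩
    rw [Set.Finite.coe_toFinset]
    exact box_hull K n m
  · have ho : IsOpen (K.A ⁻¹' Set.Ioo (n : ℝ) (n + 1) ∩ K.B ⁻¹' Set.Ioo (m : ℝ) (m + 1)) :=
      (isOpen_Ioo.preimage K.A.continuous).inter (isOpen_Ioo.preimage K.B.continuous)
    have hs : K.A ⁻¹' Set.Ioo (n : ℝ) (n + 1) ∩ K.B ⁻¹' Set.Ioo (m : ℝ) (m + 1) ⊆ box K n m := by
      rintro x ⟨⟨a1, a2⟩, b1, b2⟩
      exact ⟨⟨a1.le, a2.le⟩, b1.le, b2.le⟩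
    refine ⟨K.P (n + 1 / 2) (m + 1 / 2), interior_maximal hs ho ?_⟩
    simp only [Set.mem_inter_iff, Set.mem_preimage, Set.mem_Ioo, K.hA, K.hB]
    refine ⟨⟨?_, ?_⟩, ?_, ?_⟩ <;> linarith

lemma slab_A (K : Crd) (n m k : ℤ) :
    IsExposed ℝ (box K n m) {x ∈ box K n m | (k : ℝ) ≤ K.A x ∧ K.A x ≤ k + 1} := by
  have := exposed_slab_int (t := box K n m) K.A n k 1 0 (by norm_num)
    (fun x hx => by have := mem_box.1 hx; constructor <;> linarith)
  simpa using this

lemma slab_B (K : Crd) (n m k : ℤ) :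
    IsExposed ℝ (box K n m) {x ∈ box K n m | (k : ℝ) ≤ K.B x ∧ K.B x ≤ k + 1} := by
  have := exposed_slab_int (t := box K n m) K.B m k 1 0 (by norm_num)
    (fun x hx => by have := mem_box.1 hx; constructor <;> linarith)
  simpa using this

/-- The diagonal slabs. -/
lemma slab_C (K : Crd) (n m k : ℤ) (h : -n - m ≤ k ∨ k + 1 ≤ -n - m - 2) :
    IsExposed ℝ (box K n m) {x ∈ box K n m | (k : ℝ) ≤ -K.A x - K.B x ∧ -K.A x - K.B x ≤ k + 1} := by
  have := exposed_slab (t := box K n m) (-K.A - K.B) (lo := k) (hi := k + 1) (by linarith) ?_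
  · simpa only [sub_apply, neg_apply] using this
  · simp only [sub_apply, neg_apply]
    rcases h with h | h
    · right; left
      intro x hx
      have := mem_box.1 hx
      have h' : ((-n - m : ℤ) : ℝ) ≤ k := Int.cast_le.2 h
      push_cast at h'
      linarith
    · left
      intro x hx
      have := mem_box.1 hx
      have h' : ((k + 1 : ℤ) : ℝ) ≤ (-n - m - 2 : ℤ) := Int.cast_le.2 h
      push_cast at h'
      linarith

lemma exp_congr {t s s' : Set (EucSp 2)} (h : IsExposed ℝ t s) (e : s' = s) : IsExposed ℝ t s' :=
  e ▸ h

lemma box_exp0 (K : Crd) (n m n' m' : ℤ) :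
    IsExposed ℝ (box K n m) (box K n m ∩ box K n' m') := by
  refine exp_congr ((slab_A K n m n').inter (slab_B K n m m')) ?_
  ext x
  simp only [Set.mem_inter_iff, Set.mem_ofPred_eq, mem_box (n := n')]
  tauto

lemma box_exp1 (K : Crd) (n m n' m' : ℤ) (h : (3 : ℤ) ∣ n - m - 1) (h' : (3 : ℤ) ∣ n' - m' - 1) :
    IsExposed ℝ (box K n m) (box K n m ∩ box K.rot n' m') := by
  have far : n' ≠ m → n' ≠ m + 1 → n' ≠ m - 1 → box K n m ∩ box K.rot n' m' = ∅ := by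
    intro h1 h2 h3
    rw [Set.eq_empty_iff_forall_notMem]
    rintro x ⟨hx, hx'⟩
    obtain ⟨-, b1, b2⟩ := mem_box.1 hx
    obtain ⟨⟨c1, c2⟩, -⟩ := mem_box.1 hx'
    rw [Crd.rot_A] at c1 c2
    have e1 : (n' : ℝ) ≤ (m + 1 : ℤ) := by push_cast; linarith
    have e2 : (m : ℝ) ≤ (n' + 1 : ℤ) := by push_cast; linarith
    rw [Int.cast_le] at e1 e2
    omega
  by_cases h1 : n' = m
  · subst h1
    refine exp_congr (slab_C K n n' m' (by omega)) ?_
    ext x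
    simp only [Set.mem_inter_iff, Set.mem_ofPred_eq, mem_box, Crd.rot_A, Crd.rot_B]
    tauto
  by_cases h2 : n' = m + 1
  · subst h2
    refine exp_congr ((slab_B K n m (m + 1)).inter (slab_A K n m (-m' - m - 2))) ?_
    ext x
    simp only [Set.mem_inter_iff, Set.mem_ofPred_eq, mem_box, Crd.rot_A, Crd.rot_B]
    push_cast
    constructor
    · rintro ⟨⟨⟨a1, a2⟩, b1, b2⟩, ⟨c1, c2⟩, d1, d2⟩
      refine ⟨⟨⟨⟨?_, ?_⟩, ?_, ?_⟩, ?_, ?_⟩, ⟨⟨?_, ?_⟩, ?_, ?_⟩, ?_, ?_⟩ <;> linarith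
    · rintro ⟨⟨⟨⟨a1, a2⟩, b1, b2⟩, c1, c2⟩, -, d1, d2⟩
      refine ⟨⟨⟨?_, ?_⟩, ?_, ?_⟩, ⟨?_, ?_⟩, ?_, ?_⟩ <;> linarith
  by_cases h3 : n' = m - 1
  · subst h3
    refine exp_congr ((slab_B K n m (m - 1)).inter (slab_A K n m (-m' - m - 1))) ?_
    ext x
    simp only [Set.mem_inter_iff, Set.mem_ofPred_eq, mem_box, Crd.rot_A, Crd.rot_B]
    push_cast
    constructor
    · rintro ⟨⟨⟨a1, a2⟩, b1, b2⟩, ⟨c1, c2⟩, d1, d2⟩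
      refine ⟨⟨⟨⟨?_, ?_⟩, ?_, ?_⟩, ?_, ?_⟩, ⟨⟨?_, ?_⟩, ?_, ?_⟩, ?_, ?_⟩ <;> linarith
    · rintro ⟨⟨⟨⟨a1, a2⟩, b1, b2⟩, c1, c2⟩, -, d1, d2⟩
      refine ⟨⟨⟨?_, ?_⟩, ?_, ?_⟩, ⟨?_, ?_⟩, ?_, ?_⟩ <;> linarith
  rw [far h1 h2 h3]
  exact isExposed_empty

lemma mem_box2 {K : Crd} {n m : ℤ} {x : EucSp 2} : x ∈ box K.rot.rot n m ↔
    ((n : ℝ) ≤ -K.A x - K.B x ∧ -K.A x - K.B x ≤ n + 1) ∧ ((m : ℝ) ≤ K.A x ∧ K.A x ≤ m + 1) := by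
  have e1 : -K.B x - (-K.A x - K.B x) = K.A x := by ring
  simp only [mem_box, Crd.rot_A, Crd.rot_B, e1]

lemma box_exp2 (K : Crd) (n m n' m' : ℤ) (h : (3 : ℤ) ∣ n - m - 1) (h' : (3 : ℤ) ∣ n' - m' - 1) :
    IsExposed ℝ (box K n m) (box K n m ∩ box K.rot.rot n' m') := by
  have far : m' ≠ n → m' ≠ n + 1 → m' ≠ n - 1 → box K n m ∩ box K.rot.rot n' m' = ∅ := by
    intro h1 h2 h3
    rw [Set.eq_empty_iff_forall_notMem]
    rintro x ⟨hx, hx'⟩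
    obtain ⟨⟨b1, b2⟩, -⟩ := mem_box.1 hx
    obtain ⟨-, c1, c2⟩ := mem_box2.1 hx'
    have e1 : (m' : ℝ) ≤ (n + 1 : ℤ) := by push_cast; linarith
    have e2 : (n : ℝ) ≤ (m' + 1 : ℤ) := by push_cast; linarith
    rw [Int.cast_le] at e1 e2
    omega
  by_cases h1 : m' = n
  · subst h1
    refine exp_congr (slab_C K m' m n' (by omega)) ?_
    ext x
    simp only [Set.mem_inter_iff, Set.mem_ofPred_eq, mem_box2, mem_box (K := K)]
    tauto
  by_cases h2 : m' = n + 1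
  · subst h2
    refine exp_congr ((slab_A K n m (n + 1)).inter (slab_B K n m (-n' - n - 2))) ?_
    ext x
    simp only [Set.mem_inter_iff, Set.mem_ofPred_eq, mem_box2, mem_box (K := K)]
    push_cast
    constructor
    · rintro ⟨⟨⟨a1, a2⟩, b1, b2⟩, ⟨c1, c2⟩, d1, d2⟩
      refine ⟨⟨⟨⟨?_, ?_⟩, ?_, ?_⟩, ?_, ?_⟩, ⟨⟨?_, ?_⟩, ?_, ?_⟩, ?_, ?_⟩ <;> linarith
    · rintro ⟨⟨⟨⟨a1, a2⟩, b1, b2⟩, c1, c2⟩, -, d1, d2⟩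
      refine ⟨⟨⟨?_, ?_⟩, ?_, ?_⟩, ⟨?_, ?_⟩, ?_, ?_⟩ <;> linarith
  by_cases h3 : m' = n - 1
  · subst h3
    refine exp_congr ((slab_A K n m (n - 1)).inter (slab_B K n m (-n' - n - 1))) ?_
    ext x
    simp only [Set.mem_inter_iff, Set.mem_ofPred_eq, mem_box2, mem_box (K := K)]
    push_cast
    constructor
    · rintro ⟨⟨⟨a1, a2⟩, b1, b2⟩, ⟨c1, c2⟩, d1, d2⟩
      refine ⟨⟨⟨⟨?_, ?_⟩, ?_, ?_⟩, ?_, ?_⟩, ⟨⟨?_, ?_⟩, ?_, ?_⟩, ?_, ?_⟩ <;> linarith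
    · rintro ⟨⟨⟨⟨a1, a2⟩, b1, b2⟩, c1, c2⟩, -, d1, d2⟩
      refine ⟨⟨⟨?_, ?_⟩, ?_, ?_⟩, ⟨?_, ?_⟩, ?_, ?_⟩ <;> linarith
  rw [far h1 h2 h3]
  exact isExposed_empty

/-- The rhombi of one direction. -/
def RB (K : Crd) : Set (Set (EucSp 2)) :=
  {t | ∃ n m : ℤ, (3 : ℤ) ∣ n - m - 1 ∧ t = box K n m}

/-- The rhombille tiling in coordinates. -/
def RH (K : Crd) : Set (Set (EucSp 2)) := RB K ∪ RB K.rot ∪ RB K.rot.rot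

lemma RB_rot3 (K : Crd) : RB K.rot.rot.rot = RB K := by
  unfold RB
  simp only [box_rot3]

lemma RH_rot (K : Crd) : RH K.rot = RH K := by
  unfold RH
  rw [RB_rot3, Set.union_comm, Set.union_assoc]

lemma RH_cases (K : Crd) {t : Set (EucSp 2)} (ht : t ∈ RH K) :
    ∃ K' : Crd, RH K' = RH K ∧ ∃ n m : ℤ, (3 : ℤ) ∣ n - m - 1 ∧ t = box K' n m := by
  rcases ht with (ht | ht) | ht
  · exact ⟨K, rfl, ht⟩
  · exact ⟨K.rot, RH_rot K, ht⟩
  · exact ⟨K.rot.rot, (RH_rot _).trans (RH_rot K), ht⟩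

lemma RH_exposed (K : Crd) {t s : Set (EucSp 2)} (ht : t ∈ RH K) (hs : s ∈ RH K) :
    IsExposed ℝ t (t ∩ s) := by
  obtain ⟨K', e, n, m, h, rfl⟩ := RH_cases K ht
  rw [← e] at hs
  rcases hs with (⟨n', m', h', rfl⟩ | ⟨n', m', h', rfl⟩) | ⟨n', m', h', rfl⟩
  · exact box_exp0 _ _ _ _ _
  · exact box_exp1 _ _ _ _ _ h h'
  · exact box_exp2 _ _ _ _ _ h h'

lemma RH_covers (K : Crd) (x : EucSp 2) : ∃ t ∈ RH K, x ∈ t := by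
  have a1 := Int.floor_le (K.A x)
  have a2 := Int.lt_floor_add_one (K.A x)
  have b1 := Int.floor_le (K.B x)
  have b2 := Int.lt_floor_add_one (K.B x)
  set p := ⌊K.A x⌋
  set q := ⌊K.B x⌋
  have hmod : (3 : ℤ) ∣ p - q - 1 ∨ (3 : ℤ) ∣ p - q ∨ (3 : ℤ) ∣ p - q - 2 := by omega
  rcases hmod with h | h | h
  · exact ⟨_, Or.inl (Or.inl ⟨p, q, h, rfl⟩), ⟨a1, a2.le⟩, b1, b2.le⟩
  · rcases le_total (K.A x + K.B x) (p + q + 1) with hc | hc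
    · refine ⟨_, Or.inl (Or.inr ⟨q, -p - q - 1, by omega, rfl⟩), ?_⟩
      rw [mem_box, Crd.rot_A, Crd.rot_B]
      push_cast
      refine ⟨⟨?_, ?_⟩, ?_, ?_⟩ <;> linarith
    · refine ⟨_, Or.inr ⟨-p - q - 2, p, by omega, rfl⟩, ?_⟩
      rw [mem_box2]
      push_cast
      refine ⟨⟨?_, ?_⟩, ?_, ?_⟩ <;> linarith
  · rcases le_total (K.A x + K.B x) (p + q + 1) with hc | hc
    · refine ⟨_, Or.inr ⟨-p - q - 1, p, by omega, rfl⟩, ?_⟩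
      rw [mem_box2]
      push_cast
      refine ⟨⟨?_, ?_⟩, ?_, ?_⟩ <;> linarith
    · refine ⟨_, Or.inl (Or.inr ⟨q, -p - q - 2, by omega, rfl⟩), ?_⟩
      rw [mem_box, Crd.rot_A, Crd.rot_B]
      push_cast
      refine ⟨⟨?_, ?_⟩, ?_, ?_⟩ <;> linarith

lemma RB_fin (K : Crd) {B : Set (EucSp 2)} (hB : Bornology.IsBounded B) :
    {t ∈ RB K | (t ∩ B).Nonempty}.Finite := by
  obtain ⟨M, hM⟩ := dual_bdd K.A hB
  obtain ⟨N, hN⟩ := dual_bdd K.B hB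
  have hf : (Set.Icc (-(M : ℤ) - 1) (M + 1) ×ˢ Set.Icc (-(N : ℤ) - 1) (N + 1)).Finite :=
    (Set.finite_Icc _ _).prod (Set.finite_Icc _ _)
  refine (hf.image (fun z => box K z.1 z.2)).subset ?_
  rintro t ⟨⟨n, m, hm, rfl⟩, x, hx, hxB⟩
  refine ⟨(n, m), ?_, rfl⟩
  obtain ⟨⟨a1, a2⟩, b1, b2⟩ := mem_box.1 hx
  have h1 := abs_le.1 (hM x hxB)
  have h2 := abs_le.1 (hN x hxB)
  have e1 : (n : ℝ) ≤ (M + 1 : ℤ) := by push_cast; linarith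
  have e2 : ((-M - 1 : ℤ) : ℝ) ≤ n := by push_cast; linarith
  have e3 : (m : ℝ) ≤ (N + 1 : ℤ) := by push_cast; linarith
  have e4 : ((-N - 1 : ℤ) : ℝ) ≤ m := by push_cast; linarith
  rw [Int.cast_le] at e1 e2 e3 e4
  simp only [Set.mem_prod, Set.mem_Icc]
  omega

lemma RH_tiling (K : Crd) : IsLFCTiling (RH K) := by
  constructor
  · intro t ht
    obtain ⟨K', e, n, m, h, rfl⟩ := RH_cases K ht
    exact box_polytope K' n m
  · rw [Set.eq_univ_iff_forall]
    exact RH_covers K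
  · intro t ht s hs
    exact ⟨RH_exposed K ht hs, by rw [Set.inter_comm]; exact RH_exposed K hs ht⟩
  · intro B hB
    refine (((RB_fin K hB).union (RB_fin K.rot hB)).union (RB_fin K.rot.rot hB)).subset ?_
    rintro t ⟨(ht | ht) | ht, h⟩
    · exact Or.inl (Or.inl ⟨ht, h⟩)
    · exact Or.inl (Or.inr ⟨ht, h⟩)
    · exact Or.inr ⟨ht, h⟩

end rhomb

open scoped Classical

section rhomb2

lemma box_inj (K : Crd) {n m n' m' : ℤ} (h : box K n m = box K n' m') : n = n' ∧ m = m' := by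
  have h1 : K.P n m ∈ box K n' m' := h ▸ bcorn_sub K n m (by simp [bcorn])
  have h2 : K.P n' m' ∈ box K n m := h ▸ bcorn_sub K n' m' (by simp [bcorn])
  rw [mem_box, K.hA, K.hB] at h1 h2
  obtain ⟨⟨a1, -⟩, b1, -⟩ := h1
  obtain ⟨⟨a2, -⟩, b2, -⟩ := h2
  rw [Int.cast_le] at a1 a2 b1 b2
  omega

lemma box_ne_rot (K : Crd) (n m n' m' : ℤ) : box K n m ≠ box K.rot n' m' := by
  intro h
  have h1 : K.P n m ∈ box K.rot n' m' := h ▸ bcorn_sub K n m (by simp [bcorn])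
  have h2 : K.P (n + 1) (m + 1) ∈ box K.rot n' m' := h ▸ bcorn_sub K n m (by simp [bcorn])
  rw [mem_box, Crd.rot_A, Crd.rot_B, K.hA, K.hB] at h1 h2
  linarith [h1.2.1, h1.2.2, h2.2.1, h2.2.2]

lemma RB_disj (K : Crd) {t : Set (EucSp 2)} (h1 : t ∈ RB K) (h2 : t ∈ RB K.rot) : False := by
  obtain ⟨n, m, -, rfl⟩ := h1
  obtain ⟨n', m', -, e⟩ := h2
  exact box_ne_rot K _ _ _ _ e

lemma box_int {K : Crd} {v : EucSp 2} {p q n m : ℤ} (hA : K.A v = p) (hB : K.B v = q) :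
    v ∈ box K n m ↔ (n ≤ p ∧ p ≤ n + 1) ∧ m ≤ q ∧ q ≤ m + 1 := by
  rw [mem_box, hA, hB]
  norm_cast

lemma RB_two {K : Crd} {v : EucSp 2} {p q : ℤ} (hA : K.A v = p) (hB : K.B v = q)
    (h : (3 : ℤ) ∣ p - q - 1) :
    {t ∈ RB K | v ∈ t} = {box K p q, box K (p - 1) (q - 1)} := by
  ext t
  simp only [Set.mem_ofPred_eq, Set.mem_insert_iff, Set.mem_singleton_iff]
  constructor
  · rintro ⟨⟨n, m, hd, rfl⟩, hv⟩
    rw [box_int hA hB] at hv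
    have : (n = p ∧ m = q) ∨ (n = p - 1 ∧ m = q - 1) := by omega
    rcases this with ⟨rfl, rfl⟩ | ⟨rfl, rfl⟩
    · exact Or.inl rfl
    · exact Or.inr rfl
  · rintro (rfl | rfl)
    · exact ⟨⟨p, q, h, rfl⟩, (box_int hA hB).2 (by omega)⟩
    · exact ⟨⟨p - 1, q - 1, by omega, rfl⟩, (box_int hA hB).2 (by omega)⟩

lemma RB_two_card {K : Crd} {v : EucSp 2} {p q : ℤ} (hA : K.A v = p) (hB : K.B v = q)
    (h : (3 : ℤ) ∣ p - q - 1) : {t ∈ RB K | v ∈ t}.ncard = 2 := by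
  rw [RB_two hA hB h, Set.ncard_pair]
  intro e
  have := box_inj K e
  omega

lemma RB_one {K : Crd} {v : EucSp 2} {p q : ℤ} (hA : K.A v = p) (hB : K.B v = q)
    (h : ¬ (3 : ℤ) ∣ p - q - 1) : {t ∈ RB K | v ∈ t}.ncard ≤ 1 := by
  have : ∃ n m : ℤ, {t ∈ RB K | v ∈ t} ⊆ {box K n m} := by
    have h0 : (3 : ℤ) ∣ p - q ∨ (3 : ℤ) ∣ p - q - 2 := by omega
    rcases h0 with h0 | h0
    · refine ⟨p, q - 1, ?_⟩
      rintro t ⟨⟨n, m, hd, rfl⟩, hv⟩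
      rw [box_int hA hB] at hv
      have : n = p ∧ m = q - 1 := by omega
      rw [this.1, this.2]
      rfl
    · refine ⟨p - 1, q, ?_⟩
      rintro t ⟨⟨n, m, hd, rfl⟩, hv⟩
      rw [box_int hA hB] at hv
      have : n = p - 1 ∧ m = q := by omega
      rw [this.1, this.2]
      rfl
  obtain ⟨n, m, hs⟩ := this
  exact (Set.ncard_le_ncard hs (Set.finite_singleton _)).trans (Set.ncard_singleton _).le

lemma RH_split (K : Crd) (v : EucSp 2) : {t ∈ RH K | v ∈ t} =
    {t ∈ RB K | v ∈ t} ∪ {t ∈ RB K.rot | v ∈ t} ∪ {t ∈ RB K.rot.rot | v ∈ t} := by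
  ext t
  simp only [RH, Set.mem_union, Set.mem_ofPred_eq]
  tauto

lemma RH_d6 {K : Crd} {v : EucSp 2} {p q : ℤ} (hA : K.A v = p) (hB : K.B v = q)
    (h : (3 : ℤ) ∣ p - q - 1) : {t ∈ RH K | v ∈ t}.ncard = 6 := by
  have hA1 : K.rot.A v = q := by rw [Crd.rot_A, hB]
  have hB1 : K.rot.B v = (-p - q : ℤ) := by rw [Crd.rot_B, hA, hB]; push_cast; ring
  have hA2 : K.rot.rot.A v = (-p - q : ℤ) := by rw [Crd.rot_A, hB1]
  have hB2 : K.rot.rot.B v = p := by rw [Crd.rot_B, hA1, hB1]; push_cast; ring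
  have c0 := RB_two_card hA hB h
  have c1 := RB_two_card hA1 hB1 (by omega)
  have c2 := RB_two_card hA2 hB2 (by omega)
  have f0 : {t ∈ RB K | v ∈ t}.Finite := Set.finite_of_ncard_ne_zero (by omega)
  have f1 : {t ∈ RB K.rot | v ∈ t}.Finite := Set.finite_of_ncard_ne_zero (by omega)
  have f2 : {t ∈ RB K.rot.rot | v ∈ t}.Finite := Set.finite_of_ncard_ne_zero (by omega)
  rw [RH_split, Set.ncard_union_eq _ (f0.union f1) f2, Set.ncard_union_eq _ f0 f1, c0, c1, c2]
  · rw [Set.disjoint_left]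
    rintro t ⟨h0, -⟩ ⟨h1, -⟩
    exact RB_disj K h0 h1
  · rw [Set.disjoint_left]
    rintro t (⟨h0, -⟩ | ⟨h0, -⟩) ⟨h1, -⟩
    · rw [← RB_rot3] at h0
      exact RB_disj K.rot.rot h1 h0
    · exact RB_disj K.rot h0 h1

lemma RH_d3 {K : Crd} {v : EucSp 2} {p q : ℤ} (hA : K.A v = p) (hB : K.B v = q)
    (h : ¬ (3 : ℤ) ∣ p - q - 1) : {t ∈ RH K | v ∈ t}.ncard ≤ 3 := by
  have hA1 : K.rot.A v = q := by rw [Crd.rot_A, hB]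
  have hB1 : K.rot.B v = (-p - q : ℤ) := by rw [Crd.rot_B, hA, hB]; push_cast; ring
  have hA2 : K.rot.rot.A v = (-p - q : ℤ) := by rw [Crd.rot_A, hB1]
  have hB2 : K.rot.rot.B v = p := by rw [Crd.rot_B, hA1, hB1]; push_cast; ring
  have c0 := RB_one hA hB h
  have c1 := RB_one hA1 hB1 (by omega)
  have c2 := RB_one hA2 hB2 (by omega)
  rw [RH_split]
  refine (Set.ncard_union_le _ _).trans ?_
  have := Set.ncard_union_le {t ∈ RB K | v ∈ t} {t ∈ RB K.rot | v ∈ t}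
  omega

lemma bcorn_coord {K : Crd} {n m : ℤ} {v : EucSp 2} (hv : v ∈ bcorn K n m) :
    ∃ p q : ℤ, K.A v = p ∧ K.B v = q ∧ (p = n ∨ p = n + 1) ∧ (q = m ∨ q = m + 1) := by
  rcases hv with rfl | rfl | rfl | rfl
  · exact ⟨n, m + 1, by simp, by simp, by simp, by simp⟩
  · exact ⟨n, m, by simp, by simp, by simp, by simp⟩
  · exact ⟨n + 1, m, by simp, by simp, by simp, by simp⟩
  · exact ⟨n + 1, m + 1, by simp, by simp, by simp, by simp⟩

lemma RH_edge {K : Crd} {n m : ℤ} {v w : EucSp 2} (hv : v ∈ bcorn K n m) (hw : w ∈ bcorn K n m)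
    (he : IsExposed ℝ (box K n m) (segment ℝ v w)) {p q p' q' : ℤ}
    (a : K.A v = p) (b : K.B v = q) (a' : K.A w = p') (b' : K.B w = q')
    (hp : p = n ∨ p = n + 1) (hq : q = m ∨ q = m + 1)
    (hp' : p' = n ∨ p' = n + 1) (hq' : q' = m ∨ q' = m + 1) : p = p' ∨ q = q' := by
  by_contra hcon
  push Not at hcon
  obtain ⟨h1, h2⟩ := hcon
  have hx : K.P p q' ∈ bcorn K n m := by
    rcases hp with rfl | rfl <;> rcases hq' with rfl | rfl <;> simp [bcorn]
  have hy : K.P p' q ∈ bcorn K n m := by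
    rcases hp' with rfl | rfl <;> rcases hq with rfl | rfl <;> simp [bcorn]
  have := not_diag he (bcorn_sub _ _ _ hv) (bcorn_sub _ _ _ hw) (x := K.P p q') (y := K.P p' q)
    (by rw [bcorn_ext]; exact hx) (bcorn_sub _ _ _ hy) (by
      apply K.ext
      · simp only [map_add, K.hA, a, a']
      · simp only [map_add, K.hB, b, b']; ring)
  rcases this with e | e
  · have := congrArg K.B e
    rw [K.hB, b, Int.cast_inj] at this
    exact h2 this.symm
  · have := congrArg K.A e
    rw [K.hA, a', Int.cast_inj] at this
    exact h1 this

lemma RH_typB (K : Crd) : TypB (RH_tiling K) := by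
  intro Φ
  have d0 := Φ.d_ge (RH_tiling K)
  have d1 := Φ.s0.d_ge (RH_tiling K)
  have ev := Φ.v_ext
  have ew := Φ.w_ext
  have ex := Φ.exp
  obtain ⟨K', e, n, m, h, ht⟩ := RH_cases K Φ.mem
  have hn : Φ.n (RH_tiling K) = 4 := by
    rw [Fl.n_eq, ht, bcorn_ext, bcorn_card]
  rw [Fl.d_eq] at d0 d1
  rw [Fl.d_eq, Fl.d_eq]
  have es : Φ.s0.v = Φ.w := rfl
  rw [es] at d1 ⊢
  rw [ht] at ex
  rw [ht, bcorn_ext] at ev ew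
  refine ⟨hn, ?_⟩
  obtain ⟨p, q, a, b, hp, hq⟩ := bcorn_coord ev
  obtain ⟨p', q', a', b', hp', hq'⟩ := bcorn_coord ew
  have hed := RH_edge ev ew ex a b a' b' hp hq hp' hq'
  have hz : ¬ (p = p' ∧ q = q') := by
    rintro ⟨rfl, rfl⟩
    exact Φ.ne (K'.ext (a.trans a'.symm) (b.trans b'.symm))
  by_cases hc : (3 : ℤ) ∣ p - q - 1
  · have hc' : ¬ (3 : ℤ) ∣ p' - q' - 1 := by omega
    have i1 := RH_d6 a b hc
    have i2 := RH_d3 a' b' hc'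
    rw [e] at i1 i2
    exact ⟨by omega, by omega⟩
  · have hc' : (3 : ℤ) ∣ p' - q' - 1 := by omega
    have i1 := RH_d6 a' b' hc'
    have i2 := RH_d3 a b hc
    rw [e] at i1 i2
    exact ⟨by omega, by omega⟩

/-- Coordinates for the rhombille tiling. -/
noncomputable def KRH : Crd where
  A := lin (2 / Real.sqrt 3) 0
  B := lin (-(1 / Real.sqrt 3)) 1
  P := fun a b => pt2 (Real.sqrt 3 / 2 * a) (a / 2 + b)
  hA := by
    intro a b
    have : Real.sqrt 3 ≠ 0 := by positivity
    simp [pt2]; field_simp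
  hB := by
    intro a b
    have : Real.sqrt 3 ≠ 0 := by positivity
    simp [pt2]; field_simp; ring
  hP := by
    intro x
    have : Real.sqrt 3 ≠ 0 := by positivity
    apply ext2
    · simp [pt2]; field_simp
    · simp [pt2]; field_simp; ring

lemma KRH_P (a b c d a' b' : ℝ) (h1 : a + c = Real.sqrt 3 / 2 * a')
    (h2 : b + d = a' / 2 + b') : pt2 a b + pt2 c d = KRH.P a' b' := by
  apply ext2
  · simpa [pt2, KRH] using h1
  · simpa [pt2, KRH] using h2

lemma rlat_pt (a b : ℤ) : a • pt2 (Real.sqrt 3) 0 + b • pt2 (Real.sqrt 3 / 2) (3 / 2) =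
    pt2 (a * Real.sqrt 3 + b * (Real.sqrt 3 / 2)) (b * (3 / 2)) := by
  apply ext2 <;> simp [pt2]

lemma r3_eq (a b : ℤ) : (fun x => x + (a • pt2 (Real.sqrt 3) 0 + b • pt2 (Real.sqrt 3 / 2) (3 / 2))) ''
    rhombTile3 = box KRH (2 * a + b) (-a + b - 1) := by
  rw [box_hull, bcorn, rhombTile3, translate_hull, rlat_pt]
  simp only [Set.image_insert_eq, Set.image_singleton]
  congr 1
  push_cast
  congr 1
  · apply KRH_P <;> ring
  congr 1
  · apply KRH_P <;> ring
  congr 1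
  · apply KRH_P <;> ring
  congr 1
  · apply KRH_P <;> ring

lemma r1_eq (a b : ℤ) : (fun x => x + (a • pt2 (Real.sqrt 3) 0 + b • pt2 (Real.sqrt 3 / 2) (3 / 2))) ''
    rhombTile1 = box KRH.rot (-a + b) (-a - 2 * b - 1) := by
  rw [box_hull, bcorn, rhombTile1, translate_hull, rlat_pt]
  simp only [Set.image_insert_eq, Set.image_singleton, Crd.rot]
  congr 1
  push_cast
  congr 1
  · apply KRH_P <;> ring
  congr 1
  · apply KRH_P <;> ring
  congr 1
  · apply KRH_P <;> ring
  congr 1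
  · apply KRH_P <;> ring

lemma r2_eq (a b : ℤ) : (fun x => x + (a • pt2 (Real.sqrt 3) 0 + b • pt2 (Real.sqrt 3 / 2) (3 / 2))) ''
    rhombTile2 = box KRH.rot.rot (-a - 2 * b) (2 * a + b - 1) := by
  rw [box_hull, bcorn, rhombTile2, translate_hull, rlat_pt]
  simp only [Set.image_insert_eq, Set.image_singleton, Crd.rot]
  congr 1
  push_cast
  congr 1
  · apply KRH_P <;> ring
  congr 1
  · apply KRH_P <;> ring
  congr 1
  · apply KRH_P <;> ring
  congr 1
  · apply KRH_P <;> ring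

lemma rhomb_eq : RhombilleTiling = RH KRH := by
  ext t
  constructor
  · rintro ⟨v, ⟨a, b, rfl⟩, rfl | rfl | rfl⟩
    · exact Or.inl (Or.inr ⟨_, _, by omega, r1_eq a b⟩)
    · exact Or.inr ⟨_, _, by omega, r2_eq a b⟩
    · exact Or.inl (Or.inl ⟨_, _, by omega, r3_eq a b⟩)
  · rintro ((⟨n, m, ⟨k, hk⟩, rfl⟩ | ⟨n, m, ⟨k, hk⟩, rfl⟩) | ⟨n, m, ⟨k, hk⟩, rfl⟩)
    · refine ⟨_, ⟨k, n - 2 * k, rfl⟩, Or.inr (Or.inr ?_)⟩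
      rw [r3_eq]; congr 1 <;> omega
    · refine ⟨_, ⟨k - n, k, rfl⟩, Or.inl ?_⟩
      rw [r1_eq]; congr 1 <;> omega
    · refine ⟨_, ⟨m + 1 + k, -k - (m + 1 + k), rfl⟩, Or.inr (Or.inl ?_)⟩
      rw [r2_eq]; congr 1 <;> omega

end rhomb2

end mywork

/-- Every normal combinatorially two-orbit LFC tiling of the plane has
face poset order-isomorphic to that of the trihexagonal tiling or that of the rhombille
tiling. -/
theorem normal_two_orbit_planar_tiling_classification (T : Set (Set (EucSp 2)))
    (hT : IsLFCTiling T) (hnorm : IsNormalTiling T) (h2 : TwoFlagOrbits (TPoset T)) :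
    Nonempty (TPoset T ≃o TPoset TrihexagonalTiling) ∨
    Nonempty (TPoset T ≃o TPoset RhombilleTiling) := by
  rcases two_orbit_numeric hT hnorm h2 with h | h
  · left
    rw [trihex_eq]
    exact TypA.iso (hT := hT) h (TH_typA KTH)
  · right
    rw [rhomb_eq]
    exact TypB.iso (hT := hT) h (RH_typB KRH)
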